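/- arXiv:2503.03728 — 2 statements merged into one kernel-verified Lean document; each statement's English description precedes it below -/
import Mathlib

section
/- Let R = k[x_1,…,x_d] and let φ = [Φ₁; Φ₂] be an n×(n−1) matrix of linear forms with a = d, where Φ₂ is the lower (n−d)×(n−1) block, I = I_{n−1}(φ) has height 2, and assume ht I_{n−d}(Φ₂) = d. Let f_1,…,f_n denote the ordered signed (n−1)-minors of φ and let J = (f_1,…,f_d) be the ideal generated by the minors fixing the rows of Φ₂. Then (x_1,…,x_d)^{n−d}·I = (x_1,…,x_d)^{n−d}·J; in particular (x_1,…,x_d)^{n−d}·(f_{d+1},…,f_n) ⊆ (x_1,…,x_d)^{n−d}·J. -/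
open Matrix MvPolynomial

noncomputable section

def idealHeight {A : Type*} [CommRing A] (I : Ideal A) : ℕ∞ :=
  ⨅ (P : PrimeSpectrum A) (_ : I ≤ P.asIdeal), Order.height P

def minorsIdeal {A : Type*} [CommRing A] {p q : ℕ} (t : ℕ)
    (M : Matrix (Fin p) (Fin q) A) : Ideal A :=
  Ideal.span { x | ∃ (r : Fin t → Fin p) (c : Fin t → Fin q),
    Function.Injective r ∧ Function.Injective c ∧ x = (M.submatrix r c).det }

/-- Condition `G_s` of Artin–Nagata: for every prime `P ⊇ L` with `ht P ≤ s − 1`,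
the localization `L_P` can be generated by at most `ht P` elements. -/
def CondG {A : Type*} [CommRing A] (L : Ideal A) (s : ℕ) : Prop :=
  ∀ P : Ideal A, P.IsPrime → L ≤ P → idealHeight P + 1 ≤ (s : ℕ∞) →
    ∃ c : ℕ, (c : ℕ∞) ≤ idealHeight P ∧ ∃ g : Fin c → A, (∀ i, g i ∈ L) ∧
      ∀ x ∈ L, ∃ u ∉ P, u * x ∈ Ideal.span (Set.range g)

/-- The skew-symmetric matrix of signed `m × m` minors (obtained by omitting two columns)
of an `m × (m+2)` matrix; this is the middle differential of the Buchsbaum–Rim complex. -/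
def bbrim {A : Type*} [CommRing A] {m : ℕ} (ψ : Matrix (Fin m) (Fin (m + 2)) A) :
    Matrix (Fin (m + 2)) (Fin (m + 2)) A :=
  Matrix.of fun i j =>
    if h : (i : ℕ) < (j : ℕ) then
      (-1) ^ ((i : ℕ) + (j : ℕ)) *
        (ψ.submatrix id (fun q => j.succAbove
          ((⟨(i : ℕ), by have := j.isLt; omega⟩ : Fin (m + 1)).succAbove q))).det
    else if h' : (j : ℕ) < (i : ℕ) then
      (-1) ^ ((i : ℕ) + (j : ℕ) + 1) *
        (ψ.submatrix id (fun q => i.succAbove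
          ((⟨(j : ℕ), by have := i.isLt; omega⟩ : Fin (m + 1)).succAbove q))).det
    else 0

def rowMap {A : Type*} [CommRing A] {ι : Type*} [Fintype ι] (g : ι → A) :
    (ι → A) →ₗ[A] A :=
  ∑ i, g i • LinearMap.proj i

/-- Data of a (necessarily minimal) graded free resolution
`0 → ⊕_j R(−a_j) → ⊕_i R(−b_i) → I → 0` of an ideal of a polynomial ring. -/
def HasResolutionData {A : Type*} [CommRing A] {σ : Type*} (I : Ideal (MvPolynomial σ A))
    {N M : ℕ} (b : Fin N → ℕ) (a : Fin M → ℕ) : Prop :=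
  ∃ (g : Fin N → MvPolynomial σ A) (φ : Matrix (Fin N) (Fin M) (MvPolynomial σ A)),
    (∀ i, (g i).IsHomogeneous (b i)) ∧ Ideal.span (Set.range g) = I ∧
    (∀ i j, (φ i j).IsHomogeneous (a j - b i) ∧ (a j ≤ b i → φ i j = 0)) ∧
    Function.Injective φ.mulVecLin ∧
    LinearMap.range φ.mulVecLin = LinearMap.ker (rowMap g)

/-- The Castelnuovo–Mumford regularity of a codimension-two perfect ideal, read off from
its minimal graded free resolution `0 → ⊕_j R(−a_j) → ⊕_i R(−b_i) → I → 0` as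
`max(max_i b_i, max_j a_j − 1)`. -/
def HasRegularity {A : Type*} [CommRing A] {σ : Type*} (I : Ideal (MvPolynomial σ A))
    (r : ℕ) : Prop :=
  ∃ (N M : ℕ) (b : Fin N → ℕ) (a : Fin M → ℕ), HasResolutionData I b a ∧
    (Finset.univ.sup b) ⊔ ((Finset.univ.sup a) - 1) = r

def IsCohenMacaulayRing (A : Type*) [CommRing A] : Prop :=
  ∀ P : Ideal A, P.IsMaximal → ∃ rs : List A,
    (∀ x ∈ rs, x ∈ P) ∧ RingTheory.Sequence.IsRegular A rs ∧
      (rs.length : ℕ∞) = idealHeight P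

def reesPresentation {A : Type*} [CommRing A] {n : ℕ} (f : Fin n → A) :
    MvPolynomial (Fin n) A →ₐ[A] Polynomial A :=
  MvPolynomial.aeval fun i => Polynomial.C (f i) * Polynomial.X

def Ideal.IsLinearType {A : Type*} [CommRing A] (I : Ideal A) : Prop :=
  ∀ (n : ℕ) (f : Fin n → A), Ideal.span (Set.range f) = I →
    RingHom.ker (reesPresentation f) =
      Ideal.span {p | p ∈ RingHom.ker (reesPresentation f) ∧ p.IsHomogeneous 1}

def moduleDepth {A : Type*} [CommRing A] (J : Ideal A) (M : Type*)
    [AddCommGroup M] [Module A M] : ℕ∞ :=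
  sSup {c : ℕ∞ | ∃ rs : List A, (∀ x ∈ rs, x ∈ J) ∧
    RingTheory.Sequence.IsRegular M rs ∧ (rs.length : ℕ∞) = c}

def analyticSpread {A : Type*} [CommRing A] (m I : Ideal A) : WithBot ℕ∞ :=
  ringKrullDim ((reesAlgebra I) ⧸ (Ideal.map (algebraMap A (reesAlgebra I)) m))

section Points

variable {k : Type*} [Field k]

def gradedPiece (I : Ideal (MvPolynomial (Fin 3) k)) (t : ℕ) :
    Submodule k (MvPolynomial (Fin 3) k) :=
  Submodule.restrictScalars k I ⊓ homogeneousSubmodule (Fin 3) k t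

def pointIdeal (p : Fin 3 → k) : Ideal (MvPolynomial (Fin 3) k) :=
  Ideal.span {f | f.IsHomogeneous 1 ∧ MvPolynomial.eval p f = 0}

def vanishingIdeal {n : ℕ} (pts : Fin n → (Fin 3 → k)) : Ideal (MvPolynomial (Fin 3) k) :=
  ⨅ i, pointIdeal (pts i)

def oneTimesPiece (I : Ideal (MvPolynomial (Fin 3) k)) (s : ℕ) :
    Submodule k (MvPolynomial (Fin 3) k) :=
  Submodule.span k {g | ∃ ℓ f, ℓ ∈ homogeneousSubmodule (Fin 3) k 1 ∧
    f ∈ gradedPiece I s ∧ g = ℓ * f}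

def IsPointFamily {n : ℕ} (pts : Fin n → (Fin 3 → k)) : Prop :=
  (∀ i, pts i ≠ 0) ∧ ∀ i j, i ≠ j → ∀ c : k, pts i ≠ c • pts j

def InGenericPosition {n : ℕ} (pts : Fin n → (Fin 3 → k)) : Prop :=
  ∀ t : ℕ, Module.finrank k (gradedPiece (vanishingIdeal pts) t) = (t + 2).choose 2 - n

def InUniformPosition {n : ℕ} (pts : Fin n → (Fin 3 → k)) : Prop :=
  ∀ T : Finset (Fin n), ∀ t : ℕ,
    Module.finrank k (gradedPiece (⨅ i ∈ T, pointIdeal (pts i)) t) = (t + 2).choose 2 - T.card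

def HasInitialDegree (I : Ideal (MvPolynomial (Fin 3) k)) (s : ℕ) : Prop :=
  gradedPiece I s ≠ ⊥ ∧ ∀ t < s, gradedPiece I t = ⊥

def InTightGenericPosition {n : ℕ} (pts : Fin n → (Fin 3 → k)) (s : ℕ) : Prop :=
  InGenericPosition pts ∧
    Module.finrank k (oneTimesPiece (vanishingIdeal pts) s) =
      min (3 * Module.finrank k (gradedPiece (vanishingIdeal pts) s))
        (Module.finrank k (gradedPiece (vanishingIdeal pts) (s + 1)))

def IsBirationalOntoImage {N : ℕ} (f : Fin N → MvPolynomial (Fin 3) k) : Prop :=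
  ∃ (e : ℕ) (G : Fin 3 → MvPolynomial (Fin N) k) (w : MvPolynomial (Fin 3) k),
    w ≠ 0 ∧ (∀ j, (G j).IsHomogeneous e) ∧
      ∀ j, MvPolynomial.aeval f (G j) = w * MvPolynomial.X j

end Points

end

namespace KoszulStrand

section Exterior

variable {A : Type*} [CommRing A] {q : ℕ}

/-- The sign of inserting `j` into the increasingly ordered set `c`. -/
def insSign (A : Type*) [CommRing A] (j : Fin q) (c : Finset (Fin q)) : A :=
  (-1) ^ (c.filter (· < j)).card

lemma insSign_mul_self (j : Fin q) (c : Finset (Fin q)) :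
    insSign A j c * insSign A j c = 1 := by
  rw [insSign, ← mul_pow]; simp

lemma insSign_insert (i j : Fin q) (c : Finset (Fin q)) (hi : i ∉ c) :
    insSign A j (insert i c) = if i < j then - insSign A j c else insSign A j c := by
  unfold insSign
  rw [Finset.filter_insert]
  split_ifs with h
  · rw [Finset.card_insert_of_notMem (by simp [hi]), pow_succ]; ring
  · rfl

lemma insSign_erase_self (j : Fin q) (c : Finset (Fin q)) :
    insSign A j (c.erase j) = insSign A j c := by
  unfold insSign
  congr 2
  ext x
  simp only [Finset.mem_filter, Finset.mem_erase]
  constructor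
  · rintro ⟨⟨_, h⟩, h'⟩; exact ⟨h, h'⟩
  · rintro ⟨h, h'⟩; exact ⟨⟨ne_of_lt h', h⟩, h'⟩

lemma insSign_erase (i j : Fin q) (c : Finset (Fin q)) (hi : i ∈ c) :
    insSign A j (c.erase i) = if i < j then - insSign A j c else insSign A j c := by
  have h := insSign_insert (A := A) i j (c.erase i) (Finset.notMem_erase i c)
  rw [Finset.insert_erase hi] at h
  split_ifs with h' <;> simp [h, h']

/-- Contraction with the `j`-th coordinate on the exterior algebra of `A^q`, whose elements are
written as families of coefficients indexed by subsets. -/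
def contr (A : Type*) [CommRing A] {q : ℕ} (j : Fin q) :
    Module.End A (Finset (Fin q) → A) where
  toFun f c := if j ∈ c then 0 else insSign A j c * f (insert j c)
  map_add' f g := by ext c; simp only [Pi.add_apply]; split_ifs <;> ring
  map_smul' a f := by
    ext c; simp only [Pi.smul_apply, smul_eq_mul, RingHom.id_apply]; split_ifs <;> ring

/-- Exterior multiplication by the `j`-th basis vector. -/
def wedge (A : Type*) [CommRing A] {q : ℕ} (j : Fin q) :
    Module.End A (Finset (Fin q) → A) where
  toFun f c := if j ∈ c then insSign A j c * f (c.erase j) else 0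
  map_add' f g := by ext c; simp only [Pi.add_apply]; split_ifs <;> ring
  map_smul' a f := by
    ext c; simp only [Pi.smul_apply, smul_eq_mul, RingHom.id_apply]; split_ifs <;> ring

lemma contr_apply (j : Fin q) (f : Finset (Fin q) → A) (c : Finset (Fin q)) :
    contr A j f c = if j ∈ c then 0 else insSign A j c * f (insert j c) := rfl

lemma wedge_apply (j : Fin q) (f : Finset (Fin q) → A) (c : Finset (Fin q)) :
    wedge A j f c = if j ∈ c then insSign A j c * f (c.erase j) else 0 := rfl

lemma contr_mul_self (i : Fin q) : contr A i * contr A i = 0 := by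
  ext f c
  simp [Module.End.mul_apply, contr_apply]

lemma contr_mul_contr (i j : Fin q) : contr A i * contr A j = - (contr A j * contr A i) := by
  rcases eq_or_ne i j with rfl | hij
  · rw [contr_mul_self, neg_zero]
  refine LinearMap.ext fun f => funext fun c => ?_
  simp only [Module.End.mul_apply, contr_apply, LinearMap.neg_apply, Pi.neg_apply,
    Finset.mem_insert]
  by_cases hi : i ∈ c
  · simp [hi]
  by_cases hj : j ∈ c
  · simp [hj]
  rw [insSign_insert _ _ _ hi, insSign_insert _ _ _ hj, Finset.insert_comm]
  rcases lt_or_gt_of_ne hij with h | h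
  · simp [hi, hj, hij, hij.symm, h, h.not_gt]; ring
  · simp [hi, hj, hij, hij.symm, h, h.not_gt]; ring

lemma wedge_mul_wedge_of_ne {i j : Fin q} (hij : i ≠ j) :
    wedge A i * wedge A j = - (wedge A j * wedge A i) := by
  refine LinearMap.ext fun f => funext fun c => ?_
  simp only [Module.End.mul_apply, wedge_apply, LinearMap.neg_apply, Pi.neg_apply,
    Finset.mem_erase]
  by_cases hi : i ∈ c
  swap
  · simp [hi]
  by_cases hj : j ∈ c
  swap
  · simp [hj]
  rw [insSign_erase _ _ _ hi, insSign_erase _ _ _ hj, Finset.erase_right_comm]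
  rcases lt_or_gt_of_ne hij with h | h
  · simp [hi, hj, hij, hij.symm, h, h.not_gt]; ring
  · simp [hi, hj, hij, hij.symm, h, h.not_gt]; ring

lemma wedge_mul_self (i : Fin q) : wedge A i * wedge A i = 0 := by
  refine LinearMap.ext fun f => funext fun c => ?_
  simp [Module.End.mul_apply, wedge_apply]

lemma wedge_mul_wedge (i j : Fin q) : wedge A i * wedge A j = - (wedge A j * wedge A i) := by
  rcases eq_or_ne i j with rfl | hij
  · rw [wedge_mul_self, neg_zero]
  · exact wedge_mul_wedge_of_ne hij

lemma contr_mul_wedge_add (i j : Fin q) :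
    contr A i * wedge A j + wedge A j * contr A i = if i = j then 1 else 0 := by
  refine LinearMap.ext fun f => funext fun c => ?_
  split_ifs with hij
  · subst hij
    simp only [Module.End.mul_apply, contr_apply, wedge_apply, LinearMap.add_apply, Pi.add_apply,
      Module.End.one_apply]
    by_cases hi : i ∈ c
    · simp only [hi, if_true, Finset.notMem_erase, if_false, zero_add]
      rw [insSign_erase_self, ← mul_assoc, insSign_mul_self, Finset.insert_erase hi, one_mul]
    · simp only [hi, if_false, Finset.mem_insert_self, if_true, add_zero]
      rw [insSign_insert _ _ _ hi, if_neg (lt_irrefl i), ← mul_assoc, insSign_mul_self,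
        Finset.erase_insert hi, one_mul]
  · simp only [Module.End.mul_apply, contr_apply, wedge_apply, LinearMap.add_apply, Pi.add_apply,
      LinearMap.zero_apply, Pi.zero_apply, Finset.mem_insert, Finset.mem_erase]
    by_cases hi : i ∈ c
    · simp [hi, hij]
    by_cases hj : j ∈ c
    swap
    · simp [hi, hj, Ne.symm hij]
    rw [insSign_insert _ _ _ hi, insSign_erase _ _ _ hj, Finset.erase_insert_of_ne hij]
    rcases lt_or_gt_of_ne hij with h | h
    · simp [hi, hj, h, h.not_gt]; ring
    · simp [hi, hj, h, h.not_gt]; ring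

/-- Contraction with the linear form with coefficients `v`. -/
def contrVec (v : Fin q → A) : Module.End A (Finset (Fin q) → A) := ∑ j, v j • contr A j

/-- Exterior multiplication by the vector `u`. -/
def wedgeVec (u : Fin q → A) : Module.End A (Finset (Fin q) → A) := ∑ j, u j • wedge A j

lemma contrVec_mul_contrVec (v w : Fin q → A) :
    contrVec v * contrVec w = - (contrVec w * contrVec v) := by
  simp only [contrVec, Finset.sum_mul_sum]
  rw [Finset.sum_comm, ← Finset.sum_neg_distrib]
  refine Finset.sum_congr rfl fun i _ => ?_
  rw [← Finset.sum_neg_distrib]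
  refine Finset.sum_congr rfl fun j _ => ?_
  rw [smul_mul_smul_comm, smul_mul_smul_comm, contr_mul_contr, smul_neg, mul_comm]

lemma wedgeVec_mul_wedgeVec (v w : Fin q → A) :
    wedgeVec v * wedgeVec w = - (wedgeVec w * wedgeVec v) := by
  simp only [wedgeVec, Finset.sum_mul_sum]
  rw [Finset.sum_comm, ← Finset.sum_neg_distrib]
  refine Finset.sum_congr rfl fun i _ => ?_
  rw [← Finset.sum_neg_distrib]
  refine Finset.sum_congr rfl fun j _ => ?_
  rw [smul_mul_smul_comm, smul_mul_smul_comm, wedge_mul_wedge, smul_neg, mul_comm]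

lemma sum_sum_eq_zero_of_antisymm {M ι : Type*} [AddCommGroup M] [Fintype ι]
    (a : ι → ι → M) (h0 : ∀ i, a i i = 0) (h : ∀ i j, a i j + a j i = 0) :
    ∑ i, ∑ j, a i j = 0 := by
  classical
  rw [← Finset.sum_product']
  refine Finset.sum_involution (fun x _ => (x.2, x.1)) ?_ ?_ ?_ ?_
  · rintro ⟨i, j⟩ _; exact h i j
  · rintro ⟨i, j⟩ _ hne heq
    simp only [Prod.mk.injEq] at heq
    exact hne (by simpa [heq.2] using h0 j)
  · simp
  · simp

lemma contrVec_mul_self (v : Fin q → A) : contrVec v * contrVec v = 0 := by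
  simp only [contrVec, Finset.sum_mul_sum]
  refine sum_sum_eq_zero_of_antisymm _ (fun i => ?_) fun i j => ?_
  · rw [smul_mul_smul_comm, contr_mul_self, smul_zero]
  · rw [smul_mul_smul_comm, smul_mul_smul_comm, contr_mul_contr, mul_comm (v j), smul_neg,
      neg_add_cancel]

lemma contrVec_mul_wedgeVec_add (v u : Fin q → A) :
    contrVec v * wedgeVec u + wedgeVec u * contrVec v = algebraMap A _ (∑ j, v j * u j) := by
  simp only [contrVec, wedgeVec, Finset.sum_mul_sum]
  rw [Finset.sum_comm (γ := Fin q) (s := Finset.univ) (f := fun i j => (u i • wedge A i) * _),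
    ← Finset.sum_add_distrib, map_sum]
  refine Finset.sum_congr rfl fun i _ => ?_
  rw [← Finset.sum_add_distrib]
  have : ∀ j, v i • contr A i * u j • wedge A j + u j • wedge A j * v i • contr A i
      = (v i * u j) • (if i = j then (1 : Module.End A (Finset (Fin q) → A)) else 0) := by
    intro j
    rw [← contr_mul_wedge_add, smul_mul_smul_comm, smul_mul_smul_comm, mul_comm (u j), smul_add]
  rw [Finset.sum_congr rfl fun j _ => this j]
  simp [Algebra.algebraMap_eq_smul_one]

end Exterior

section Shifts

variable {A M : Type*} [CommRing A] [AddCommGroup M] [Module A M] {d : ℕ}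

/-- Multiplication by the variable `x_l` on `M`-valued families indexed by exponents. -/
def mulVar (A M : Type*) [CommRing A] [AddCommGroup M] [Module A M] {d : ℕ} (l : Fin d) :
    Module.End A ((Fin d → ℕ) → M) where
  toFun z α := if α l = 0 then 0 else z (Function.update α l (α l - 1))
  map_add' f g := by ext c; simp only [Pi.add_apply]; split_ifs <;> simp
  map_smul' a f := by
    ext c; simp only [Pi.smul_apply, RingHom.id_apply]; split_ifs <;> simp

/-- Division by the variable `x_l`, discarding the terms not divisible by it. -/
def divVar (A M : Type*) [CommRing A] [AddCommGroup M] [Module A M] {d : ℕ} (l : Fin d) :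
    Module.End A ((Fin d → ℕ) → M) where
  toFun z α := z (Function.update α l (α l + 1))
  map_add' _ _ := rfl
  map_smul' _ _ := rfl

/-- Setting the variable `x_l` to zero. -/
def zeroVar (A M : Type*) [CommRing A] [AddCommGroup M] [Module A M] {d : ℕ} (l : Fin d) :
    Module.End A ((Fin d → ℕ) → M) where
  toFun z α := if α l = 0 then z α else 0
  map_add' f g := by ext c; simp only [Pi.add_apply]; split_ifs <;> simp
  map_smul' a f := by
    ext c; simp only [Pi.smul_apply, RingHom.id_apply]; split_ifs <;> simp

/-- Pointwise application of an endomorphism to families indexed by exponents. -/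
def pointwise (d : ℕ) : Module.End A M →ₐ[A] Module.End A ((Fin d → ℕ) → M) where
  toFun T := T.compLeft (Fin d → ℕ)
  map_one' := rfl
  map_mul' _ _ := rfl
  map_zero' := rfl
  map_add' _ _ := rfl
  commutes' _ := rfl

lemma mulVar_apply (l : Fin d) (z : (Fin d → ℕ) → M) (α : Fin d → ℕ) :
    mulVar A M l z α = if α l = 0 then 0 else z (Function.update α l (α l - 1)) := rfl

lemma divVar_apply (l : Fin d) (z : (Fin d → ℕ) → M) (α : Fin d → ℕ) :
    divVar A M l z α = z (Function.update α l (α l + 1)) := rfl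

lemma zeroVar_apply (l : Fin d) (z : (Fin d → ℕ) → M) (α : Fin d → ℕ) :
    zeroVar A M l z α = if α l = 0 then z α else 0 := rfl

lemma pointwise_apply (T : Module.End A M) (z : (Fin d → ℕ) → M) (α : Fin d → ℕ) :
    pointwise d T z α = T (z α) := rfl

lemma divVar_mul_mulVar_self (l : Fin d) : divVar A M l * mulVar A M l = 1 := by
  refine LinearMap.ext fun z => funext fun α => ?_
  simp [Module.End.mul_apply, mulVar_apply, divVar_apply]

lemma mulVar_mul_divVar_self (l : Fin d) :
    mulVar A M l * divVar A M l = 1 - zeroVar A M l := by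
  refine LinearMap.ext fun z => funext fun α => ?_
  simp only [Module.End.mul_apply, mulVar_apply, divVar_apply, LinearMap.sub_apply,
    Module.End.one_apply, Pi.sub_apply, zeroVar_apply]
  split_ifs with h
  · simp
  · have : α l - 1 + 1 = α l := by omega
    simp [this]

lemma divVar_mul_mulVar {l m : Fin d} (h : l ≠ m) :
    divVar A M l * mulVar A M m = mulVar A M m * divVar A M l := by
  refine LinearMap.ext fun z => funext fun α => ?_
  simp only [Module.End.mul_apply, mulVar_apply, divVar_apply]
  rw [Function.update_of_ne h.symm, Function.update_of_ne h, Function.update_comm h]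

lemma mulVar_mul_mulVar (l m : Fin d) :
    mulVar A M l * mulVar A M m = mulVar A M m * mulVar A M l := by
  rcases eq_or_ne l m with rfl | h
  · rfl
  refine LinearMap.ext fun z => funext fun α => ?_
  simp only [Module.End.mul_apply, mulVar_apply]
  rw [Function.update_of_ne h.symm, Function.update_of_ne h, Function.update_comm h]
  split_ifs <;> rfl

lemma mulVar_mul_pointwise (l : Fin d) (T : Module.End A M) :
    mulVar A M l * pointwise d T = pointwise d T * mulVar A M l := by
  refine LinearMap.ext fun z => funext fun α => ?_
  simp only [Module.End.mul_apply, mulVar_apply, pointwise_apply]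
  split_ifs <;> simp

lemma divVar_mul_pointwise (l : Fin d) (T : Module.End A M) :
    divVar A M l * pointwise d T = pointwise d T * divVar A M l := rfl

end Shifts

section Differential

variable {A : Type*} [CommRing A] {d q : ℕ}

/-- The Koszul differential of the linear forms `∑ l, Ψ l j • x_l`, `j : Fin q`. -/
def koszulDiff (Ψ : Fin d → Fin q → A) :
    Module.End A ((Fin d → ℕ) → Finset (Fin q) → A) :=
  ∑ l, mulVar A _ l * pointwise d (contrVec (Ψ l))

/-- Exterior multiplication by `u` combined with division by `x_l`. -/
def homotopy (l : Fin d) (u : Fin q → A) :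
    Module.End A ((Fin d → ℕ) → Finset (Fin q) → A) :=
  pointwise d (wedgeVec u) * divVar A _ l

lemma koszulDiff_mul_self (Ψ : Fin d → Fin q → A) :
    koszulDiff Ψ * koszulDiff Ψ = 0 := by
  have key : ∀ l m, mulVar A _ l * pointwise d (contrVec (Ψ l)) *
      (mulVar A _ m * pointwise d (contrVec (Ψ m))) =
      mulVar A _ l * mulVar A _ m * pointwise d (contrVec (Ψ l) * contrVec (Ψ m)) := by
    intro l m
    rw [mul_assoc, ← mul_assoc (pointwise d _), ← mulVar_mul_pointwise, map_mul]
    simp only [mul_assoc]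
  rw [koszulDiff, Finset.sum_mul_sum]
  refine sum_sum_eq_zero_of_antisymm _ (fun l => ?_) fun l m => ?_
  · rw [key, contrVec_mul_self, map_zero, mul_zero]
  · rw [key, key, mulVar_mul_mulVar m l, ← mul_add, ← map_add, contrVec_mul_contrVec (Ψ m),
      add_neg_cancel, map_zero, mul_zero]

/-- The homotopy `homotopy l u` connects multiplication by `D` with an operator that sets `x_l`
to zero. -/
lemma koszulDiff_homotopy (Ψ : Fin d → Fin q → A) (D : A) (l : Fin d) (u : Fin q → A)
    (hu : ∀ m, ∑ j, Ψ m j * u j = if m = l then D else 0) :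
    koszulDiff Ψ * homotopy l u + homotopy l u * koszulDiff Ψ +
      zeroVar A _ l * pointwise d (contrVec (Ψ l) * wedgeVec u) = algebraMap A _ D := by
  have hC : ∀ m, contrVec (Ψ m) * wedgeVec u + wedgeVec u * contrVec (Ψ m) =
      algebraMap A _ (if m = l then D else 0) := fun m => by
    rw [contrVec_mul_wedgeVec_add, hu]
  have h1 : ∀ m, mulVar A _ m * pointwise d (contrVec (Ψ m)) * homotopy l u =
      mulVar A _ m * divVar A _ l * pointwise d (contrVec (Ψ m) * wedgeVec u) := by
    intro m
    rw [homotopy, ← divVar_mul_pointwise, map_mul]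
    simp only [mul_assoc]
    rw [← mul_assoc (pointwise d _) (divVar A _ l), ← divVar_mul_pointwise]
    simp only [mul_assoc]
  have h2 : ∀ m, homotopy l u * (mulVar A _ m * pointwise d (contrVec (Ψ m))) =
      divVar A _ l * mulVar A _ m * pointwise d (wedgeVec u * contrVec (Ψ m)) := by
    intro m
    rw [homotopy, ← divVar_mul_pointwise, map_mul]
    simp only [mul_assoc]
    rw [← mul_assoc (pointwise d _) (mulVar A _ m), ← mulVar_mul_pointwise]
    simp only [mul_assoc]
  rw [koszulDiff, Finset.sum_mul, Finset.mul_sum, ← Finset.sum_add_distrib,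
    ← Finset.add_sum_erase _ _ (Finset.mem_univ l), Finset.sum_eq_zero, add_zero, h1, h2,
    mulVar_mul_divVar_self, divVar_mul_mulVar_self, sub_mul, one_mul, one_mul, add_right_comm,
    sub_add_cancel, ← map_add, hC, if_pos rfl, AlgHom.commutes]
  intro m hm
  have hm : m ≠ l := Finset.ne_of_mem_erase hm
  rw [h1, h2, divVar_mul_mulVar hm.symm, ← mul_add, ← map_add, hC, if_neg hm, map_zero, map_zero,
    mul_zero]

/-- Families in `A^q`-exterior degree `i` and total degree `n`. -/
def strand (A : Type*) [CommRing A] (d q i n : ℕ) :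
    Submodule A ((Fin d → ℕ) → Finset (Fin q) → A) where
  carrier := {z | ∀ α c, ¬ (c.card = i ∧ ∑ l, α l + i = n) → z α c = 0}
  add_mem' hz hw α c h := by simp [hz α c h, hw α c h]
  zero_mem' _ _ _ := rfl
  smul_mem' a z hz α c h := by simp [hz α c h]

/-- Families with all coefficients in the ideal `𝔞`. -/
def coeffsIn (𝔞 : Ideal A) (d q : ℕ) :
    Submodule A ((Fin d → ℕ) → Finset (Fin q) → A) where
  carrier := {z | ∀ α c, z α c ∈ 𝔞}
  add_mem' hz hw α c := 𝔞.add_mem (hz α c) (hw α c)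
  zero_mem' _ _ := 𝔞.zero_mem
  smul_mem' a _ hz α c := 𝔞.mul_mem_left a (hz α c)

lemma pointwise_contrVec_mem_strand {i n : ℕ} (v : Fin q → A)
    {z : (Fin d → ℕ) → Finset (Fin q) → A} (hz : z ∈ strand A d q (i + 1) (n + 1)) :
    pointwise d (contrVec v) z ∈ strand A d q i n := by
  intro α c h
  simp only [pointwise_apply, contrVec, LinearMap.sum_apply, LinearMap.smul_apply,
    Finset.sum_apply, Pi.smul_apply, contr_apply]
  refine Finset.sum_eq_zero fun j _ => ?_
  split_ifs with hj
  · simp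
  · rw [hz α (insert j c), mul_zero, smul_zero]
    rw [Finset.card_insert_of_notMem hj]
    omega

lemma pointwise_wedgeVec_mem_strand {i n : ℕ} (v : Fin q → A)
    {z : (Fin d → ℕ) → Finset (Fin q) → A} (hz : z ∈ strand A d q i n) :
    pointwise d (wedgeVec v) z ∈ strand A d q (i + 1) (n + 1) := by
  intro α c h
  simp only [pointwise_apply, wedgeVec, LinearMap.sum_apply, LinearMap.smul_apply,
    Finset.sum_apply, Pi.smul_apply, wedge_apply]
  refine Finset.sum_eq_zero fun j _ => ?_
  split_ifs with hj
  · rw [hz α (c.erase j), mul_zero, smul_zero]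
    have := Finset.card_erase_add_one hj
    omega
  · simp

lemma sum_update_add (α : Fin d → ℕ) (l : Fin d) (b : ℕ) :
    ∑ m, Function.update α l b m + α l = ∑ m, α m + b := by
  rw [Finset.sum_update_of_mem (Finset.mem_univ l), Finset.sdiff_singleton_eq_erase,
    ← Finset.add_sum_erase _ α (Finset.mem_univ l)]
  ring

lemma mulVar_mem_strand {i n : ℕ} (l : Fin d)
    {z : (Fin d → ℕ) → Finset (Fin q) → A} (hz : z ∈ strand A d q i n) :
    mulVar A _ l z ∈ strand A d q i (n + 1) := by
  intro α c h
  rw [mulVar_apply]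
  split_ifs with hl
  · rfl
  · apply hz
    have := sum_update_add α l (α l - 1)
    omega

lemma divVar_mem_strand {i n : ℕ} (l : Fin d)
    {z : (Fin d → ℕ) → Finset (Fin q) → A} (hz : z ∈ strand A d q i (n + 1)) :
    divVar A _ l z ∈ strand A d q i n := by
  intro α c h
  rw [divVar_apply]
  apply hz
  have := sum_update_add α l (α l + 1)
  omega

lemma zeroVar_mem_strand {i n : ℕ} (l : Fin d)
    {z : (Fin d → ℕ) → Finset (Fin q) → A} (hz : z ∈ strand A d q i n) :
    zeroVar A _ l z ∈ strand A d q i n := by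
  intro α c h
  rw [zeroVar_apply]
  split_ifs with hl
  · exact hz α c h
  · rfl

lemma koszulDiff_mem_strand {i n : ℕ} (Ψ : Fin d → Fin q → A)
    {z : (Fin d → ℕ) → Finset (Fin q) → A} (hz : z ∈ strand A d q (i + 1) (n + 1)) :
    koszulDiff Ψ z ∈ strand A d q i (n + 1) := by
  rw [koszulDiff, LinearMap.sum_apply]
  exact Submodule.sum_mem _ fun l _ => mulVar_mem_strand l (pointwise_contrVec_mem_strand _ hz)

lemma homotopy_mem_strand {i n : ℕ} (l : Fin d) (u : Fin q → A)
    {z : (Fin d → ℕ) → Finset (Fin q) → A} (hz : z ∈ strand A d q i (n + 1)) :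
    homotopy l u z ∈ strand A d q (i + 1) (n + 1) :=
  pointwise_wedgeVec_mem_strand _ (divVar_mem_strand l hz)

lemma pointwise_contrVec_mem_coeffsIn {𝔞 : Ideal A} (v : Fin q → A)
    {z : (Fin d → ℕ) → Finset (Fin q) → A} (hz : z ∈ coeffsIn 𝔞 d q) :
    pointwise d (contrVec v) z ∈ coeffsIn 𝔞 d q := by
  intro α c
  simp only [pointwise_apply, contrVec, LinearMap.sum_apply, LinearMap.smul_apply,
    Finset.sum_apply, Pi.smul_apply, contr_apply]
  refine 𝔞.sum_mem fun j _ => ?_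
  split_ifs
  · simp
  · exact 𝔞.mul_mem_left _ (𝔞.mul_mem_left _ (hz _ _))

lemma homotopy_mem_coeffsIn {𝔞 : Ideal A} (l : Fin d) (u : Fin q → A)
    {z : (Fin d → ℕ) → Finset (Fin q) → A} (hz : z ∈ coeffsIn 𝔞 d q) :
    homotopy l u z ∈ coeffsIn 𝔞 d q := by
  intro α c
  simp only [homotopy, Module.End.mul_apply, divVar_apply, pointwise_apply, wedgeVec,
    LinearMap.sum_apply, LinearMap.smul_apply,
    Finset.sum_apply, Pi.smul_apply, wedge_apply]
  refine 𝔞.sum_mem fun j _ => ?_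
  split_ifs
  · exact 𝔞.mul_mem_left _ (𝔞.mul_mem_left _ (hz _ _))
  · simp

lemma koszulDiff_mem_coeffsIn {𝔞 : Ideal A} (Ψ : Fin d → Fin q → A)
    {z : (Fin d → ℕ) → Finset (Fin q) → A} (hz : z ∈ coeffsIn 𝔞 d q) :
    koszulDiff Ψ z ∈ coeffsIn 𝔞 d q := by
  rw [koszulDiff, LinearMap.sum_apply]
  refine Submodule.sum_mem _ fun l _ α c => ?_
  rw [Module.End.mul_apply, mulVar_apply]
  split_ifs
  · exact 𝔞.zero_mem
  · exact pointwise_contrVec_mem_coeffsIn _ hz _ _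

end Differential

section Torsion

variable {A : Type*} [CommRing A] {d q : ℕ}

/-- The composite of the operators `contrVec (Ψ l) * wedgeVec (U l)` for `l` in a list. -/
def contrWedgeProd (Ψ U : Fin d → Fin q → A) (L : List (Fin d)) :
    Module.End A (Finset (Fin q) → A) :=
  (L.map fun l => contrVec (Ψ l) * wedgeVec (U l)).prod

lemma mul_mul_eq_of_anticomm {S : Type*} [Ring S] {u c w : S} (h : c * u = - (u * c))
    (h' : u * w = - (w * u)) : u * (c * w) = c * w * u := by
  rw [mul_assoc, ← neg_eq_iff_eq_neg.2 h', mul_neg, ← mul_assoc, ← mul_assoc, h, neg_mul, neg_neg]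

lemma commute_wedgeVec_contrWedgeProd {Ψ U : Fin d → Fin q → A} {l : Fin d} {L : List (Fin d)}
    (h : ∀ m ∈ L, ∑ j, Ψ m j * U l j = 0) :
    wedgeVec (U l) * contrWedgeProd Ψ U L = contrWedgeProd Ψ U L * wedgeVec (U l) := by
  refine (Commute.list_prod_right _ _ ?_).eq
  intro T hT
  obtain ⟨m, hm, rfl⟩ := List.mem_map.1 hT
  have h1 : contrVec (Ψ m) * wedgeVec (U l) = - (wedgeVec (U l) * contrVec (Ψ m)) := by
    rw [← add_eq_zero_iff_eq_neg, contrVec_mul_wedgeVec_add, h m hm, map_zero]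
  exact mul_mul_eq_of_anticomm h1 (wedgeVec_mul_wedgeVec _ _)

lemma wedgeVec_apply_of_card_ne {i : ℕ} (u : Fin q → A) {f : Finset (Fin q) → A}
    (hf : ∀ c, c.card ≠ i → f c = 0) (c : Finset (Fin q)) (hc : c.card ≠ i + 1) :
    wedgeVec u f c = 0 := by
  simp only [wedgeVec, LinearMap.sum_apply, LinearMap.smul_apply, Finset.sum_apply, Pi.smul_apply,
    wedge_apply]
  refine Finset.sum_eq_zero fun j _ => ?_
  split_ifs with hj
  · rw [hf, mul_zero, smul_zero]
    have := Finset.card_erase_add_one hj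
    omega
  · simp

lemma contrWedgeProd_apply_eq_zero {Ψ U : Fin d → Fin q → A}
    (h : ∀ m l, m ≠ l → ∑ j, Ψ m j * U l j = 0) {L : List (Fin d)} (hL : L.Nodup) {i : ℕ}
    (hi : q < i + L.length) {f : Finset (Fin q) → A} (hf : ∀ c, c.card ≠ i → f c = 0) :
    contrWedgeProd Ψ U L f = 0 := by
  induction L generalizing i f with
  | nil =>
    have : f = 0 := funext fun c => hf c <| by
      have := Finset.card_le_univ c
      simp only [Fintype.card_fin, List.length_nil] at this hi
      omega
    rw [this, map_zero]
  | cons l L ih =>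
    rw [List.nodup_cons] at hL
    have hc := commute_wedgeVec_contrWedgeProd (Ψ := Ψ) (U := U) (l := l) (L := L)
      fun m hm => h m l fun hml => hL.1 (hml ▸ hm)
    have : contrWedgeProd Ψ U (l :: L) =
        contrVec (Ψ l) * (contrWedgeProd Ψ U L * wedgeVec (U l)) := by
      rw [← hc, ← mul_assoc]; rfl
    rw [this, Module.End.mul_apply, Module.End.mul_apply,
      ih hL.2 (i := i + 1) (by simp only [List.length_cons] at hi; omega)
        (wedgeVec_apply_of_card_ne _ hf), map_zero]

/-- The composite of the operators occurring as error terms in `koszulDiff_homotopy`. -/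
def errorProd (Ψ U : Fin d → Fin q → A) (L : List (Fin d)) :
    Module.End A ((Fin d → ℕ) → Finset (Fin q) → A) :=
  (L.map fun l => zeroVar A _ l * pointwise d (contrVec (Ψ l) * wedgeVec (U l))).prod

lemma errorProd_apply (Ψ U : Fin d → Fin q → A) (L : List (Fin d))
    (z : (Fin d → ℕ) → Finset (Fin q) → A) (α : Fin d → ℕ) :
    errorProd Ψ U L z α = if ∀ l ∈ L, α l = 0 then contrWedgeProd Ψ U L (z α) else 0 := by
  induction L with
  | nil => simp [errorProd, contrWedgeProd]
  | cons l L ih =>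
    have : errorProd Ψ U (l :: L) z α = if α l = 0 then
        (contrVec (Ψ l) * wedgeVec (U l)) (errorProd Ψ U L z α) else 0 := rfl
    rw [this, ih]
    have h2 : contrWedgeProd Ψ U (l :: L) (z α) =
      (contrVec (Ψ l) * wedgeVec (U l)) (contrWedgeProd Ψ U L (z α)) := rfl
    rw [h2]
    simp only [List.forall_mem_cons]
    by_cases h : α l = 0
    · by_cases h' : ∀ l ∈ L, α l = 0
      · rw [if_pos h, if_pos h', if_pos ⟨h, h'⟩]
      · rw [if_pos h, if_neg h', if_neg (fun H => h' H.2), map_zero]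
    · rw [if_neg h, if_neg (fun H => h H.1)]

lemma exists_sub_koszulDiff_sub_errorProd_mem {Ψ U : Fin d → Fin q → A} {D : A} {𝔞 : Ideal A}
    (h : ∀ m l, ∑ j, Ψ m j * U l j = if m = l then D else 0) {i n : ℕ}
    {z : (Fin d → ℕ) → Finset (Fin q) → A} (hz : z ∈ strand A d q i (n + 1))
    (hz' : koszulDiff Ψ z ∈ coeffsIn 𝔞 d q) (L : List (Fin d)) :
    errorProd Ψ U L z ∈ strand A d q i (n + 1) ∧
    koszulDiff Ψ (errorProd Ψ U L z) ∈ coeffsIn 𝔞 d q ∧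
    ∃ w ∈ strand A d q (i + 1) (n + 1),
      D ^ L.length • z - koszulDiff Ψ w - errorProd Ψ U L z ∈ coeffsIn 𝔞 d q := by
  induction L with
  | nil => exact ⟨hz, hz', 0, Submodule.zero_mem _, by simp [errorProd]⟩
  | cons l L ih =>
    obtain ⟨h1, h2, w, hw, h3⟩ := ih
    set y := errorProd Ψ U L z with hy
    have hy' : errorProd Ψ U (l :: L) z =
      (zeroVar A (Finset (Fin q) → A) l *
        pointwise d (contrVec (Ψ l) * wedgeVec (U l)) : Module.End A _) y := rfl
    have key := LinearMap.congr_fun (koszulDiff_homotopy Ψ D l (U l) (fun m => h m l)) y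
    simp only [LinearMap.add_apply, Module.End.mul_apply, Module.algebraMap_end_apply] at key
    have e : errorProd Ψ U (l :: L) z = D • y - koszulDiff Ψ (homotopy l (U l) y) -
        homotopy l (U l) (koszulDiff Ψ y) := by
      rw [hy', Module.End.mul_apply, ← key]; abel
    have hsq : ∀ x, koszulDiff Ψ (koszulDiff Ψ x) = 0 := fun x =>
      LinearMap.congr_fun (koszulDiff_mul_self Ψ) x
    refine ⟨?_, ?_, D • w + homotopy l (U l) y, ?_, ?_⟩
    · rw [hy', Module.End.mul_apply, map_mul]
      exact zeroVar_mem_strand _ (pointwise_contrVec_mem_strand _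
        (pointwise_wedgeVec_mem_strand _ h1))
    · rw [e, map_sub, map_sub, hsq, sub_zero, map_smul]
      exact Submodule.sub_mem _ (Submodule.smul_mem _ _ h2)
        (koszulDiff_mem_coeffsIn _ (homotopy_mem_coeffsIn _ _ h2))
    · exact Submodule.add_mem _ (Submodule.smul_mem _ _ hw) (homotopy_mem_strand _ _ h1)
    · have : D ^ (l :: L).length • z - koszulDiff Ψ (D • w + homotopy l (U l) y) -
          errorProd Ψ U (l :: L) z = D • (D ^ L.length • z - koszulDiff Ψ w - y) +
            homotopy l (U l) (koszulDiff Ψ y) := by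
        rw [e, map_add, map_smul, List.length_cons, pow_succ', mul_smul, smul_sub, smul_sub]
        abel
      rw [this]
      exact Submodule.add_mem _ (Submodule.smul_mem _ _ h3) (homotopy_mem_coeffsIn _ _ h2)

lemma exists_pow_smul_sub_koszulDiff_mem {Ψ U : Fin d → Fin q → A} {D : A} {𝔞 : Ideal A}
    (h : ∀ m l, ∑ j, Ψ m j * U l j = if m = l then D else 0) {i n : ℕ} (hn : q < n + 1 + d)
    {z : (Fin d → ℕ) → Finset (Fin q) → A} (hz : z ∈ strand A d q i (n + 1))
    (hz' : koszulDiff Ψ z ∈ coeffsIn 𝔞 d q) :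
    ∃ w ∈ strand A d q (i + 1) (n + 1), D ^ d • z - koszulDiff Ψ w ∈ coeffsIn 𝔞 d q := by
  obtain ⟨-, -, w, hw, h3⟩ := exists_sub_koszulDiff_sub_errorProd_mem h hz hz' (List.finRange d)
  have : errorProd Ψ U (List.finRange d) z = 0 := by
    funext α
    rw [errorProd_apply]
    split_ifs with hα
    swap
    · rfl
    simp only [List.mem_finRange, true_imp_iff] at hα
    have hs : ∑ l, α l = 0 := Finset.sum_eq_zero fun l _ => hα l
    by_cases hi : i = n + 1
    · refine contrWedgeProd_apply_eq_zero (fun m l hml => by rw [h, if_neg hml])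
        (List.nodup_finRange d) (i := i) (by rw [List.length_finRange]; omega) fun c hc => ?_
      exact hz α c fun H => hc H.1
    · have : z α = 0 := funext fun c => hz α c fun H => hi (by omega)
      rw [this, map_zero]; rfl
  rw [this, sub_zero, List.length_finRange] at h3
  exact ⟨w, hw, h3⟩

/-- The ideal of elements annihilating a class in the homology of the strand modulo `𝔞`. -/
def homologyAnnihilator (Ψ : Fin d → Fin q → A) (𝔞 : Ideal A) (i n : ℕ)
    (z : (Fin d → ℕ) → Finset (Fin q) → A) : Ideal A where
  carrier := {a | ∃ w ∈ strand A d q i n, a • z - koszulDiff Ψ w ∈ coeffsIn 𝔞 d q}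
  add_mem' := by
    rintro a b ⟨w, hw, h⟩ ⟨w', hw', h'⟩
    refine ⟨w + w', Submodule.add_mem _ hw hw', ?_⟩
    have := Submodule.add_mem _ h h'
    rwa [map_add, add_smul, add_sub_add_comm]
  zero_mem' := ⟨0, Submodule.zero_mem _, by simp⟩
  smul_mem' a b := by
    rintro ⟨w, hw, h⟩
    refine ⟨a • w, Submodule.smul_mem _ _ hw, ?_⟩
    rw [map_smul, smul_eq_mul, mul_smul, ← smul_sub]
    exact Submodule.smul_mem _ _ h

/-- A maximal minor of `Ψ` has a power annihilating the homology of the strand. -/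
lemma det_pow_mem_homologyAnnihilator (Ψ : Fin d → Fin q → A) (𝔞 : Ideal A)
    (c : Fin d → Fin q) {i n : ℕ} (hn : q < n + 1 + d)
    {z : (Fin d → ℕ) → Finset (Fin q) → A} (hz : z ∈ strand A d q i (n + 1))
    (hz' : koszulDiff Ψ z ∈ coeffsIn 𝔞 d q) :
    ((Matrix.of Ψ).submatrix id c).det ^ d ∈ homologyAnnihilator Ψ 𝔞 (i + 1) (n + 1) z := by
  classical
  set B := (Matrix.of Ψ).submatrix id c with hB
  refine exists_pow_smul_sub_koszulDiff_mem
    (U := fun l j => ∑ e, if c e = j then B.adjugate e l else 0) (fun m l => ?_) hn hz hz'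
  have h := congr_fun (congr_fun (Matrix.mul_adjugate B) m) l
  rw [Matrix.mul_apply, Matrix.smul_apply, Matrix.one_apply, smul_eq_mul, mul_ite, mul_one,
    mul_zero] at h
  rw [← h]
  simp only [Finset.mul_sum]
  rw [Finset.sum_comm]
  refine Finset.sum_congr rfl fun e _ => ?_
  simp [hB]

end Torsion

section Acyclicity

variable {k : Type*} [Field k] {d q n : ℕ}

/-- The ideal generated by the first `e` variables. -/
noncomputable def initialVars (k : Type*) [Field k] (n e : ℕ) : Ideal (MvPolynomial (Fin n) k) :=
  Ideal.span (X '' {i : Fin n | (i : ℕ) < e})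

lemma initialVars_mono (e : ℕ) : initialVars k n e ≤ initialVars k n (e + 1) :=
  Ideal.span_mono (Set.image_mono fun i (hi : (i : ℕ) < e) => Nat.lt_succ_of_lt hi)

lemma X_mem_initialVars (e : Fin n) : (X e : MvPolynomial (Fin n) k) ∈ initialVars k n (e + 1) :=
  Ideal.subset_span ⟨e, Nat.lt_succ_self _, rfl⟩

lemma mem_initialVars_of_X_mul_mem (e : Fin n) {a : MvPolynomial (Fin n) k}
    (h : X e * a ∈ initialVars k n e) : a ∈ initialVars k n e := by
  rw [initialVars, mem_ideal_span_X_image] at h ⊢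
  intro s hs
  have hs' : Finsupp.single e 1 + s ∈ (X e * a).support := by
    rw [mem_support_iff, coeff_X_mul]
    exact mem_support_iff.1 hs
  obtain ⟨i, hi, hi'⟩ := h _ hs'
  refine ⟨i, hi, ?_⟩
  have hne : e ≠ i := fun H => by
    rw [Set.mem_ofPred_eq, H] at hi
    exact lt_irrefl _ hi
  simpa [Finsupp.single_eq_of_ne hne, Finsupp.single_eq_of_ne hne.symm] using hi'

lemma exists_sub_X_mul_mem_initialVars (e : Fin n) {a : MvPolynomial (Fin n) k}
    (h : a ∈ initialVars k n (e + 1)) : ∃ b, a - X e * b ∈ initialVars k n e := by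
  have hset : {i : Fin n | (i : ℕ) < e + 1} = insert e {i : Fin n | (i : ℕ) < e} := by
    ext i
    simp only [Set.mem_ofPred_eq, Set.mem_insert_iff, Fin.ext_iff]
    omega
  rw [initialVars, hset, Set.image_insert_eq, Ideal.mem_span_insert] at h
  obtain ⟨b, c, hc, rfl⟩ := h
  exact ⟨b, by rw [mul_comm, add_sub_cancel_left]; exact hc⟩

lemma exists_strand_sub_X_smul_mem (e : Fin n) {i t : ℕ}
    {w : (Fin d → ℕ) → Finset (Fin q) → MvPolynomial (Fin n) k}
    (hw : w ∈ strand (MvPolynomial (Fin n) k) d q i t)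
    (h : w ∈ coeffsIn (initialVars k n (e + 1)) d q) :
    ∃ w' ∈ strand (MvPolynomial (Fin n) k) d q i t,
      w - (X e : MvPolynomial (Fin n) k) • w' ∈ coeffsIn (initialVars k n e) d q := by
  classical
  choose b hb using fun α c => exists_sub_X_mul_mem_initialVars e (h α c)
  refine ⟨fun α c => if w α c = 0 then 0 else b α c, fun α c H => if_pos (hw α c H),
    fun α c => ?_⟩
  simp only [Pi.sub_apply, Pi.smul_apply, smul_eq_mul]
  split_ifs with h0
  · simp [h0]
  · exact hb α c

/-- If the variables are nilpotent modulo the maximal minors of `Ψ`, then the strand of the Koszul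
complex of the forms `∑ l, Ψ l j • x_l` is exact modulo any initial sequence of variables. -/
lemma exists_sub_koszulDiff_mem {Ψ : Fin d → Fin q → MvPolynomial (Fin (n + 1)) k}
    (hrad : ∀ e, X e ∈ (Ideal.span (Set.range fun c : Fin d → Fin q =>
      ((Matrix.of Ψ).submatrix id c).det)).radical) (hn : q < n + 1 + d) (r e : ℕ)
    (her : e + r = n + 1) {z : (Fin d → ℕ) → Finset (Fin q) → MvPolynomial (Fin (n + 1)) k}
    (hz : z ∈ strand _ d q (e + 1) (n + 1))
    (hz' : koszulDiff Ψ z ∈ coeffsIn (initialVars k (n + 1) e) d q) :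
    ∃ v ∈ strand _ d q (e + 2) (n + 1),
      z - koszulDiff Ψ v ∈ coeffsIn (initialVars k (n + 1) e) d q := by
  induction r generalizing e z with
  | zero =>
    have : z = 0 := funext fun α => funext fun c => hz α c (by omega)
    exact ⟨0, Submodule.zero_mem _, by rw [this, map_zero, sub_zero]; exact Submodule.zero_mem _⟩
  | succ r ih =>
    obtain ⟨e, rfl⟩ : ∃ e' : Fin (n + 1), e = e' := ⟨⟨e, by omega⟩, rfl⟩
    set 𝔞 := initialVars k (n + 1) e with h𝔞
    have hsq : ∀ x, koszulDiff Ψ (koszulDiff Ψ x) = 0 := fun x =>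
      LinearMap.congr_fun (koszulDiff_mul_self Ψ) x
    have hX : X e ∈ (homologyAnnihilator Ψ 𝔞 (e + 2) (n + 1) z).radical := by
      refine (Ideal.radical_le_radical_iff.2 (Ideal.span_le.2 ?_)) (hrad e)
      rintro _ ⟨c, rfl⟩
      exact ⟨d, det_pow_mem_homologyAnnihilator Ψ 𝔞 c hn hz hz'⟩
    obtain ⟨N, hN⟩ := hX
    induction N with
    | zero => simpa [homologyAnnihilator] using hN
    | succ N ihN =>
      obtain ⟨w, hw, hwz⟩ := hN
      refine ihN ?_
      set y := (X e : MvPolynomial (Fin (n + 1)) k) ^ N • z with hy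
      rw [pow_succ', mul_smul, ← hy] at hwz
      have hmono : coeffsIn 𝔞 d q ≤ coeffsIn (initialVars k (n + 1) (e + 1)) d q :=
        fun x hx α c => initialVars_mono _ (hx α c)
      have hdw : koszulDiff Ψ w ∈ coeffsIn (initialVars k (n + 1) (e + 1)) d q := by
        have h1 : (X e : MvPolynomial (Fin (n + 1)) k) • y ∈
            coeffsIn (initialVars k (n + 1) (e + 1)) d q :=
          fun α c => Ideal.mul_mem_right (y α c) _ (X_mem_initialVars e)
        have := Submodule.sub_mem _ h1 (hmono hwz)
        rwa [sub_sub_cancel] at this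
      obtain ⟨v, hv, hwv⟩ := ih (e + 1) (by omega) hw hdw
      obtain ⟨w', hw', hw''⟩ := exists_strand_sub_X_smul_mem e
        (Submodule.sub_mem _ hw (koszulDiff_mem_strand Ψ hv)) hwv
      refine ⟨w', hw', fun α c => mem_initialVars_of_X_mul_mem e ?_⟩
      have h2 := koszulDiff_mem_coeffsIn Ψ hw''
      rw [map_sub, map_sub, hsq, sub_zero, map_smul] at h2
      have h3 := Submodule.add_mem _ hwz h2 α c
      rw [sub_add_sub_cancel, ← smul_sub] at h3
      exact h3

/-- Under the assumptions of `exists_sub_koszulDiff_mem`, the forms `∑ l, Ψ l j • x_l` have no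
relation whose coefficients are forms of degree `n` in the `x_l` with constant coefficients. -/
lemma eq_zero_of_koszulDiff_eq_zero {Ψ : Fin d → Fin q → MvPolynomial (Fin (n + 1)) k}
    (hΨ : ∀ l j, constantCoeff (Ψ l j) = 0)
    (hrad : ∀ e, X e ∈ (Ideal.span (Set.range fun c : Fin d → Fin q =>
      ((Matrix.of Ψ).submatrix id c).det)).radical) (hn : q < n + 1 + d)
    (c : (Fin d → ℕ) → Fin q → k) (hc : ∀ α j, ∑ l, α l ≠ n → c α j = 0)
    (h : ∀ α, ∑ l, (if α l = 0 then 0 else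
      ∑ j, Ψ l j * C (c (Function.update α l (α l - 1)) j)) = 0) (α : Fin d → ℕ) (j : Fin q) :
    c α j = 0 := by
  classical
  set z : (Fin d → ℕ) → Finset (Fin q) → MvPolynomial (Fin (n + 1)) k :=
    fun α s => ∑ j, if s = {j} then C (c α j) else 0 with hzdef
  have hz : z ∈ strand _ d q 1 (n + 1) := by
    intro α s H
    refine Finset.sum_eq_zero fun j _ => ?_
    split_ifs with hs
    · rw [hc, C_0]
      intro hα
      exact H ⟨by rw [hs, Finset.card_singleton], by omega⟩
    · rfl
  have hz1 : ∀ α j, z α {j} = C (c α j) := fun α j => by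
    simp [hzdef]
  have hz' : koszulDiff Ψ z = 0 := by
    have hmem := koszulDiff_mem_strand Ψ hz
    funext α s
    by_cases hs : s = ∅
    swap
    · exact hmem α s fun H => hs (Finset.card_eq_zero.1 H.1)
    subst hs
    have e : koszulDiff Ψ z α ∅ = ∑ l, (if α l = 0 then 0 else
        ∑ j, Ψ l j * C (c (Function.update α l (α l - 1)) j)) := by
      rw [koszulDiff, LinearMap.sum_apply, Finset.sum_apply, Finset.sum_apply]
      refine Finset.sum_congr rfl fun l _ => ?_
      rw [Module.End.mul_apply, mulVar_apply]
      split_ifs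
      · rfl
      · rw [pointwise_apply, contrVec, LinearMap.sum_apply, Finset.sum_apply]
        refine Finset.sum_congr rfl fun j _ => ?_
        rw [LinearMap.smul_apply, Pi.smul_apply, contr_apply, if_neg (Finset.notMem_empty j),
          insert_empty_eq, hz1]
        simp [insSign]
    rw [e, h]
    rfl
  obtain ⟨v, -, hzv⟩ := exists_sub_koszulDiff_mem hrad hn (n + 1) 0 (by omega) hz
    (by rw [hz']; exact Submodule.zero_mem _)
  have h0 : initialVars k (n + 1) 0 = ⊥ := by simp [initialVars]
  have h1 : z α {j} - koszulDiff Ψ v α {j} = 0 := by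
    have := hzv α {j}
    rwa [h0] at this
  rw [hz1, sub_eq_zero] at h1
  have h2 : constantCoeff (koszulDiff Ψ v α {j}) = 0 := by
    rw [koszulDiff, LinearMap.sum_apply, Finset.sum_apply, Finset.sum_apply, map_sum]
    refine Finset.sum_eq_zero fun l _ => ?_
    rw [Module.End.mul_apply, mulVar_apply]
    split_ifs
    · exact map_zero _
    · rw [pointwise_apply, contrVec, LinearMap.sum_apply, Finset.sum_apply, map_sum]
      refine Finset.sum_eq_zero fun j _ => ?_
      rw [LinearMap.smul_apply, Pi.smul_apply, smul_eq_mul, map_mul, hΨ, zero_mul]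
  rw [← h1, constantCoeff_C] at h2
  exact h2

end Acyclicity

section LinearForms

variable {k : Type*} [Field k] {d p q n : ℕ}

lemma eq_sum_coeff_single_mul_X {f : MvPolynomial (Fin d) k} (hf : f.IsHomogeneous 1) :
    f = ∑ l, C (coeff (Finsupp.single l 1) f) * X l := by
  ext s
  simp only [coeff_sum, coeff_C_mul, coeff_X, mul_ite, mul_one, mul_zero]
  by_cases hs : s.degree = 1
  · obtain ⟨l, rfl⟩ : s ∈ Set.range fun a : Fin d => Finsupp.single a 1 := by
      rwa [Finsupp.range_single_one]
    rw [Finset.sum_eq_single l]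
    · simp
    · intro m _ hm
      rw [if_neg fun h => hm (Finsupp.single_left_injective one_ne_zero h)]
    · simp
  · rw [hf.coeff_eq_zero hs, eq_comm]
    refine Finset.sum_eq_zero fun l _ => if_neg ?_
    rintro rfl
    simp at hs

lemma aeval_eq_sum {S : Type*} [CommRing S] [Algebra k S] (v : Fin d → S)
    {f : MvPolynomial (Fin d) k} (hf : f.IsHomogeneous 1) :
    aeval v f = ∑ l, algebraMap k S (coeff (Finsupp.single l 1) f) * v l := by
  conv_lhs => rw [eq_sum_coeff_single_mul_X hf]
  simp

/-- If the maximal minors of a matrix of linear forms have the maximal possible height, then the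
matrix has full row rank at all nonzero points. -/
lemma eq_zero_of_sum_mul_aeval_eq_zero {κ : Type*} [Field κ] [Algebra k κ]
    {Φ : Matrix (Fin p) (Fin q) (MvPolynomial (Fin d) k)} (hΦ : ∀ i j, (Φ i j).IsHomogeneous 1)
    (hht : (d : ℕ∞) ≤ idealHeight (minorsIdeal p Φ)) {v : Fin d → κ} {u : Fin p → κ} (hu : u ≠ 0)
    (h : ∀ j, ∑ i, u i * aeval v (Φ i j) = 0) : v = 0 := by
  by_contra hv
  obtain ⟨l, hl⟩ := Function.ne_iff.1 hv
  set ev : MvPolynomial (Fin d) k →ₐ[k] Polynomial κ :=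
    aeval fun l => Polynomial.C (v l) * Polynomial.X with hev
  have hker : (RingHom.ker ev).IsPrime := RingHom.ker_isPrime _
  have hker0 : (RingHom.ker (constantCoeff : MvPolynomial (Fin d) k →+* k)).IsPrime :=
    RingHom.ker_isPrime _
  have hev1 : ∀ i j, ev (Φ i j) = Polynomial.C (aeval v (Φ i j)) * Polynomial.X := by
    intro i j
    rw [hev, aeval_eq_sum _ (hΦ i j), aeval_eq_sum _ (hΦ i j), map_sum, Finset.sum_mul]
    refine Finset.sum_congr rfl fun l _ => ?_
    rw [map_mul, mul_assoc]
    rfl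
  have hle : minorsIdeal p Φ ≤ RingHom.ker ev := by
    refine Ideal.span_le.2 ?_
    rintro _ ⟨r, c, hr, -, rfl⟩
    rw [SetLike.mem_coe, RingHom.mem_ker, AlgHom.map_det]
    refine Matrix.exists_vecMul_eq_zero_iff.1 ⟨fun i => Polynomial.C (u (r i)), ?_, ?_⟩
    · obtain ⟨i, hi⟩ := Function.ne_iff.1 hu
      obtain ⟨i', rfl⟩ := (Finite.injective_iff_surjective.1 hr) i
      refine Function.ne_iff.2 ⟨i', ?_⟩
      simpa using hi
    · funext j
      have e : ∀ i, Polynomial.C (u (r i)) * ev (Φ (r i) (c j)) =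
          Polynomial.C (u (r i) * aeval v (Φ (r i) (c j))) * Polynomial.X := fun i => by
        rw [hev1, map_mul, mul_assoc]
      simp only [Matrix.vecMul, dotProduct, AlgHom.mapMatrix_apply, Matrix.map_apply,
        Matrix.submatrix_apply, Pi.zero_apply, e]
      have e' : ∑ i, u (r i) * aeval v (Φ (r i) (c j)) = 0 :=
        ((Equiv.ofBijective r (Finite.injective_iff_bijective.1 hr)).sum_comp
          (fun i => u i * aeval v (Φ i (c j)))).trans (h _)
      rw [← Finset.sum_mul, ← map_sum, e', map_zero, zero_mul]
  have hlt : (⟨_, hker⟩ : PrimeSpectrum (MvPolynomial (Fin d) k)) < ⟨_, hker0⟩ := by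
    refine lt_of_le_of_ne ?_ fun H => ?_
    · intro f hf
      have h1 : (Polynomial.constantCoeff : Polynomial κ →+* κ).comp ev.toRingHom =
          (algebraMap k κ).comp constantCoeff := by
        ext <;> simp [hev]
      have h2 := RingHom.congr_fun h1 f
      have hf : ev f = 0 := hf
      simp only [AlgHom.toRingHom_eq_coe, RingHom.coe_comp, RingHom.coe_coe,
        Function.comp_apply, hf, map_zero] at h2
      exact (map_eq_zero _).1 h2.symm
    · have h1 : X l ∈ RingHom.ker (constantCoeff : MvPolynomial (Fin d) k →+* k) := by
        simp [RingHom.mem_ker]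
      have H : RingHom.ker ev = RingHom.ker constantCoeff := congrArg PrimeSpectrum.asIdeal H
      rw [← H] at h1
      rw [RingHom.mem_ker, hev, aeval_X] at h1
      simp [Polynomial.X_ne_zero] at h1
      exact hl h1
  have h1 : (d : ℕ∞) ≤ Order.height (⟨_, hker⟩ : PrimeSpectrum (MvPolynomial (Fin d) k)) :=
    hht.trans (iInf₂_le (⟨_, hker⟩ : PrimeSpectrum (MvPolynomial (Fin d) k)) hle)
  have h2 := Order.height_add_one_le hlt
  have h3 := Order.height_le_krullDim (⟨_, hker0⟩ : PrimeSpectrum (MvPolynomial (Fin d) k))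
  have h4 : Order.krullDim (PrimeSpectrum (MvPolynomial (Fin d) k)) = (d : WithBot ℕ∞) := by
    have := MvPolynomial.ringKrullDim_of_isNoetherianRing (R := k) (ι := Fin d)
    rw [ringKrullDim_eq_zero_of_field, zero_add, Nat.card_fin] at this
    exact this
  rw [h4] at h3
  have h5 : (d : ℕ∞) + 1 ≤ d := by
    have h6 := ((add_le_add_left h1 1).trans h2)
    exact h6.trans (by exact_mod_cast h3)
  have h7 : d + 1 ≤ d := by exact_mod_cast h5
  omega

lemma exists_sum_mul_eq_zero_of_det_eq_zero {κ : Type*} [Field κ] (M : Matrix (Fin d) (Fin q) κ)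
    (h : ∀ c : Fin d → Fin q, (M.submatrix id c).det = 0) :
    ∃ v : Fin d → κ, v ≠ 0 ∧ ∀ j, ∑ l, v l * M l j = 0 := by
  by_cases hW : Submodule.span κ (Set.range fun j l => M l j) = ⊤
  · exfalso
    obtain ⟨g, hg, -, hli⟩ :=
      Submodule.exists_fun_fin_finrank_span_eq κ (Set.range fun j l => M l j)
    have hd : Module.finrank κ (Submodule.span κ (Set.range fun j l => M l j)) = d := by
      rw [hW, finrank_top, Module.finrank_fin_fun]
    choose c hc using hg
    have hli' := hli.comp (Fin.cast hd.symm) (Fin.cast_injective _)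
    have := Matrix.linearIndependent_cols_iff_isUnit
      (A := M.submatrix id (c ∘ Fin.cast hd.symm)).1 (by
        have e : (M.submatrix id (c ∘ Fin.cast hd.symm)).col = g ∘ Fin.cast hd.symm := by
          funext j l
          exact congr_fun (hc (Fin.cast hd.symm j)) l
        rw [e]
        exact hli')
    rw [Matrix.isUnit_iff_isUnit_det, h] at this
    exact not_isUnit_zero this
  · obtain ⟨f, hf, hle⟩ := Submodule.exists_le_ker_of_lt_top _ (lt_top_iff_ne_top.2 hW)
    have hf' : ∀ w : Fin d → κ, f w = ∑ l, f (Pi.single l 1) * w l := by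
      intro w
      rw [f.pi_apply_eq_sum_univ w]
      refine Finset.sum_congr rfl fun l _ => ?_
      rw [smul_eq_mul, mul_comm]
      congr 2
      funext m
      simp [Pi.single_apply, eq_comm]
    refine ⟨fun l => f (Pi.single l 1), fun H => hf ?_, fun j => ?_⟩
    · refine LinearMap.ext fun w => ?_
      rw [hf']
      exact Finset.sum_eq_zero fun l _ => by rw [congr_fun H l]; simp
    · rw [← hf' fun l => M l j]
      exact hle (Submodule.subset_span ⟨j, rfl⟩)

/-- The matrix over `k[y_1, …, y_p]` obtained from the matrix `Φ` of linear forms by writing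
`∑ i, y_i Φ i j = ∑ l, dualForms Φ l j * x_l`. -/
noncomputable def dualForms (Φ : Matrix (Fin p) (Fin q) (MvPolynomial (Fin d) k)) (l : Fin d)
    (j : Fin q) : MvPolynomial (Fin p) k :=
  ∑ i, C (coeff (Finsupp.single l 1) (Φ i j)) * X i

lemma X_mem_radical_dualForms {Φ : Matrix (Fin p) (Fin q) (MvPolynomial (Fin d) k)}
    (hΦ : ∀ i j, (Φ i j).IsHomogeneous 1)
    (hht : (d : ℕ∞) ≤ idealHeight (minorsIdeal p Φ)) (e : Fin p) :
    X e ∈ (Ideal.span (Set.range fun c : Fin d → Fin q =>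
      ((Matrix.of (dualForms Φ)).submatrix id c).det)).radical := by
  rw [Ideal.radical_eq_sInf, Submodule.mem_sInf]
  rintro P ⟨hle, hP⟩
  set π : MvPolynomial (Fin p) k →ₐ[k] FractionRing (MvPolynomial (Fin p) k ⧸ P) :=
    (IsScalarTower.toAlgHom k (MvPolynomial (Fin p) k ⧸ P) _).comp (Ideal.Quotient.mkₐ k P)
    with hπ
  have hπ0 : ∀ a, π a = 0 ↔ a ∈ P := by
    intro a
    rw [← Ideal.Quotient.eq_zero_iff_mem]
    exact map_eq_zero_iff _ (IsFractionRing.injective (MvPolynomial (Fin p) k ⧸ P) _)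
  obtain ⟨v, hv, hv'⟩ := exists_sum_mul_eq_zero_of_det_eq_zero
    ((Matrix.of (dualForms Φ)).map π) (fun c => by
      rw [Matrix.submatrix_map]
      have := AlgHom.map_det π ((Matrix.of (dualForms Φ)).submatrix id c)
      rw [AlgHom.mapMatrix_apply] at this
      rw [← this, hπ0]
      exact hle (Ideal.subset_span ⟨c, rfl⟩))
  by_contra he
  refine hv (eq_zero_of_sum_mul_aeval_eq_zero hΦ hht (u := fun i => π (X i))
    (Function.ne_iff.2 ⟨e, fun H => he ((hπ0 _).1 H)⟩) fun j => ?_)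
  rw [← hv' j]
  simp only [aeval_eq_sum v (hΦ _ j), Finset.mul_sum, Matrix.map_apply, Matrix.of_apply,
    dualForms, map_sum, map_mul]
  rw [Finset.sum_comm]
  refine Finset.sum_congr rfl fun l _ => Finset.sum_congr rfl fun i _ => ?_
  rw [← MvPolynomial.algebraMap_eq, AlgHom.commutes]
  ring

lemma coeff_mul_of_isHomogeneous_one {f : MvPolynomial (Fin d) k} (hf : f.IsHomogeneous 1)
    (g : MvPolynomial (Fin d) k) (s : Fin d →₀ ℕ) :
    coeff s (f * g) = ∑ l, coeff (Finsupp.single l 1) f *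
      (if s l = 0 then 0 else coeff (s - Finsupp.single l 1) g) := by
  conv_lhs => rw [eq_sum_coeff_single_mul_X hf]
  rw [Finset.sum_mul, coeff_sum]
  refine Finset.sum_congr rfl fun l _ => ?_
  rw [mul_assoc, coeff_C_mul, coeff_X_mul']
  simp [Finsupp.mem_support_iff]

lemma eq_zero_of_sum_mul_eq_zero_of_degree_eq
    {Φ : Matrix (Fin (n + 1)) (Fin q) (MvPolynomial (Fin d) k)}
    (hΦ : ∀ i j, (Φ i j).IsHomogeneous 1)
    (hht : (d : ℕ∞) ≤ idealHeight (minorsIdeal (n + 1) Φ)) (hn : q < n + 1 + d)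
    {F : Fin q → MvPolynomial (Fin d) k} (hF : ∀ j, (F j).IsHomogeneous n)
    (h : ∀ i, ∑ j, Φ i j * F j = 0) (j : Fin q) : F j = 0 := by
  have key := eq_zero_of_koszulDiff_eq_zero (Ψ := dualForms Φ)
    (fun l j => by simp [dualForms]) (X_mem_radical_dualForms hΦ hht) hn
    (fun α j => coeff (Finsupp.equivFunOnFinite.symm α) (F j))
    (fun α j hα => (hF j).coeff_eq_zero (by
      rwa [Finsupp.degree_eq_sum])) (fun α => ?_)
  · ext s
    have := key s j
    rwa [Finsupp.equivFunOnFinite_symm_coe] at this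
  · set s := Finsupp.equivFunOnFinite.symm α with hs
    have hs' : ∀ l, Finsupp.equivFunOnFinite.symm (Function.update α l (α l - 1)) =
        s - Finsupp.single l 1 := by
      intro l
      ext m
      rcases eq_or_ne m l with rfl | hm
      · simp [hs]
      · simp [hs, hm]
    have h1 : ∀ i, ∑ l, (if α l = 0 then 0 else ∑ j, coeff (Finsupp.single l 1) (Φ i j) *
        coeff (s - Finsupp.single l 1) (F j)) = 0 := by
      intro i
      have h2 := congrArg (coeff s) (h i)
      rw [coeff_sum, coeff_zero] at h2
      simp only [coeff_mul_of_isHomogeneous_one (hΦ i _)] at h2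
      rw [Finset.sum_comm] at h2
      refine Eq.trans ?_ h2
      refine Finset.sum_congr rfl fun l _ => ?_
      have : s l = α l := rfl
      rw [this]
      split_ifs <;> simp
    have h2 : ∑ i, C (∑ l, (if α l = 0 then 0 else ∑ j, coeff (Finsupp.single l 1) (Φ i j) *
        coeff (s - Finsupp.single l 1) (F j))) * (X i : MvPolynomial (Fin (n + 1)) k) = 0 :=
      Finset.sum_eq_zero fun i _ => by rw [h1, C_0, zero_mul]
    refine Eq.trans ?_ h2
    simp only [map_sum, Finset.sum_mul]
    rw [Finset.sum_comm]
    refine Finset.sum_congr rfl fun l _ => ?_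
    split_ifs
    · simp
    · simp only [map_sum, Finset.sum_mul, map_mul]
      rw [Finset.sum_comm]
      refine Finset.sum_congr rfl fun j _ => ?_
      rw [dualForms, Finset.sum_mul, hs']
      refine Finset.sum_congr rfl fun i _ => ?_
      ring

/-- The columns of `Φ` have no relations of degree less than the number of rows. -/
lemma eq_zero_of_sum_mul_eq_zero (hd : 1 ≤ d)
    {Φ : Matrix (Fin p) (Fin q) (MvPolynomial (Fin d) k)}
    (hΦ : ∀ i j, (Φ i j).IsHomogeneous 1)
    (hht : (d : ℕ∞) ≤ idealHeight (minorsIdeal p Φ)) (hp : q < p + d)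
    (hn : n < p) {F : Fin q → MvPolynomial (Fin d) k} (hF : ∀ j, (F j).IsHomogeneous n)
    (h : ∀ i, ∑ j, Φ i j * F j = 0) (j : Fin q) : F j = 0 := by
  obtain ⟨r, rfl⟩ : ∃ r, p = n + r + 1 := ⟨p - n - 1, by omega⟩
  have := eq_zero_of_sum_mul_eq_zero_of_degree_eq hΦ hht hp
    (F := fun j => F j * X (⟨0, hd⟩ : Fin d) ^ r)
    (fun j => (hF j).mul (by simpa using (isHomogeneous_X k (⟨0, hd⟩ : Fin d)).pow r)) (fun i => by
      simp only [← mul_assoc]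
      rw [← Finset.sum_mul, h, zero_mul]) j
  exact (mul_eq_zero.1 this).resolve_right (pow_ne_zero _ (X_ne_zero _))

end LinearForms

section MinorsSpan

variable {k : Type*} [Field k] {d p q n : ℕ}

lemma isHomogeneous_det {M : Matrix (Fin p) (Fin p) (MvPolynomial (Fin d) k)} (w : Fin p → ℕ)
    (h : ∀ t e, (M t e).IsHomogeneous (w t)) : M.det.IsHomogeneous (∑ t, w t) := by
  rw [Matrix.det_apply]
  refine IsHomogeneous.sum _ _ _ fun σ _ => ?_
  have : (∏ e, M (σ e) e).IsHomogeneous (∑ t, w t) := by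
    rw [← Equiv.sum_comp σ w]
    exact IsHomogeneous.prod _ _ _ fun e _ => h _ _
  rcases Int.units_eq_one_or (Equiv.Perm.sign σ) with hs | hs
  · rwa [hs, one_smul]
  · rw [hs, Units.neg_smul, one_smul]
    exact (homogeneousSubmodule (Fin d) k _).neg_mem this

/-- The determinant of the columns indexed by `c`, as an alternating form of the rows. -/
def detColumns {R : Type*} [CommRing R] (c : Fin p → Fin q) :
    (Fin q → R) [⋀^Fin p]→ₗ[R] R :=
  Matrix.detRowAlternating.compLinearMap (LinearMap.funLeft R R c)

lemma detColumns_apply {R : Type*} [CommRing R] (c : Fin p → Fin q) (v : Fin p → Fin q → R) :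
    detColumns c v = ((Matrix.of v).submatrix id c).det := rfl

lemma sum_mul_alternatingMap_update {R ι : Type*} [CommRing R] [DecidableEq ι]
    (a : (Fin q → R) [⋀^ι]→ₗ[R] R) (v : ι → Fin q → R) (t : ι) (x : Fin q → R) :
    ∑ j, x j * a (Function.update v t (Pi.single j 1)) = a (Function.update v t x) := by
  have h := (a.toMultilinearMap.toLinearMap v t).pi_apply_eq_sum_univ x
  simp only [MultilinearMap.toLinearMap_apply, AlternatingMap.coe_multilinearMap,
    smul_eq_mul] at h
  rw [h]
  refine Finset.sum_congr rfl fun j _ => ?_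
  congr 3
  funext m
  simp [Pi.single_apply, eq_comm]

lemma alternatingMap_comp_eq_zero {R M N ι : Type*} [CommRing R] [AddCommGroup M] [Module R M]
    [AddCommGroup N] [Module R N] [Fintype ι] [DecidableEq ι] (a : M [⋀^ι]→ₗ[R] N) {v : ι → M}
    (h : a v = 0) (ρ : ι → ι) : a (fun t => v (ρ t)) = 0 := by
  by_cases hρ : Function.Injective ρ
  · have := a.map_perm v (Equiv.ofBijective ρ (Finite.injective_iff_bijective.1 hρ))
    rw [h, smul_zero] at this
    exact this
  · obtain ⟨i, j, hij, hne⟩ : ∃ i j, ρ i = ρ j ∧ i ≠ j := by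
      simpa [Function.Injective] using hρ
    exact a.map_eq_zero_of_eq _ (congrArg v hij) hne

lemma detColumns_single {R : Type*} [CommRing R] (c c' : Fin p ↪o Fin q) :
    detColumns c (fun t => Pi.single (c' t) (1 : R)) = if c = c' then 1 else 0 := by
  rw [detColumns_apply]
  split_ifs with h
  · subst h
    have : (Matrix.of fun t => Pi.single (c t) (1 : R)).submatrix id c = 1 := by
      ext t e
      simp [Pi.single_apply, Matrix.one_apply, eq_comm]
    rw [this, Matrix.det_one]
  · obtain ⟨t, ht⟩ : ∃ t, c' t ∉ Set.range c := by
      by_contra! H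
      refine h (OrderEmbedding.range_inj.1 ?_)
      have hsub : Set.range c' ⊆ Set.range c := by
        rintro _ ⟨t, rfl⟩
        exact H t
      refine (Set.eq_of_subset_of_ncard_le hsub ?_ (Set.toFinite _)).symm
      rw [← Set.image_univ, ← Set.image_univ, Set.ncard_image_of_injective _ c.injective,
        Set.ncard_image_of_injective _ c'.injective]
    refine Matrix.det_eq_zero_of_row_eq_zero t fun e => ?_
    have : c e ≠ c' t := fun H => ht ⟨e, H⟩
    simp [this]

/-- The maximal minors of `Φ` are linearly independent over `k`. -/
lemma linearIndependent_minors (hd : 1 ≤ d)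
    {Φ : Matrix (Fin p) (Fin q) (MvPolynomial (Fin d) k)}
    (hΦ : ∀ i j, (Φ i j).IsHomogeneous 1)
    (hht : (d : ℕ∞) ≤ idealHeight (minorsIdeal p Φ)) (hp : q < p + d) :
    LinearIndependent k fun c : Fin p ↪o Fin q => (Φ.submatrix id c).det := by
  classical
  have : Fintype (Fin p ↪o Fin q) := Fintype.ofFinite _
  rw [Fintype.linearIndependent_iff]
  intro a ha c₀
  set A : (Fin q → MvPolynomial (Fin d) k) [⋀^Fin p]→ₗ[MvPolynomial (Fin d) k]
      MvPolynomial (Fin d) k := ∑ c, (C (a c) : MvPolynomial (Fin d) k) • detColumns c with hA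
  have hAv : ∀ v, A v = ∑ c, C (a c) * detColumns c v := fun v =>
    map_sum (⟨⟨fun B : (Fin q → MvPolynomial (Fin d) k) [⋀^Fin p]→ₗ[MvPolynomial (Fin d) k]
      MvPolynomial (Fin d) k => B v, rfl⟩, fun _ _ => rfl⟩ : _ →+ _) _ _
  have key : ∀ T : Finset (Fin p), ∀ (w : Fin p → Fin q) (ρ : Fin p → Fin p),
      A (fun t => if t ∈ T then Pi.single (w t) 1 else Φ (ρ t)) = 0 := by
    intro T
    induction T using Finset.induction_on with
    | empty =>
      intro w ρ
      simp only [Finset.notMem_empty, if_false]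
      refine alternatingMap_comp_eq_zero A (v := Φ) ?_ ρ
      refine (hAv _).trans (Eq.trans ?_ ha)
      exact Finset.sum_congr rfl fun c _ => (smul_eq_C_mul _ _).symm
    | insert t₀ T ht₀ ih =>
      intro w ρ
      set v : Fin p → Fin q → MvPolynomial (Fin d) k :=
        fun t => if t ∈ T then Pi.single (w t) 1 else Φ (ρ t) with hv
      have hup : ∀ x, Function.update v t₀ x = fun t => if t = t₀ then x else v t := fun x => by
        funext t
        rw [Function.update_apply]
      have hF : ∀ j, (A (Function.update v t₀ (Pi.single j 1))).IsHomogeneous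
          (∑ t, if t ∈ insert t₀ T then 0 else 1) := by
        intro j
        rw [hAv]
        refine IsHomogeneous.sum _ _ _ fun c _ => ?_
        rw [← zero_add (∑ t, _)]
        refine (isHomogeneous_C _ _).mul (isHomogeneous_det _ fun t e => ?_)
        rw [LinearMap.funLeft_apply, hup]
        have hs : ∀ i j : Fin q, (Pi.single i (1 : MvPolynomial (Fin d) k) :
            Fin q → MvPolynomial (Fin d) k) j |>.IsHomogeneous 0 := fun i j => by
          rw [Pi.single_apply]
          split_ifs
          · exact isHomogeneous_one _ _
          · exact isHomogeneous_zero _ _ _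
        by_cases h1 : t = t₀
        · simpa [h1] using hs j (c e)
        · by_cases h2 : t ∈ T
          · simpa [h1, h2, hv] using hs (w t) (c e)
          · simpa [h1, h2, hv] using hΦ (ρ t) (c e)
      have hlt : (∑ t, if t ∈ insert t₀ T then 0 else 1) < p := by
        calc (∑ t, if t ∈ insert t₀ T then 0 else 1) < ∑ t : Fin p, 1 :=
              Finset.sum_lt_sum (fun t _ => by split_ifs <;> simp) ⟨t₀, Finset.mem_univ _, by simp⟩
          _ = p := by simp
      have h0 := eq_zero_of_sum_mul_eq_zero hd hΦ hht hp hlt hF (fun i => by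
        rw [sum_mul_alternatingMap_update A v t₀ (Φ i), ← ih w (Function.update ρ t₀ i), hup]
        congr 1
        funext t
        by_cases h1 : t = t₀
        · subst h1; simp [ht₀]
        · simp [h1, hv]) (w t₀)
      rw [← h0, hup]
      congr 1
      funext t
      by_cases h1 : t = t₀
      · simp [h1]
      · simp [h1, hv]
  have h := key Finset.univ c₀ id
  simp only [Finset.mem_univ, if_true] at h
  rw [hAv] at h
  simpa [detColumns_single] using h

/-- Every power of the irrelevant ideal given by the number of rows is contained in the ideal
generated by the maximal minors, if these are as many as the monomials. -/
lemma pow_idealOfVars_le_span_minors (hd : 1 ≤ d)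
    {Φ : Matrix (Fin p) (Fin q) (MvPolynomial (Fin d) k)}
    (hΦ : ∀ i j, (Φ i j).IsHomogeneous 1)
    (hht : (d : ℕ∞) ≤ idealHeight (minorsIdeal p Φ)) (hp : q + 1 = p + d) :
    idealOfVars (Fin d) k ^ p ≤
      Ideal.span (Set.range fun c : Fin p ↪o Fin q => (Φ.submatrix id c).det) := by
  classical
  have : Fintype (Fin p ↪o Fin q) := Fintype.ofFinite _
  set S : Finset (MvPolynomial (Fin d) k) :=
    (Finset.finsuppAntidiag Finset.univ p).image fun s => monomial s 1 with hS
  have hmem : ∀ s : Fin d →₀ ℕ, s.degree = p → monomial s (1 : k) ∈ S := fun s hs => by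
    refine Finset.mem_image_of_mem _ (Finset.mem_finsuppAntidiag.2 ⟨?_, Finset.subset_univ _⟩)
    rw [← hs, Finsupp.degree_eq_sum]
  have hle : Submodule.span k (Set.range fun c : Fin p ↪o Fin q => (Φ.submatrix id c).det) ≤
      Submodule.span k (S : Set (MvPolynomial (Fin d) k)) := by
    refine Submodule.span_le.2 ?_
    rintro _ ⟨c, rfl⟩
    have hh := isHomogeneous_det (M := Φ.submatrix id c) (fun _ => 1) fun t e => hΦ t (c e)
    simp only [Finset.sum_const, Finset.card_univ, Fintype.card_fin, smul_eq_mul, mul_one] at hh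
    have hsum := (Φ.submatrix id c).det.as_sum
    refine Set.mem_of_eq_of_mem hsum ?_
    refine Submodule.sum_mem _ fun s hs => ?_
    rw [← mul_one (coeff s _), ← smul_eq_mul, ← smul_monomial]
    refine Submodule.smul_mem _ _ (Submodule.subset_span (hmem s ?_))
    by_contra hne
    exact mem_support_iff.1 hs (hh.coeff_eq_zero hne)
  have hcard : S.card ≤ Fintype.card (Fin p ↪o Fin q) := by
    refine Finset.card_image_le.trans ?_
    rw [Finset.card_finsuppAntidiag_nat_eq_choose, ← Nat.card_eq_fintype_card,
      Nat.card_congr Set.powersetCard.ofFinEmbEquiv, Set.powersetCard.card]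
    simp only [Finset.card_univ, Fintype.card_fin, Nat.card_eq_fintype_card]
    rw [show d + p - 1 = q by omega]
  have heq := Submodule.eq_of_le_of_finrank_le hle (by
    rw [finrank_span_eq_card (linearIndependent_minors hd hΦ hht (by omega))]
    exact (finrank_span_finset_le_card S).trans hcard)
  rw [pow_idealOfVars_eq_span]
  refine Ideal.span_le.2 ?_
  rintro _ ⟨s, hs, rfl⟩
  have h1 : monomial s (1 : k) ∈ Submodule.span k (S : Set (MvPolynomial (Fin d) k)) :=
    Submodule.subset_span (hmem s hs)
  rw [← heq] at h1
  exact Submodule.span_le_restrictScalars k (MvPolynomial (Fin d) k) _ h1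

end MinorsSpan

section Residual

/-- The signed maximal minors of an `(m + 1) × m` matrix. -/
def signedMinors {R : Type*} [CommRing R] {m : ℕ} (φ : Matrix (Fin (m + 1)) (Fin m) R)
    (i : Fin (m + 1)) : R :=
  (-1) ^ (i : ℕ) * (φ.submatrix (Fin.succAbove i) id).det

lemma sum_signedMinors_mul {R : Type*} [CommRing R] {m : ℕ}
    (φ : Matrix (Fin (m + 1)) (Fin m) R) (c : Fin m) :
    ∑ i, signedMinors φ i * φ i c = 0 := by
  set M : Matrix (Fin (m + 1)) (Fin (m + 1)) R :=
    Matrix.of fun i => Fin.cons (φ i c) (φ i) with hM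
  have h : M.det = 0 := Matrix.det_zero_of_column_eq (Fin.succ_ne_zero c).symm fun i => by simp [hM]
  rw [Matrix.det_succ_column_zero] at h
  rw [← h]
  refine Finset.sum_congr rfl fun i _ => ?_
  have : M.submatrix i.succAbove Fin.succ = φ.submatrix i.succAbove id := by
    ext a b
    simp [hM]
  rw [this, signedMinors]
  simp only [hM, Matrix.of_apply, Fin.cons_zero]
  ring

lemma minorsIdeal_eq_span_signedMinors {R : Type*} [CommRing R] {m : ℕ}
    (φ : Matrix (Fin (m + 1)) (Fin m) R) :
    minorsIdeal m φ = Ideal.span (Set.range (signedMinors φ)) := by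
  refine le_antisymm (Ideal.span_le.2 ?_) (Ideal.span_le.2 ?_)
  · rintro _ ⟨r, c, hr, hc, rfl⟩
    obtain ⟨i, hi⟩ : ∃ i, i ∉ Set.range r := by
      by_contra! H
      have := Fintype.card_le_of_surjective r H
      simp at this
    have hex : ∀ t, ∃ s, i.succAbove s = r t := fun t =>
      Fin.exists_succAbove_eq fun H => hi ⟨t, H⟩
    choose s hs using hex
    have hsinj : Function.Injective s := fun a b hab => hr (by rw [← hs a, ← hs b, hab])
    set σ := Equiv.ofBijective s (Finite.injective_iff_bijective.1 hsinj)
    set τ := Equiv.ofBijective c (Finite.injective_iff_bijective.1 hc)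
    have hφ : φ.submatrix r c = ((φ.submatrix i.succAbove id).submatrix id τ).submatrix σ id := by
      ext a b
      simp [σ, τ, hs]
    have hmem : (φ.submatrix i.succAbove id).det ∈ Ideal.span (Set.range (signedMinors φ)) := by
      have : (φ.submatrix i.succAbove id).det = (-1) ^ (i : ℕ) * signedMinors φ i := by
        rw [signedMinors, ← mul_assoc, ← pow_add, Even.neg_one_pow ⟨_, rfl⟩, one_mul]
      rw [this]
      exact Ideal.mul_mem_left _ _ (Ideal.subset_span ⟨i, rfl⟩)
    rw [hφ, Matrix.det_permute, Matrix.det_permute']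
    exact Ideal.mul_mem_left _ _ (Ideal.mul_mem_left _ _ hmem)
  · rintro _ ⟨i, rfl⟩
    exact Ideal.mul_mem_left _ _ (Ideal.subset_span
      ⟨_, _, Fin.succAbove_right_injective, Function.injective_id, rfl⟩)

lemma mem_pow_idealOfVars_of_isHomogeneous {R σ : Type*} [CommSemiring R] {n : ℕ}
    {x : MvPolynomial σ R} (h : x.IsHomogeneous n) : x ∈ idealOfVars σ R ^ n := by
  rw [mem_pow_idealOfVars_iff']
  intro s hs
  exact h.coeff_eq_zero hs.ne

variable {k : Type*} [Field k] {d p q : ℕ}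

/-- Expanding a maximal minor of `B` along the row `t`, after replacing that row by a row of
linear forms, gives a form of degree `p`. -/
lemma isHomogeneous_sum_mul_adjugate {B : Matrix (Fin p) (Fin p) (MvPolynomial (Fin d) k)}
    (hB : ∀ t e, (B t e).IsHomogeneous 1) {x : Fin p → MvPolynomial (Fin d) k}
    (hx : ∀ e, (x e).IsHomogeneous 1) (t : Fin p) :
    (∑ e, x e * B.adjugate e t).IsHomogeneous p := by
  have : ∑ e, x e * B.adjugate e t = (B.updateRow t x).det := by
    rw [Matrix.det_eq_sum_mul_adjugate_row _ t]
    refine Finset.sum_congr rfl fun e _ => ?_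
    rw [Matrix.updateRow_self, Matrix.adjugate_apply, Matrix.adjugate_apply,
      Matrix.updateRow_idem]
  rw [this]
  have h := isHomogeneous_det (M := B.updateRow t x) (fun _ => 1) fun s e => by
    rw [Matrix.updateRow_apply]
    split_ifs
    exacts [hx e, hB s e]
  simpa using h

/-- If the rows of a matrix of linear forms, split in two blocks, are annihilated by
`(g, g')`, then a maximal minor of the second block multiplies `g'` into the product of the
ideal generated by `g` and a power of the irrelevant ideal. -/
lemma det_mul_mem_of_sum_mul_eq_zero {ι : Type*} [Fintype ι]
    {A : Matrix ι (Fin p) (MvPolynomial (Fin d) k)}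
    {B : Matrix (Fin p) (Fin p) (MvPolynomial (Fin d) k)}
    (hA : ∀ i e, (A i e).IsHomogeneous 1) (hB : ∀ t e, (B t e).IsHomogeneous 1)
    {g : ι → MvPolynomial (Fin d) k} {g' : Fin p → MvPolynomial (Fin d) k}
    (h : ∀ e, ∑ i, g i * A i e + ∑ t, g' t * B t e = 0) (t : Fin p) :
    B.det * g' t ∈ idealOfVars (Fin d) k ^ p * Ideal.span (Set.range g) := by
  have h1 : B.det * g' t = ∑ e, (∑ s, g' s * B s e) * B.adjugate e t := by
    have h2 : g' ᵥ* (B * B.adjugate) = B.det • g' := by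
      rw [Matrix.mul_adjugate, Matrix.vecMul_smul, Matrix.vecMul_one]
    rw [← Matrix.vecMul_vecMul] at h2
    exact (congrFun h2 t).symm
  have h3 : B.det * g' t = ∑ i, (-∑ e, A i e * B.adjugate e t) * g i := by
    rw [h1]
    simp_rw [fun e => eq_neg_of_add_eq_zero_right (h e), neg_mul, Finset.sum_mul,
      Finset.sum_neg_distrib]
    rw [Finset.sum_comm]
    congr 1
    refine Finset.sum_congr rfl fun i _ => Finset.sum_congr rfl fun e _ => ?_
    ring
  rw [h3]
  refine Ideal.sum_mem _ fun i _ => Ideal.mul_mem_mul (neg_mem ?_) (Ideal.subset_span ⟨i, rfl⟩)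
  exact mem_pow_idealOfVars_of_isHomogeneous (isHomogeneous_sum_mul_adjugate hB (hA i) t)

/-- If the rows of a matrix of linear forms with blocks `A`, `B` are annihilated by `(g, g')`
and the maximal minors of `B` have the greatest possible height, then the ideals generated by
`g` and by `(g, g')` agree up to a power of the irrelevant ideal. -/
lemma pow_idealOfVars_mul_span_le {ι : Type*} [Fintype ι] (hd : 1 ≤ d)
    {A : Matrix ι (Fin q) (MvPolynomial (Fin d) k)}
    {B : Matrix (Fin p) (Fin q) (MvPolynomial (Fin d) k)}
    (hA : ∀ i e, (A i e).IsHomogeneous 1) (hB : ∀ t e, (B t e).IsHomogeneous 1)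
    (hht : (d : ℕ∞) ≤ idealHeight (minorsIdeal p B)) (hp : q + 1 = p + d)
    {g : ι → MvPolynomial (Fin d) k} {g' : Fin p → MvPolynomial (Fin d) k}
    (h : ∀ e, ∑ i, g i * A i e + ∑ t, g' t * B t e = 0) :
    idealOfVars (Fin d) k ^ p * Ideal.span (Set.range g') ≤
      idealOfVars (Fin d) k ^ p * Ideal.span (Set.range g) := by
  refine (Ideal.mul_mono_left (pow_idealOfVars_le_span_minors hd hB hht hp)).trans ?_
  rw [Ideal.span_mul_span', Ideal.span_le]
  rintro _ ⟨_, ⟨c, rfl⟩, _, ⟨t, rfl⟩, rfl⟩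
  exact det_mul_mem_of_sum_mul_eq_zero (A := A.submatrix id c) (fun i e => hA i (c e))
    (fun t e => hB t (c e)) (fun e => h (c e)) t

end Residual

end KoszulStrand

/-- With `φ = [Φ₁; Φ₂]` an `n×(n−1)` matrix of linear forms, `a = d`,
`I = I_{n−1}(φ)` of height 2, `ht I_{n−d}(Φ₂) = d`, `f_1,…,f_n` the ordered signed
`(n−1)`-minors of `φ` and `J = (f_1,…,f_d)`:
`(x_1,…,x_d)^{n−d}·I = (x_1,…,x_d)^{n−d}·J`; in particular
`(x_1,…,x_d)^{n−d}·(f_{d+1},…,f_n) ⊆ (x_1,…,x_d)^{n−d}·J`.  (Here `n = m + 1`.) -/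
theorem statement3 {k : Type*} [Field k] [Infinite k] {d m : ℕ}
    (hd : 1 ≤ d) (hdm : d ≤ m)
    (φ : Matrix (Fin (m + 1)) (Fin m) (MvPolynomial (Fin d) k))
    (hlin : ∀ i j, (φ i j).IsHomogeneous 1)
    (Φ₂ : Matrix (Fin (m + 1 - d)) (Fin m) (MvPolynomial (Fin d) k))
    (hΦ₂ : Φ₂ = φ.submatrix (fun i : Fin (m + 1 - d) =>
      (⟨d + (i : ℕ), by have := i.isLt; omega⟩ : Fin (m + 1))) id)
    (hI : idealHeight (minorsIdeal m φ) = 2)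
    (hht : idealHeight (minorsIdeal (m + 1 - d) Φ₂) = (d : ℕ∞))
    (f : Fin (m + 1) → MvPolynomial (Fin d) k)
    (hf : f = fun i : Fin (m + 1) => (-1) ^ (i : ℕ) * (φ.submatrix (Fin.succAbove i) id).det)
    (J : Ideal (MvPolynomial (Fin d) k))
    (hJ : J = Ideal.span (Set.range fun i : Fin d =>
      f (⟨(i : ℕ), by have := i.isLt; omega⟩ : Fin (m + 1))))
    (mI : Ideal (MvPolynomial (Fin d) k))
    (hmI : mI = Ideal.span (Set.range (MvPolynomial.X : Fin d → MvPolynomial (Fin d) k))) :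
    mI ^ (m + 1 - d) * (minorsIdeal m φ) = mI ^ (m + 1 - d) * J ∧
      mI ^ (m + 1 - d) * Ideal.span (Set.range fun i : Fin (m + 1 - d) =>
        f (⟨d + (i : ℕ), by have := i.isLt; omega⟩ : Fin (m + 1))) ≤
          mI ^ (m + 1 - d) * J := by
  subst hΦ₂ hJ hmI
  have hf' : f = KoszulStrand.signedMinors φ := hf
  have hsplit : ∀ F : Fin (m + 1) → MvPolynomial (Fin d) k, ∑ i, F i =
      ∑ i : Fin d, F ⟨i, by omega⟩ + ∑ i : Fin (m + 1 - d), F ⟨d + i, by omega⟩ := fun F => by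
    rw [← (finCongr (show d + (m + 1 - d) = m + 1 by omega)).sum_comp, Fin.sum_univ_add]
    rfl
  have hle := KoszulStrand.pow_idealOfVars_mul_span_le (p := m + 1 - d) hd
    (A := φ.submatrix (fun i : Fin d => (⟨i, by omega⟩ : Fin (m + 1))) id)
    (fun i e => hlin _ _) (fun t e => hlin _ _) hht.ge (by omega)
    (g := fun i : Fin d => f ⟨i, by omega⟩)
    (g' := fun i : Fin (m + 1 - d) => f ⟨d + i, by omega⟩) fun e => by
      have := KoszulStrand.sum_signedMinors_mul φ e
      rwa [hsplit, ← hf'] at this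
  refine ⟨le_antisymm ?_ (Ideal.mul_mono_right ?_), hle⟩
  · rw [KoszulStrand.minorsIdeal_eq_span_signedMinors, ← hf']
    have hsub : Ideal.span (Set.range f) ≤
        Ideal.span (Set.range fun i : Fin d => f ⟨i, by omega⟩) ⊔
          Ideal.span (Set.range fun i : Fin (m + 1 - d) => f ⟨d + i, by omega⟩) := by
      refine Ideal.span_le.2 ?_
      rintro _ ⟨i, rfl⟩
      by_cases hi : (i : ℕ) < d
      · exact Ideal.mem_sup_left (Ideal.subset_span ⟨⟨i, hi⟩, rfl⟩)
      · refine Ideal.mem_sup_right (Ideal.subset_span ⟨⟨i - d, by omega⟩, ?_⟩)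
        exact congrArg f (Fin.ext (by simp only; omega))
    refine (Ideal.mul_mono_right hsub).trans ?_
    rw [Ideal.mul_sup]
    exact sup_le le_rfl hle
  · rw [KoszulStrand.minorsIdeal_eq_span_signedMinors, ← hf']
    refine Ideal.span_mono ?_
    rintro _ ⟨i, rfl⟩
    exact ⟨_, rfl⟩
end

section
/- Let k be a field with char(k) ∤ n, and let F = ℓ_1⋯ℓ_n ∈ R = k[x_1,…,x_d] be the defining form of a generic hyperplane arrangement of size n ≥ d+1 (i.e., the ℓ_i are pairwise non-proportional linear forms any d of which are linearly independent). Then the gradient ideal J_F = (∂F/∂x_1,…,∂F/∂x_d) is an ideal of linear type. -/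
open Matrix MvPolynomial

namespace GenericArrangement

section Grading

variable {k σ : Type*} [Field k]

attribute [local instance] MvPolynomial.weightedGradedAlgebra

lemma component_mul_of_isWeightedHomogeneous {w : σ → ℕ × ℕ} {a : MvPolynomial σ k} {e : ℕ × ℕ}
    (ha : IsWeightedHomogeneous w a e) (b : MvPolynomial σ k) (m : ℕ × ℕ) :
    weightedHomogeneousComponent w (e + m) (a * b) =
      a * weightedHomogeneousComponent w m b := by
  have := DirectSum.coe_decompose_mul_of_left_mem (weightedHomogeneousSubmodule k w)
    (b := b) (e + m) (i := e) (a := a) ha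
  rw [if_pos (by simp)] at this
  rw [add_tsub_cancel_left] at this
  simp_rw [← weightedDecomposition.decompose'_apply]
  exact this

lemma component_mul_eq_zero {w : σ → ℕ × ℕ} {a : MvPolynomial σ k} {e : ℕ × ℕ}
    (ha : IsWeightedHomogeneous w a e) (b : MvPolynomial σ k) {m : ℕ × ℕ} (h : ¬ e ≤ m) :
    weightedHomogeneousComponent w m (a * b) = 0 := by
  have := DirectSum.coe_decompose_mul_of_left_mem (weightedHomogeneousSubmodule k w)
    (b := b) m (i := e) (a := a) ha
  rw [if_neg h] at this
  rw [← weightedDecomposition.decompose'_apply]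
  exact this

lemma component_mem_span {w : σ → ℕ × ℕ} {s : Set (MvPolynomial σ k)}
    (hs : ∀ x ∈ s, ∃ e, IsWeightedHomogeneous w x e) {p : MvPolynomial σ k}
    (hp : p ∈ Ideal.span s) (m : ℕ × ℕ) :
    weightedHomogeneousComponent w m p ∈ Ideal.span s := by
  exact weightedHomogeneousComponent_mem_of_mem k w
    (Ideal.homogeneous_span (weightedHomogeneousSubmodule k w) s hs) hp m

/-- A homogeneous element of `I + (c)`, with `I` and `c` homogeneous, is a sum of homogeneous
elements of `I` and `(c)` of the same degree. -/
lemma exists_homogeneous_decomposition {w : σ → ℕ × ℕ} {I : Ideal (MvPolynomial σ k)}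
    (hI : ∀ p ∈ I, ∀ m, weightedHomogeneousComponent w m p ∈ I)
    {c : MvPolynomial σ k} {e : ℕ × ℕ} (hc : IsWeightedHomogeneous w c e)
    {f : MvPolynomial σ k} {m : ℕ × ℕ} (hf : IsWeightedHomogeneous w f m)
    (h : f ∈ I ⊔ Ideal.span {c}) :
    f ∈ I ∨ ∃ a ∈ I, ∃ g m', e + m' = m ∧ IsWeightedHomogeneous w g m' ∧ f = a + c * g := by
  obtain ⟨a, ha, b, hb, rfl⟩ := Submodule.mem_sup.mp h
  obtain ⟨g, rfl⟩ := Ideal.mem_span_singleton.mp hb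
  by_cases hem : e ≤ m
  · obtain ⟨m', rfl⟩ := exists_add_of_le hem
    refine Or.inr ⟨_, hI a ha (e + m'), weightedHomogeneousComponent w m' g, m', rfl,
      weightedHomogeneousComponent_isWeightedHomogeneous _ _, ?_⟩
    rw [← component_mul_of_isWeightedHomogeneous hc, ← map_add,
      hf.weightedHomogeneousComponent_same]
  · left
    have := hf.weightedHomogeneousComponent_same
    rw [map_add, component_mul_eq_zero hc _ hem, add_zero] at this
    rw [← this]
    exact hI a ha m

end Grading

section Forms

variable {k ι κ : Type*} [Field k] [Fintype ι]

/-- The bigrading of `k[x, Y]`, with `Sum.inr` indexing the variables `x` of bidegree `(1, 0)`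
and `Sum.inl` indexing the variables `Y` of bidegree `(0, 1)`. -/
def biweight (ι : Type*) : ι ⊕ ι → ℕ × ℕ := Sum.elim (fun _ => (0, 1)) (fun _ => (1, 0))

/-- The linear form `∑ c_i x_i`. -/
noncomputable def baseForm : (ι → k) →ₗ[k] MvPolynomial (ι ⊕ ι) k :=
  Fintype.linearCombination k fun i => X (Sum.inr i)

/-- The linear form `∑ v_i Y_i`. -/
noncomputable def fiberForm : (ι → k) →ₗ[k] MvPolynomial (ι ⊕ ι) k :=
  Fintype.linearCombination k fun i => X (Sum.inl i)

variable (k ι) in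
/-- The form `∑ x_i Y_i`. -/
noncomputable def incidenceForm : MvPolynomial (ι ⊕ ι) k := ∑ i, X (Sum.inr i) * X (Sum.inl i)

lemma aeval_baseForm {B : Type*} [CommRing B] [Algebra k B] (g : ι ⊕ ι → B) (c : ι → k) :
    aeval g (baseForm c) = ∑ i, c i • g (Sum.inr i) := by
  simp [baseForm, Fintype.linearCombination_apply]

lemma aeval_fiberForm {B : Type*} [CommRing B] [Algebra k B] (g : ι ⊕ ι → B) (c : ι → k) :
    aeval g (fiberForm c) = ∑ i, c i • g (Sum.inl i) := by
  simp [fiberForm, Fintype.linearCombination_apply]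

lemma baseForm_single [DecidableEq ι] (i : ι) :
    baseForm (Pi.single i (1 : k)) = X (Sum.inr i) := by
  simp [baseForm, Fintype.linearCombination_apply, Pi.single_apply]

lemma fiberForm_single [DecidableEq ι] (i : ι) :
    fiberForm (Pi.single i (1 : k)) = X (Sum.inl i) := by
  simp [fiberForm, Fintype.linearCombination_apply, Pi.single_apply]

lemma baseForm_eq_zero {c : ι → k} (h : baseForm c = 0) : c = 0 := by
  classical
  funext i
  simpa [aeval_baseForm, Pi.single_apply] using
    congrArg (aeval (Sum.elim (fun _ => (0 : k)) (Pi.single i 1))) h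

lemma fiberForm_eq_zero {c : ι → k} (h : fiberForm c = 0) : c = 0 := by
  classical
  funext i
  simpa [aeval_fiberForm, Pi.single_apply] using
    congrArg (aeval (Sum.elim (Pi.single i 1) (fun _ => (0 : k)))) h

lemma isBihomogeneous_baseForm (c : ι → k) :
    IsWeightedHomogeneous (biweight ι) (baseForm c) (1, 0) := by
  rw [baseForm, Fintype.linearCombination_apply]
  refine IsWeightedHomogeneous.sum _ _ _ fun i _ => ?_
  rw [smul_eq_C_mul]
  exact (isWeightedHomogeneous_X k (biweight ι) (Sum.inr i)).C_mul _

lemma isBihomogeneous_fiberForm (c : ι → k) :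
    IsWeightedHomogeneous (biweight ι) (fiberForm c) (0, 1) := by
  rw [fiberForm, Fintype.linearCombination_apply]
  refine IsWeightedHomogeneous.sum _ _ _ fun i _ => ?_
  rw [smul_eq_C_mul]
  exact (isWeightedHomogeneous_X k (biweight ι) (Sum.inl i)).C_mul _

lemma isBihomogeneous_incidenceForm :
    IsWeightedHomogeneous (biweight ι) (incidenceForm k ι) (1, 1) :=
  IsWeightedHomogeneous.sum _ _ _ fun i _ =>
    (isWeightedHomogeneous_X k (biweight ι) (Sum.inr i)).mul
      (isWeightedHomogeneous_X k (biweight ι) (Sum.inl i))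

lemma sum_eq_of_mem_support {f : MvPolynomial (ι ⊕ ι) k} {j r : ℕ}
    (hf : IsWeightedHomogeneous (biweight ι) f (j, r)) {d : ι ⊕ ι →₀ ℕ} (hd : d ∈ f.support) :
    ∑ t, d (Sum.inr t) = j ∧ ∑ t, d (Sum.inl t) = r := by
  have := hf (mem_support_iff.mp hd)
  rw [Finsupp.weight_apply, Finsupp.sum_fintype _ _ (by simp)] at this
  simp only [biweight, Fintype.sum_sum_type, Sum.elim_inl, Sum.elim_inr, Prod.ext_iff, Prod.fst_add,
    Prod.fst_sum, Prod.snd_add, Prod.snd_sum, Prod.smul_mk, smul_eq_mul, mul_zero, mul_one,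
    Finset.sum_const_zero, zero_add, add_zero] at this
  exact this

lemma aeval_smul_of_isBihomogeneous {B : Type*} [CommRing B] [Algebra k B]
    {f : MvPolynomial (ι ⊕ ι) k} {j r : ℕ} (hf : IsWeightedHomogeneous (biweight ι) f (j, r))
    (α β : ι → B) (s t : B) :
    aeval (Sum.elim (fun i => t * β i) (fun i => s * α i)) f =
      s ^ j * t ^ r * aeval (Sum.elim β α) f := by
  rw [aeval_def, eval₂_eq', aeval_def, eval₂_eq', Finset.mul_sum]
  refine Finset.sum_congr rfl fun d hd => ?_
  have := sum_eq_of_mem_support hf hd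
  simp only [Fintype.prod_sum_type, Sum.elim_inl, Sum.elim_inr, mul_pow, Finset.prod_mul_distrib,
    Finset.prod_pow_eq_pow_sum, this.1, this.2]
  ring

end Forms

section Linear

variable {k ι κ : Type*} [Field k] [Fintype ι] {a : κ → ι → k}

/-- Any at most `card ι` of the vectors `a i` are linearly independent. -/
def IsGeneric (a : κ → ι → k) : Prop :=
  ∀ Z : Finset κ, Z.card ≤ Fintype.card ι → LinearIndependent k fun i : Z => a i

/-- The vectors `e i`, `i ∈ Z`, are dual to the linear forms `a j`, `j ∈ Z`. -/
def IsDual (a : κ → ι → k) (Z : Finset κ) (e : κ → ι → k) : Prop :=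
  ∀ i ∈ Z, a i ⬝ᵥ e i = 1 ∧ ∀ j ∈ Z, j ≠ i → a j ⬝ᵥ e i = 0

lemma IsGeneric.mulVec_surjective (ha : IsGeneric a) {Z : Finset κ}
    (hZ : Z.card ≤ Fintype.card ι) :
    Function.Surjective (Matrix.of fun i : Z => a i).mulVecLin := by
  rw [← LinearMap.range_eq_top]
  apply Submodule.eq_top_of_finrank_eq
  have : LinearIndependent k (Matrix.of fun i : Z => a i).row := ha Z hZ
  simpa [Matrix.rank] using this.rank_matrix

lemma IsGeneric.exists_isDual (ha : IsGeneric a) {Z : Finset κ}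
    (hZ : Z.card ≤ Fintype.card ι) : ∃ e, IsDual a Z e := by
  classical
  choose f hf using ha.mulVec_surjective hZ
  refine ⟨fun i => if h : i ∈ Z then f (Pi.single ⟨i, h⟩ 1) else 0, fun i hi => ?_⟩
  have key (j : Z) : a j ⬝ᵥ f (Pi.single ⟨i, hi⟩ 1) = (Pi.single ⟨i, hi⟩ 1 : Z → k) j :=
    congrFun (hf (Pi.single ⟨i, hi⟩ 1)) j
  simp only [dif_pos hi]
  refine ⟨by simpa using key ⟨i, hi⟩, fun j hj hji => ?_⟩
  rw [key ⟨j, hj⟩, Pi.single_eq_of_ne]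
  simpa using hji

lemma IsDual.dotProduct_sum {Z : Finset κ} {e : κ → ι → k} (he : IsDual a Z e) {i : κ}
    (hi : i ∈ Z) (c : κ → k) : a i ⬝ᵥ ∑ j ∈ Z, c j • e j = c i := by
  rw [_root_.dotProduct_sum, Finset.sum_eq_single i]
  · simp [(he i hi).1]
  · intro j hj hji
    simp [(he j hj).2 i hi hji.symm]
  · exact fun h => absurd hi h

/-- The common kernel of the linear forms `a i`, `i ∈ Z`. -/
def commonKernel (a : κ → ι → k) (Z : Finset κ) : Submodule k (ι → k) :=
  LinearMap.ker (Matrix.of fun i : Z => a i).mulVecLin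

lemma mem_commonKernel {Z : Finset κ} {v : ι → k} :
    v ∈ commonKernel a Z ↔ ∀ i ∈ Z, a i ⬝ᵥ v = 0 := by
  rw [commonKernel, LinearMap.mem_ker, funext_iff]
  simp [Matrix.mulVec]

lemma IsGeneric.finrank_commonKernel (ha : IsGeneric a) {Z : Finset κ}
    (hZ : Z.card ≤ Fintype.card ι) :
    Module.finrank k (commonKernel a Z) + Z.card = Fintype.card ι := by
  have h := (Matrix.of fun i : Z => a i).mulVecLin.finrank_range_add_finrank_ker
  rw [LinearMap.range_eq_top.mpr (ha.mulVec_surjective hZ)] at h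
  simp at h
  rw [commonKernel, add_comm, h]

lemma IsGeneric.eq_zero_of_mem (ha : IsGeneric a) {Z : Finset κ}
    (hZ : Z.card = Fintype.card ι) {v : ι → k} (hv : v ∈ commonKernel a Z) : v = 0 := by
  have h := ha.finrank_commonKernel hZ.le
  have : Module.finrank k (commonKernel a Z) = 0 := by omega
  rw [Submodule.finrank_eq_zero] at this
  simpa [this] using hv

lemma IsGeneric.card_lt (ha : IsGeneric a) {Z : Finset κ} {v : ι → k}
    (hv : v ∈ commonKernel a Z) (hv0 : v ≠ 0) : Z.card < Fintype.card ι := by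
  by_contra! h
  obtain ⟨Z', hZ', hc⟩ := Finset.exists_subset_card_eq h
  exact hv0 (ha.eq_zero_of_mem hc (mem_commonKernel.mpr fun i hi =>
    mem_commonKernel.mp hv i (hZ' hi)))

lemma IsGeneric.exists_spanning (ha : IsGeneric a) {Z : Finset κ}
    (hZ : Z.card + 1 = Fintype.card ι) :
    ∃ v ∈ commonKernel a Z, v ≠ 0 ∧ ∀ w ∈ commonKernel a Z, ∃ c : k, w = c • v := by
  have h := ha.finrank_commonKernel (Z := Z) (by omega)
  have h1 : Module.finrank k (commonKernel a Z) = 1 := by omega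
  obtain ⟨v, hv, hs⟩ := finrank_eq_one_iff'.mp h1
  refine ⟨v, v.2, by simpa using hv, fun w hw => ?_⟩
  obtain ⟨c, hc⟩ := hs ⟨w, hw⟩
  exact ⟨c, by simpa using (congrArg Subtype.val hc).symm⟩

end Linear

section LogIdeal

variable {k ι κ : Type*} [Field k] [Fintype ι] {a : κ → ι → k}

open Classical in
/-- The product of the linear forms `a i`, `i ∈ A`, that do not vanish at `v`. -/
noncomputable def nonvanishingProd (a : κ → ι → k) (v : ι → k) (A : Finset κ) :
    MvPolynomial (ι ⊕ ι) k :=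
  ∏ i ∈ A, if a i ⬝ᵥ v = 0 then 1 else baseForm (a i)

open Classical in
lemma isBihomogeneous_nonvanishingProd (v : ι → k) (A : Finset κ) :
    IsWeightedHomogeneous (biweight ι) (nonvanishingProd a v A)
      ((A.filter fun i => a i ⬝ᵥ v ≠ 0).card, 0) := by
  have : ((A.filter fun i => a i ⬝ᵥ v ≠ 0).card, 0) =
      ∑ i ∈ A, if a i ⬝ᵥ v = 0 then (0 : ℕ × ℕ) else (1, 0) := by
    rw [Finset.card_filter, Prod.ext_iff, Prod.fst_sum, Prod.snd_sum]
    constructor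
    · exact Finset.sum_congr rfl fun i _ => by split_ifs <;> simp_all
    · exact (Finset.sum_eq_zero fun i _ => by split_ifs <;> rfl).symm
  rw [this]
  refine IsWeightedHomogeneous.prod _ _ _ fun i _ => ?_
  split_ifs
  · exact isWeightedHomogeneous_one k (biweight ι)
  · exact isBihomogeneous_baseForm (a i)

/-- Linear forms indexed by `W`, the form `∑ x_i Y_i`, and for each `v` in the common kernel of
the forms in `W` the derivation-like element `(∏ ℓ_i) (∑ v_i Y_i)`, where `i ∈ A` runs through
the forms not vanishing at `v`. -/
noncomputable def logIdeal (a : κ → ι → k) (W A : Finset κ) : Ideal (MvPolynomial (ι ⊕ ι) k) :=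
  Ideal.span ((fun i => baseForm (a i)) '' W ∪ {incidenceForm k ι} ∪
    {q | ∃ v ∈ commonKernel a W, q = nonvanishingProd a v A * fiberForm v})

lemma logIdeal_le {W A : Finset κ} {I : Ideal (MvPolynomial (ι ⊕ ι) k)}
    (h1 : ∀ i ∈ W, baseForm (a i) ∈ I) (h2 : incidenceForm k ι ∈ I)
    (h3 : ∀ v ∈ commonKernel a W, nonvanishingProd a v A * fiberForm v ∈ I) :
    logIdeal a W A ≤ I := by
  rw [logIdeal, Ideal.span_le]
  rintro _ ((⟨i, hi, rfl⟩ | rfl) | ⟨v, hv, rfl⟩)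
  exacts [h1 i hi, h2, h3 v hv]

lemma baseForm_mem_logIdeal {W A : Finset κ} {i : κ} (hi : i ∈ W) :
    baseForm (a i) ∈ logIdeal a W A :=
  Ideal.subset_span (.inl (.inl ⟨i, hi, rfl⟩))

lemma incidenceForm_mem_logIdeal {W A : Finset κ} : incidenceForm k ι ∈ logIdeal a W A :=
  Ideal.subset_span (.inl (.inr rfl))

lemma nonvanishingProd_mul_mem_logIdeal {W A : Finset κ} {v : ι → k}
    (hv : v ∈ commonKernel a W) : nonvanishingProd a v A * fiberForm v ∈ logIdeal a W A :=
  Ideal.subset_span (.inr ⟨v, hv, rfl⟩)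

lemma component_mem_logIdeal {W A : Finset κ} {p : MvPolynomial (ι ⊕ ι) k}
    (hp : p ∈ logIdeal a W A) (m : ℕ × ℕ) :
    weightedHomogeneousComponent (biweight ι) m p ∈ logIdeal a W A := by
  refine component_mem_span ?_ hp m
  rintro _ ((⟨i, hi, rfl⟩ | rfl) | ⟨v, hv, rfl⟩)
  · exact ⟨_, isBihomogeneous_baseForm _⟩
  · exact ⟨_, isBihomogeneous_incidenceForm⟩
  · exact ⟨_, (isBihomogeneous_nonvanishingProd v A).mul (isBihomogeneous_fiberForm v)⟩

variable [DecidableEq κ]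

lemma mem_commonKernel_insert {n : κ} {W : Finset κ} {v : ι → k} :
    v ∈ commonKernel a (insert n W) ↔ a n ⬝ᵥ v = 0 ∧ v ∈ commonKernel a W := by
  simp [mem_commonKernel]

lemma logIdeal_insert_le {n : κ} {W A : Finset κ} (hn : n ∉ A) :
    logIdeal a (insert n W) A ≤ logIdeal a W (insert n A) ⊔ Ideal.span {baseForm (a n)} := by
  refine logIdeal_le (fun i hi => ?_) (Ideal.mem_sup_left incidenceForm_mem_logIdeal)
    fun v hv => ?_
  · rcases Finset.mem_insert.mp hi with rfl | hi
    · exact Ideal.mem_sup_right (Ideal.mem_span_singleton_self _)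
    · exact Ideal.mem_sup_left (baseForm_mem_logIdeal hi)
  · rw [mem_commonKernel_insert] at hv
    have := nonvanishingProd_mul_mem_logIdeal (A := insert n A) hv.2
    rw [nonvanishingProd, Finset.prod_insert hn, if_pos hv.1, one_mul] at this
    exact Ideal.mem_sup_left this

lemma baseForm_mul_mem_logIdeal {n : κ} {W A : Finset κ} (hn : n ∉ A)
    {p : MvPolynomial (ι ⊕ ι) k} (hp : p ∈ logIdeal a W A) :
    baseForm (a n) * p ∈ logIdeal a W (insert n A) := by
  have : logIdeal a W A ≤
      (logIdeal a W (insert n A)).colon {baseForm (a n)} := by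
    refine logIdeal_le (fun i hi => ?_) ?_ fun v hv => ?_ <;>
      rw [Submodule.mem_colon_singleton, smul_eq_mul]
    · exact Ideal.mul_mem_right _ _ (baseForm_mem_logIdeal hi)
    · exact Ideal.mul_mem_right _ _ incidenceForm_mem_logIdeal
    · have := nonvanishingProd_mul_mem_logIdeal (A := insert n A) hv
      rw [nonvanishingProd, Finset.prod_insert hn] at this
      split_ifs at this with h
      · rw [one_mul] at this
        exact Ideal.mul_mem_right _ _ this
      · rw [mul_comm, ← mul_assoc]
        exact this
  have h := this hp
  rw [Submodule.mem_colon_singleton, smul_eq_mul, mul_comm] at h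
  exact h

end LogIdeal

section Specialization

variable {k ι κ : Type*} [Field k] [Fintype ι] [DecidableEq ι] {a : κ → ι → k}

/-- The projection of `k[x, Y]` onto the coordinate ring of the product of the common kernel of the
forms `a i`, `i ∈ Z`, with the span of these forms. -/
noncomputable def conormalProj (a : κ → ι → k) (Z : Finset κ) (e : κ → ι → k) :
    MvPolynomial (ι ⊕ ι) k →ₐ[k] MvPolynomial (ι ⊕ ι) k :=
  aeval (Sum.elim (fun t => fiberForm (∑ i ∈ Z, a i t • e i))
    (fun t => baseForm (Pi.single t 1 - ∑ i ∈ Z, e i t • a i)))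

lemma conormalProj_baseForm (Z : Finset κ) (e : κ → ι → k) (c : ι → k) :
    conormalProj a Z e (baseForm c) = baseForm (c - ∑ i ∈ Z, (c ⬝ᵥ e i) • a i) := by
  simp only [conormalProj, aeval_baseForm, Sum.elim_inr, ← map_smul, ← map_sum]
  congr 1
  ext t
  simp only [smul_sub, Finset.sum_sub_distrib, Pi.sub_apply, Finset.sum_apply, Pi.smul_apply,
    smul_eq_mul, Finset.mul_sum, dotProduct, Finset.sum_mul]
  rw [Finset.sum_comm]
  simp [Pi.single_apply, mul_assoc]

lemma conormalProj_fiberForm (Z : Finset κ) (e : κ → ι → k) (v : ι → k) :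
    conormalProj a Z e (fiberForm v) = fiberForm (∑ i ∈ Z, (a i ⬝ᵥ v) • e i) := by
  simp only [conormalProj, aeval_fiberForm, Sum.elim_inl, ← map_smul, ← map_sum]
  congr 1
  ext t
  simp only [Finset.sum_apply, Pi.smul_apply, smul_eq_mul, Finset.mul_sum, dotProduct,
    Finset.sum_mul]
  rw [Finset.sum_comm]
  exact Finset.sum_congr rfl fun _ _ => Finset.sum_congr rfl fun _ _ => by ring

variable {Z : Finset κ} {e : κ → ι → k}

lemma IsDual.conormalProj_baseForm_eq_zero (he : IsDual a Z e) {i : κ} (hi : i ∈ Z) :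
    conormalProj a Z e (baseForm (a i)) = 0 := by
  rw [conormalProj_baseForm, Finset.sum_eq_single i, (he i hi).1, one_smul, sub_self, map_zero]
  · intro j hj hji
    rw [(he j hj).2 i hi hji.symm, zero_smul]
  · exact fun h => absurd hi h

lemma conormalProj_fiberForm_eq_zero {v : ι → k} (hv : v ∈ commonKernel a Z) :
    conormalProj a Z e (fiberForm v) = 0 := by
  rw [conormalProj_fiberForm, Finset.sum_eq_zero, map_zero]
  intro i hi
  rw [mem_commonKernel.mp hv i hi, zero_smul]

lemma IsDual.conormalProj_incidenceForm (he : IsDual a Z e) :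
    conormalProj a Z e (incidenceForm k ι) = 0 := by
  have : conormalProj a Z e (incidenceForm k ι) =
      ∑ i ∈ Z, conormalProj a Z e (baseForm (a i)) * fiberForm (e i) := by
    simp only [incidenceForm, map_sum, map_mul, conormalProj, aeval_X, Sum.elim_inl, Sum.elim_inr,
      map_smul, Finset.mul_sum, aeval_baseForm, Finset.sum_mul]
    rw [Finset.sum_comm]
    exact Finset.sum_congr rfl fun _ _ => Finset.sum_congr rfl fun _ _ => by
      simp only [smul_mul_assoc, mul_smul_comm]
  rw [this]
  exact Finset.sum_eq_zero fun i hi => by rw [he.conormalProj_baseForm_eq_zero hi, zero_mul]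

lemma IsGeneric.conormalProj_baseForm_ne_zero [DecidableEq κ] (ha : IsGeneric a) {n : κ}
    (hn : n ∉ Z) (hZ : (insert n Z).card ≤ Fintype.card ι) :
    conormalProj a Z e (baseForm (a n)) ≠ 0 := by
  rw [conormalProj_baseForm]
  intro h
  have h0 := baseForm_eq_zero h
  have hli := ha _ hZ
  have hmem : a n ∈ Submodule.span k (a '' Z) := by
    rw [sub_eq_zero] at h0
    rw [h0]
    exact Submodule.sum_mem _ fun i hi => Submodule.smul_mem _ _
      (Submodule.subset_span ⟨i, hi, rfl⟩)
  have hli' : LinearIndepOn k a (insert n (Z : Set κ)) := by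
    rw [← Finset.coe_insert]; exact hli
  exact (linearIndepOn_insert (by simpa using hn)).mp hli' |>.2 hmem

lemma IsDual.sub_conormalProj_mem_logIdeal (he : IsDual a Z e) (f : MvPolynomial (ι ⊕ ι) k) :
    f - conormalProj a Z e f ∈ logIdeal a Z ∅ := by
  have key : (Ideal.Quotient.mkₐ k (logIdeal a Z ∅)) =
      (Ideal.Quotient.mkₐ k (logIdeal a Z ∅)).comp (conormalProj a Z e) := by
    refine algHom_ext fun t => ?_
    simp only [AlgHom.comp_apply, Ideal.Quotient.mkₐ_eq_mk, Ideal.Quotient.mk_eq_mk_iff_sub_mem]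
    rcases t with t | t
    · rw [← fiberForm_single, conormalProj_fiberForm, ← map_sub]
      have := nonvanishingProd_mul_mem_logIdeal (a := a) (W := Z) (A := ∅)
        (v := Pi.single t 1 - ∑ i ∈ Z, (a i ⬝ᵥ Pi.single t 1) • e i)
        (mem_commonKernel.mpr fun i hi => by rw [dotProduct_sub, he.dotProduct_sum hi, sub_self])
      simpa [nonvanishingProd] using this
    · rw [← baseForm_single, conormalProj_baseForm, ← map_sub, sub_sub_cancel, map_sum]
      refine Ideal.sum_mem _ fun i hi => ?_
      rw [map_smul]
      exact Submodule.smul_of_tower_mem _ _ (baseForm_mem_logIdeal hi)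
  rw [← Ideal.Quotient.mk_eq_mk_iff_sub_mem]
  exact DFunLike.congr_fun key f

lemma IsDual.conormalProj_eq_zero_of_mem [DecidableEq κ] (he : IsDual a Z e) {W A : Finset κ}
    (hW : W ⊆ Z) (hZ : Z ⊆ W ∪ A) {f : MvPolynomial (ι ⊕ ι) k} (hf : f ∈ logIdeal a W A) :
    conormalProj a Z e f = 0 := by
  have : logIdeal a W A ≤ RingHom.ker (conormalProj a Z e) := by
    refine logIdeal_le (fun i hi => he.conormalProj_baseForm_eq_zero (hW hi))
      he.conormalProj_incidenceForm fun v hv => ?_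
    rw [RingHom.mem_ker, map_mul]
    by_cases h : v ∈ commonKernel a Z
    · rw [conormalProj_fiberForm_eq_zero h, mul_zero]
    · simp only [mem_commonKernel, not_forall] at h
      obtain ⟨i, hi, hne⟩ := h
      have hiA : i ∈ A := (Finset.mem_union.mp (hZ hi)).resolve_left fun hiW =>
        hne (mem_commonKernel.mp hv i hiW)
      rw [nonvanishingProd, map_prod, Finset.prod_eq_zero hiA, zero_mul]
      rw [if_neg hne, he.conormalProj_baseForm_eq_zero hi]
  exact this hf

/-- If the forms indexed by `W` span all linear forms, every element of positive degree in `x`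
lies in the ideal they generate. -/
lemma IsDual.mem_span_of_card_eq (he : IsDual a Z e) (ha : IsGeneric a)
    (hZ : Z.card = Fintype.card ι) {f : MvPolynomial (ι ⊕ ι) k} {j r : ℕ}
    (hf : IsWeightedHomogeneous (biweight ι) f (j, r)) (hj : 1 ≤ j)
    {I : Ideal (MvPolynomial (ι ⊕ ι) k)} (hI : ∀ i ∈ Z, baseForm (a i) ∈ I) : f ∈ I := by
  have hX (t : ι) : (X (Sum.inr t) : MvPolynomial (ι ⊕ ι) k) ∈ I := by
    have h0 : (Pi.single t 1 - ∑ i ∈ Z, e i t • a i : ι → k) = 0 := by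
      ext s
      have := ha.eq_zero_of_mem hZ (v := Pi.single s 1 - ∑ i ∈ Z, (a i ⬝ᵥ Pi.single s 1) • e i)
        (mem_commonKernel.mpr fun i hi => by rw [dotProduct_sub, he.dotProduct_sum hi, sub_self])
      simpa [Pi.single_apply, eq_comm, mul_comm] using congrFun this t
    rw [sub_eq_zero] at h0
    rw [← baseForm_single, h0, map_sum]
    refine Ideal.sum_mem _ fun i hi => ?_
    rw [map_smul]
    exact Submodule.smul_of_tower_mem _ _ (hI i hi)
  rw [f.as_sum]
  refine Ideal.sum_mem _ fun d hd => ?_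
  have := (sum_eq_of_mem_support hf hd).1
  obtain ⟨t, -, ht⟩ : ∃ t ∈ Finset.univ, d (Sum.inr t) ≠ 0 := by
    refine Finset.exists_ne_zero_of_sum_ne_zero (f := fun t => d (Sum.inr t)) ?_
    omega
  exact Ideal.mem_of_dvd _ ((X_dvd_monomial).mpr (Or.inr ht)) (hX t)

end Specialization

section Membership

variable {k ι κ : Type*} [Field k] [Fintype ι] [DecidableEq ι] [DecidableEq κ] {a : κ → ι → k}

/-- A bihomogeneous element of sufficiently large degree in `x` that is killed by all the
projections `conormalProj a Z e`, `W ⊆ Z ⊆ W ∪ A`, lies in `logIdeal a W A`. -/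
theorem IsGeneric.mem_logIdeal (ha : IsGeneric a) (A : Finset κ) :
    ∀ (W : Finset κ) (j r : ℕ) (f : MvPolynomial (ι ⊕ ι) k), Disjoint W A →
      W.card ≤ Fintype.card ι → IsWeightedHomogeneous (biweight ι) f (j, r) →
      W.card + A.card + 1 ≤ j + Fintype.card ι →
      (∀ Z, W ⊆ Z → Z ⊆ W ∪ A → Z.card < Fintype.card ι → ∀ e, IsDual a Z e →
        conormalProj a Z e f = 0) → f ∈ logIdeal a W A := by
  induction A using Finset.induction_on with
  | empty =>
    intro W j r f _ hW hf hc hZ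
    obtain ⟨e, he⟩ := ha.exists_isDual hW
    rcases hW.eq_or_lt with hW | hW
    · rw [Finset.card_empty] at hc
      exact he.mem_span_of_card_eq ha hW hf (by omega) fun i hi => baseForm_mem_logIdeal hi
    · simpa [hZ W subset_rfl (by simp) hW e he] using he.sub_conormalProj_mem_logIdeal f
  | insert n A hn ih =>
    intro W j r f hd hW hf hc hZ
    rw [Finset.card_insert_of_notMem hn] at hc
    rw [Finset.disjoint_insert_right] at hd
    rcases hW.eq_or_lt with hW | hW
    · obtain ⟨e, he⟩ := ha.exists_isDual hW.le
      exact he.mem_span_of_card_eq ha hW hf (by omega) fun i hi => baseForm_mem_logIdeal hi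
    have h1 : f ∈ logIdeal a (insert n W) A := by
      refine ih _ j r f (Finset.disjoint_insert_left.mpr ⟨hn, hd.2⟩) ?_ hf ?_ fun Z h h' => ?_
      · rw [Finset.card_insert_of_notMem hd.1]; omega
      · rw [Finset.card_insert_of_notMem hd.1]; omega
      · exact hZ Z ((Finset.subset_insert _ _).trans h) (by
          rw [Finset.union_insert, ← Finset.insert_union]; exact h')
    rcases exists_homogeneous_decomposition (fun p hp m => component_mem_logIdeal hp m)
      (isBihomogeneous_baseForm (a n)) hf (logIdeal_insert_le hn h1) with h |
      ⟨b, hb, g, ⟨j', r'⟩, hm, hg, rfl⟩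
    · exact h
    obtain ⟨hj, -⟩ := Prod.ext_iff.mp hm
    simp only [Prod.fst_add] at hj
    refine Ideal.add_mem _ hb (baseForm_mul_mem_logIdeal hn
      (ih W j' r' g hd.2 hW.le hg (by omega) fun Z h h' hZc e he => ?_))
    have hnZ : n ∉ Z := fun hnZ => (Finset.mem_union.mp (h' hnZ)).elim hd.1 hn
    have hsub : Z ⊆ W ∪ insert n A :=
      h'.trans (Finset.union_subset_union_right (Finset.subset_insert _ _))
    have := hZ Z h hsub hZc e he
    rw [map_add, he.conormalProj_eq_zero_of_mem h hsub hb, zero_add, map_mul] at this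
    refine (mul_eq_zero.mp this).resolve_left (ha.conormalProj_baseForm_ne_zero hnZ ?_)
    rw [Finset.card_insert_of_notMem hnZ]
    omega

end Membership

section Interpolation

variable {k ι κ : Type*} [Field k] [Fintype ι] {a : κ → ι → k}

/-- Evaluation of the variables `x` at a point `v`. -/
noncomputable def evalBase (v : ι → k) : MvPolynomial (ι ⊕ ι) k →ₐ[k] MvPolynomial (ι ⊕ ι) k :=
  aeval (Sum.elim (fun t => X (Sum.inl t)) (fun t => C (v t)))

lemma evalBase_baseForm (v c : ι → k) : evalBase v (baseForm c) = C (c ⬝ᵥ v) := by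
  rw [evalBase, aeval_baseForm, dotProduct, map_sum]
  exact Finset.sum_congr rfl fun t _ => by rw [smul_eq_C_mul, map_mul, Sum.elim_inr]

/-- A bihomogeneous element of small degree in `x` that vanishes at all the vertices of the
arrangement lying on the forms indexed by `W` belongs to the ideal of these forms. -/
theorem IsGeneric.mem_of_evalBase_eq_zero [DecidableEq ι] [DecidableEq κ] (ha : IsGeneric a)
    (A : Finset κ) :
    ∀ (W : Finset κ) (j r : ℕ) (f : MvPolynomial (ι ⊕ ι) k), Disjoint W A →
      W.card + 1 ≤ Fintype.card ι → Fintype.card ι ≤ W.card + A.card + 1 →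
      IsWeightedHomogeneous (biweight ι) f (j, r) →
      j + Fintype.card ι ≤ W.card + A.card + 1 →
      (∀ Z, W ⊆ Z → Z ⊆ W ∪ A → Z.card + 1 = Fintype.card ι → ∀ v ∈ commonKernel a Z, v ≠ 0 →
        evalBase v f = 0) →
      f ∈ Ideal.span ((fun i => (baseForm (a i) : MvPolynomial (ι ⊕ ι) k)) '' W) := by
  have base (W : Finset κ) (hW : W.card + 1 = Fintype.card ι) (j r : ℕ)
      (f : MvPolynomial (ι ⊕ ι) k) (hf : IsWeightedHomogeneous (biweight ι) f (j, r))
      (h : ∀ v ∈ commonKernel a W, v ≠ 0 → evalBase v f = 0) :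
      f ∈ Ideal.span ((fun i => (baseForm (a i) : MvPolynomial (ι ⊕ ι) k)) '' W) := by
    obtain ⟨v, hv, hv0, hspan⟩ := ha.exists_spanning hW
    obtain ⟨e, he⟩ := ha.exists_isDual (Z := W) (by omega)
    set I := Ideal.span ((fun i => (baseForm (a i) : MvPolynomial (ι ⊕ ι) k)) '' W)
    choose c hc using fun t => hspan (Pi.single t 1 - ∑ i ∈ W, (a i ⬝ᵥ Pi.single t 1) • e i)
      (mem_commonKernel.mpr fun i hi => by rw [dotProduct_sub, he.dotProduct_sum hi, sub_self])
    have key : Ideal.Quotient.mkₐ k I = (Ideal.Quotient.mkₐ k I).comp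
        (aeval (Sum.elim (fun t => 1 * X (Sum.inl t))
          (fun t => baseForm c * C (v t)))) := by
      refine algHom_ext fun t => ?_
      rcases t with t | t
      · simp
      simp only [AlgHom.comp_apply, Ideal.Quotient.mkₐ_eq_mk, Ideal.Quotient.mk_eq_mk_iff_sub_mem,
        aeval_X, Sum.elim_inr]
      have : (X (Sum.inr t) - baseForm c * C (v t) : MvPolynomial (ι ⊕ ι) k) =
          baseForm (∑ i ∈ W, e i t • a i) := by
        rw [mul_comm, ← smul_eq_C_mul, ← map_smul, ← baseForm_single, ← map_sub]
        congr 1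
        ext s
        have := congrFun (hc s) t
        simp [Pi.single_apply] at this ⊢
        rw [mul_comm (v t), ← this]
        simp [mul_comm, eq_comm]
      rw [this, map_sum]
      refine Ideal.sum_mem _ fun i hi => ?_
      rw [map_smul]
      exact Submodule.smul_of_tower_mem _ _ (Ideal.subset_span ⟨i, hi, rfl⟩)
    have h0 := h v hv hv0
    rw [evalBase] at h0
    have := DFunLike.congr_fun key f
    rw [AlgHom.comp_apply, aeval_smul_of_isBihomogeneous hf, h0, mul_zero, map_zero] at this
    exact Ideal.Quotient.eq_zero_iff_mem.mp this
  induction A using Finset.induction_on with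
  | empty =>
    intro W j r f _ hW hW' hf hc hZ
    rw [Finset.card_empty] at hW'
    exact base W (by omega) j r f hf fun v hv hv0 =>
        hZ W subset_rfl Finset.subset_union_left (by omega) v hv hv0
  | insert n A hn ih =>
    intro W j r f hd hW hW' hf hc hZ
    rw [Finset.card_insert_of_notMem hn] at hc hW'
    rw [Finset.disjoint_insert_right] at hd
    rcases hW.eq_or_lt with hW | hW
    · exact base W hW j r f hf fun v hv hv0 =>
        hZ W subset_rfl Finset.subset_union_left hW v hv hv0
    rcases hW'.eq_or_lt with hW' | hW'
    · have hcard : (W ∪ insert n A).card + 1 = Fintype.card ι := by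
        rw [Finset.card_union_of_disjoint (Finset.disjoint_insert_right.mpr hd),
          Finset.card_insert_of_notMem hn, hW']
      obtain rfl : j = 0 := by omega
      obtain ⟨v, hv, hv0, -⟩ := ha.exists_spanning hcard
      have h0 := hZ _ Finset.subset_union_left subset_rfl hcard v hv hv0
      have h1 := aeval_smul_of_isBihomogeneous hf (fun t => C (v t) : ι → MvPolynomial (ι ⊕ ι) k)
        (fun t => X (Sum.inl t)) 0 1
      have h2 := aeval_smul_of_isBihomogeneous hf (fun t => X (Sum.inr t))
        (fun t => (X (Sum.inl t) : MvPolynomial (ι ⊕ ι) k)) 0 1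
      have hX : (Sum.elim (fun t => X (Sum.inl t)) fun t => X (Sum.inr t)) =
          (X : ι ⊕ ι → MvPolynomial (ι ⊕ ι) k) := by
        ext t; cases t <;> rfl
      rw [evalBase] at h0
      rw [h0] at h1
      simp only [zero_mul] at h1 h2
      rw [h2, hX, aeval_X_left_apply] at h1
      simp only [pow_zero, one_pow, one_mul, mul_zero] at h1
      simp [h1]
    have hI (p : MvPolynomial (ι ⊕ ι) k)
        (hp : p ∈ Ideal.span ((fun i => (baseForm (a i) : MvPolynomial (ι ⊕ ι) k)) '' W))
        (m : ℕ × ℕ) : weightedHomogeneousComponent (biweight ι) m p ∈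
          Ideal.span ((fun i => (baseForm (a i) : MvPolynomial (ι ⊕ ι) k)) '' W) := by
      refine component_mem_span ?_ hp m
      rintro _ ⟨i, -, rfl⟩
      exact ⟨_, isBihomogeneous_baseForm _⟩
    have h1 : f ∈ Ideal.span ((fun i => (baseForm (a i) : MvPolynomial (ι ⊕ ι) k)) ''
        (insert n W : Finset κ)) := by
      refine ih _ j r f (Finset.disjoint_insert_left.mpr ⟨hn, hd.2⟩) ?_ ?_ hf ?_ fun Z h h' => ?_
      · rw [Finset.card_insert_of_notMem hd.1]; omega
      · rw [Finset.card_insert_of_notMem hd.1]; omega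
      · rw [Finset.card_insert_of_notMem hd.1]; omega
      · exact hZ Z ((Finset.subset_insert _ _).trans h) (by
          rw [Finset.union_insert, ← Finset.insert_union]; exact h')
    rw [Finset.coe_insert, Set.image_insert_eq, Ideal.span_insert, sup_comm] at h1
    rcases exists_homogeneous_decomposition hI (isBihomogeneous_baseForm (a n)) hf h1 with h |
      ⟨b, hb, g, ⟨j', r'⟩, hm, hg, rfl⟩
    · exact h
    obtain ⟨hj, -⟩ := Prod.ext_iff.mp hm
    simp only [Prod.fst_add] at hj
    refine Ideal.add_mem _ hb (Ideal.mul_mem_left _ _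
      (ih W j' r' g hd.2 (by omega) (by omega) hg (by omega) fun Z h h' hZc v hv hv0 => ?_))
    have hnZ : n ∉ Z := fun hnZ => (Finset.mem_union.mp (h' hnZ)).elim hd.1 hn
    have hsub : Z ⊆ W ∪ insert n A :=
      h'.trans (Finset.union_subset_union_right (Finset.subset_insert _ _))
    have hb0 : evalBase v b = 0 := by
      have : Ideal.span ((fun i => (baseForm (a i) : MvPolynomial (ι ⊕ ι) k)) '' W) ≤
          RingHom.ker (evalBase v) := by
        rw [Ideal.span_le]
        rintro _ ⟨i, hi, rfl⟩
        simp only [SetLike.mem_coe, RingHom.mem_ker]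
        rw [evalBase_baseForm, mem_commonKernel.mp hv i (h hi), C_0]
      exact this hb
    have := hZ Z h hsub hZc v hv hv0
    rw [map_add, hb0, zero_add, map_mul, evalBase_baseForm] at this
    refine (mul_eq_zero.mp this).resolve_left ?_
    rw [C_eq_zero]
    intro hnv
    refine hv0 (ha.eq_zero_of_mem (Z := insert n Z) ?_ (mem_commonKernel_insert.mpr ⟨hnv, hv⟩))
    rw [Finset.card_insert_of_notMem hnZ, hZc]

end Interpolation

lemma derivation_prod {k A κ : Type*} [CommSemiring k] [CommSemiring A] [Algebra k A]
    [DecidableEq κ] (D : Derivation k A A) (s : Finset κ) (f : κ → A) :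
    D (∏ i ∈ s, f i) = ∑ i ∈ s, D (f i) * ∏ j ∈ s.erase i, f j := by
  induction s using Finset.induction_on with
  | empty => simp
  | insert n s hn ih =>
    rw [Finset.prod_insert hn, Derivation.leibniz, ih, Finset.sum_insert hn,
      Finset.erase_insert hn, smul_eq_mul, smul_eq_mul, Finset.mul_sum, add_comm, mul_comm]
    congr 1
    refine Finset.sum_congr rfl fun i hi => ?_
    rw [Finset.erase_insert_of_ne (by rintro rfl; exact hn hi), Finset.prod_insert (by simp [hn])]
    ring

section Gradient

variable {k ι κ : Type*} [Field k] [Fintype ι] {a : κ → ι → k}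

/-- The linear form `∑ c_i x_i` in `k[x]`. -/
noncomputable def linForm : (ι → k) →ₗ[k] MvPolynomial ι k :=
  Fintype.linearCombination k X

lemma aeval_linForm {B : Type*} [CommRing B] [Algebra k B] (g : ι → B) (c : ι → k) :
    aeval g (linForm c) = ∑ i, c i • g i := by
  simp [linForm, Fintype.linearCombination_apply]

lemma rename_linForm (c : ι → k) : rename Sum.inr (linForm c) = baseForm (ι := ι) c := by
  simp [linForm, baseForm, Fintype.linearCombination_apply]

lemma linForm_isHomogeneous (c : ι → k) : (linForm c).IsHomogeneous 1 := by
  rw [linForm, Fintype.linearCombination_apply]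
  refine IsHomogeneous.sum _ _ _ fun i _ => ?_
  rw [smul_eq_C_mul]
  exact (isHomogeneous_X k i).C_mul _

lemma pderiv_linForm (t : ι) (c : ι → k) : pderiv t (linForm c) = C (c t) := by
  classical
  simp [linForm, Fintype.linearCombination_apply, Pi.single_apply, smul_eq_C_mul, eq_comm]

variable [Fintype κ]

/-- The defining form of the arrangement with coefficient vectors `a i`. -/
noncomputable def definingForm (a : κ → ι → k) : MvPolynomial ι k := ∏ i, linForm (a i)

/-- The substitution of the gradient of the defining form for the variables `Y`. -/
noncomputable def evalGrad (a : κ → ι → k) : MvPolynomial (ι ⊕ ι) k →ₐ[k] MvPolynomial ι k :=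
  aeval (Sum.elim (fun t => pderiv t (definingForm a)) X)

lemma definingForm_isHomogeneous : (definingForm a).IsHomogeneous (Fintype.card κ) := by
  simpa [definingForm] using IsHomogeneous.prod Finset.univ (fun i => linForm (a i)) (fun _ => 1)
    fun i _ => linForm_isHomogeneous (a i)

lemma pderiv_definingForm [DecidableEq κ] (t : ι) :
    pderiv t (definingForm a) =
      ∑ i, C (a i t) * ∏ j ∈ Finset.univ.erase i, linForm (a j) := by
  simp [definingForm, derivation_prod, pderiv_linForm]

lemma evalGrad_incidenceForm :
    evalGrad a (incidenceForm k ι) = Fintype.card κ * definingForm a := by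
  rw [← nsmul_eq_mul, ← definingForm_isHomogeneous.sum_X_mul_pderiv]
  simp [evalGrad, incidenceForm]

lemma aeval_gradient_eq_zero {B : Type*} [CommRing B] [Algebra k B] {p : MvPolynomial (ι ⊕ ι) k}
    (hp : evalGrad a p = 0) (ξ : ι → B) :
    aeval (Sum.elim (fun t => aeval ξ (pderiv t (definingForm a))) ξ) p = 0 := by
  have h := congrArg (aeval ξ) hp
  rw [map_zero, evalGrad, ← AlgHom.comp_apply, comp_aeval] at h
  convert h using 3
  ext t
  cases t <;> simp

variable [DecidableEq κ]

/-- Degeneration of the relations of the gradient to a point `x` of the common zero locus of the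
forms `a i`, `i ∈ Z`. -/
lemma IsDual.aeval_eq_zero_of_evalGrad {B : Type*} [CommRing B] [IsDomain B] [Algebra k B]
    {Z : Finset κ} {e : κ → ι → k} (he : IsDual a Z e) (hne : Z.Nonempty)
    {p : MvPolynomial (ι ⊕ ι) k} {j r : ℕ} (hp : IsWeightedHomogeneous (biweight ι) p (j, r))
    (h0 : evalGrad a p = 0) (x : ι → B) (hx : ∀ i ∈ Z, ∑ t, a i t • x t = 0)
    (hx' : ∀ i ∉ Z, ∑ t, a i t • x t ≠ 0) (u : κ → B) :
    aeval (Sum.elim (fun t => ∑ i ∈ Z, a i t • ∏ l ∈ Z.erase i, u l) x) p = 0 := by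
  obtain ⟨z, hz⟩ : ∃ z, Z.card = z + 1 := ⟨Z.card - 1, by have := hne.card_pos; omega⟩
  let ξ : ι → Polynomial B := fun t =>
    Polynomial.C (x t) + Polynomial.X * Polynomial.C (∑ i ∈ Z, e i t • u i)
  let lam : κ → Polynomial B := fun i => aeval ξ (linForm (a i))
  have hlam (i : κ) : lam i = Polynomial.C (∑ t, a i t • x t) +
      Polynomial.X * Polynomial.C (∑ l ∈ Z, (a i ⬝ᵥ e l) • u l) := by
    simp only [lam, ξ, aeval_linForm, smul_add, Finset.sum_add_distrib, map_sum, Finset.mul_sum,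
      Finset.smul_sum, dotProduct, Finset.sum_smul]
    congr 1
    · exact Finset.sum_congr rfl fun t _ => Polynomial.smul_C _ _
    · rw [Finset.sum_comm]
      refine Finset.sum_congr rfl fun t _ => Finset.sum_congr rfl fun l _ => ?_
      rw [mul_smul, ← Polynomial.smul_C (a i l), mul_smul_comm]
  have hlamZ (i : κ) (hi : i ∈ Z) : lam i = Polynomial.X * Polynomial.C (u i) := by
    rw [hlam, hx i hi, map_zero, zero_add, Finset.sum_eq_single i, (he i hi).1, one_smul]
    · intro j hj hji
      rw [(he j hj).2 i hi hji.symm, zero_smul]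
    · exact fun h => absurd hi h
  let Γ : Polynomial B := ∏ i ∈ Zᶜ, lam i
  let η : ι → Polynomial B := fun t =>
    (∑ i ∈ Z, a i t • Polynomial.C (∏ l ∈ Z.erase i, u l)) * Γ +
    Polynomial.X * ∑ i ∈ Zᶜ, a i t • ((∏ l ∈ Z, Polynomial.C (u l)) * ∏ l ∈ Zᶜ.erase i, lam l)
  have hgrad (t : ι) : aeval ξ (pderiv t (definingForm a)) = Polynomial.X ^ z * η t := by
    rw [pderiv_definingForm, map_sum]
    simp only [map_mul, map_prod, algHom_C]
    change ∑ i, algebraMap k (Polynomial B) (a i t) * ∏ l ∈ Finset.univ.erase i, lam l = _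
    rw [← Finset.sum_add_sum_compl Z]
    simp only [η, mul_add, Finset.sum_mul, Finset.mul_sum]
    congr 1 <;> refine Finset.sum_congr rfl fun i hi => ?_
    · have : Finset.univ.erase i = Z.erase i ∪ Zᶜ := by
        ext l; by_cases h : l ∈ Z <;> simp [h]; rintro rfl; exact h hi
      rw [this, Finset.prod_union (Finset.disjoint_left.mpr fun l hl hl' =>
        Finset.mem_compl.mp hl' (Finset.mem_of_mem_erase hl)),
        Finset.prod_congr rfl fun l hl => hlamZ l (Finset.mem_of_mem_erase hl),
        Finset.prod_mul_distrib, Finset.prod_const, Finset.card_erase_of_mem hi, hz,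
        ← map_prod, Algebra.smul_def, Nat.add_sub_cancel]
      ring
    · have : Finset.univ.erase i = Z ∪ Zᶜ.erase i := by
        ext l; by_cases h : l ∈ Z <;> simp [h]; rintro rfl; exact Finset.mem_compl.mp hi h
      rw [this, Finset.prod_union (Finset.disjoint_left.mpr fun l hl hl' =>
        Finset.mem_compl.mp (Finset.mem_of_mem_erase hl') hl),
        Finset.prod_congr rfl fun l hl => hlamZ l hl,
        Finset.prod_mul_distrib, Finset.prod_const, hz, Algebra.smul_def]
      ring
  have h1 := aeval_gradient_eq_zero h0 ξ
  have h2 := aeval_smul_of_isBihomogeneous hp ξ η 1 (Polynomial.X ^ z)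
  simp only [one_mul, one_pow, ← hgrad] at h2
  rw [h1] at h2
  have h3 := (mul_eq_zero.mp h2.symm).resolve_left
    (pow_ne_zero _ (pow_ne_zero _ Polynomial.X_ne_zero))
  let ev : Polynomial B →ₐ[k] B := (Polynomial.aeval (0 : B)).restrictScalars k
  have hevC (b : B) : ev (Polynomial.C b) = b := by simp [ev]
  have hevX : ev Polynomial.X = 0 := by simp [ev]
  have h4 := congrArg ev h3
  rw [map_zero, ← AlgHom.comp_apply, comp_aeval] at h4
  have h5 : (fun t => ev (Sum.elim η ξ t)) =
      Sum.elim (fun t => ev Γ * ∑ i ∈ Z, a i t • ∏ l ∈ Z.erase i, u l) (fun t => 1 * x t) := by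
    ext t : 1
    rcases t with t | t
    · rw [Sum.elim_inl, Sum.elim_inl, map_add, map_mul, map_mul, hevX, zero_mul, add_zero, map_sum,
        mul_comm]
      congr 1
      exact Finset.sum_congr rfl fun i _ => by rw [map_smul, hevC]
    · simp only [Sum.elim_inr, ξ, map_add, map_mul, hevX, zero_mul, add_zero, hevC, one_mul]
  rw [h5, aeval_smul_of_isBihomogeneous hp] at h4
  have hΓ : ev Γ ≠ 0 := by
    rw [map_prod, Finset.prod_ne_zero_iff]
    intro i hi
    rw [hlam, map_add, map_mul, hevX, zero_mul, add_zero, hevC]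
    exact hx' i (Finset.mem_compl.mp hi)
  exact (mul_eq_zero.mp h4).resolve_left (by simp [hΓ])

lemma prod_mul_prod_erase_prod_erase {B κ : Type*} [CommRing B] [DecidableEq κ] {Z : Finset κ}
    {z : ℕ} (hz : Z.card = z + 1) {i : κ} (hi : i ∈ Z) (T : κ → B) :
    (∏ l ∈ Z, T l) * ∏ l ∈ Z.erase i, ∏ m ∈ Z.erase l, T m = (∏ l ∈ Z, T l) ^ z * T i := by
  have h : ∏ l ∈ Z.erase i, (T l * ∏ m ∈ Z.erase l, T m) = (∏ l ∈ Z, T l) ^ z := by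
    rw [Finset.prod_congr rfl fun l hl => Finset.mul_prod_erase Z T (Finset.mem_of_mem_erase hl),
      Finset.prod_const, Finset.card_erase_of_mem hi, hz, Nat.add_sub_cancel]
  rw [← h, Finset.prod_mul_distrib, ← Finset.mul_prod_erase Z T hi]
  ring

/-- The relations of the gradient vanish on the conormal variety of the common zero locus of the
forms `a i`, `i ∈ Z`. -/
theorem IsGeneric.conormalProj_eq_zero [DecidableEq ι] (ha : IsGeneric a)
    {p : MvPolynomial (ι ⊕ ι) k} {j r : ℕ} (hp : IsWeightedHomogeneous (biweight ι) p (j, r)) (h0 : evalGrad a p = 0)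
    {Z : Finset κ} (hZ : Z.card < Fintype.card ι) {e : κ → ι → k} (he : IsDual a Z e) :
    conormalProj a Z e p = 0 := by
  rcases Z.eq_empty_or_nonempty with rfl | hne
  · have h1 := aeval_gradient_eq_zero h0 (fun t => (X (Sum.inr t) : MvPolynomial (ι ⊕ ι) k))
    have h2 := aeval_smul_of_isBihomogeneous hp (fun t => (X (Sum.inr t) : MvPolynomial (ι ⊕ ι) k))
      (fun t => aeval (fun t => (X (Sum.inr t) : MvPolynomial (ι ⊕ ι) k))
        (pderiv t (definingForm a))) 1 0
    rw [h1, mul_zero] at h2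
    rw [← h2, conormalProj]
    congr 2
    ext t : 1
    cases t <;> simp [baseForm_single]
  obtain ⟨z, hz⟩ : ∃ z, Z.card = z + 1 := ⟨Z.card - 1, by have := hne.card_pos; omega⟩
  have hsum (i : κ) : ∑ t, a i t • conormalProj a Z e (X (Sum.inr t)) =
      conormalProj a Z e (baseForm (a i)) := by
    simp [baseForm, Fintype.linearCombination_apply]
  have h6 := he.aeval_eq_zero_of_evalGrad hne hp h0
    (fun t => conormalProj a Z e (X (Sum.inr t)))
    (fun i hi => by rw [hsum, he.conormalProj_baseForm_eq_zero hi])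
    (fun i hi => by
      rw [hsum]
      refine ha.conormalProj_baseForm_ne_zero hi ?_
      rw [Finset.card_insert_of_notMem hi]
      omega)
    (fun i => ∏ l ∈ Z.erase i, fiberForm (e l))
  have hT (i : κ) (hi : i ∈ Z) : (fiberForm (e i) : MvPolynomial (ι ⊕ ι) k) ≠ 0 := by
    intro h
    have := (he i hi).1
    rw [fiberForm_eq_zero h, dotProduct_zero] at this
    exact zero_ne_one this
  have h7 := aeval_smul_of_isBihomogeneous hp (fun t => conormalProj a Z e (X (Sum.inr t)))
    (fun t => ∑ i ∈ Z, a i t • ∏ l ∈ Z.erase i, ∏ m ∈ Z.erase l, fiberForm (e m)) 1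
    (∏ l ∈ Z, fiberForm (e l))
  rw [h6, mul_zero] at h7
  have h8 (t : ι) : (∏ l ∈ Z, fiberForm (e l)) *
        ∑ i ∈ Z, a i t • ∏ l ∈ Z.erase i, ∏ m ∈ Z.erase l, fiberForm (e m) =
      (∏ l ∈ Z, fiberForm (e l)) ^ z * conormalProj a Z e (X (Sum.inl t)) := by
    rw [conormalProj, aeval_X, Sum.elim_inl, map_sum, Finset.mul_sum, Finset.mul_sum]
    refine Finset.sum_congr rfl fun i hi => ?_
    rw [mul_smul_comm, prod_mul_prod_erase_prod_erase hz hi, map_smul, mul_smul_comm]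
  simp only [h8] at h7
  rw [aeval_smul_of_isBihomogeneous hp] at h7
  have h9 := (mul_eq_zero.mp h7).resolve_left (by
    rw [one_pow, one_mul]
    exact pow_ne_zero _ (pow_ne_zero _ (Finset.prod_ne_zero_iff.mpr hT)))
  rw [← h9, aeval_unique (conormalProj a Z e)]
  congr 2
  ext t : 1
  cases t <;> simp

end Gradient

section Euler

variable {k ι : Type*} [Field k] [Fintype ι]

lemma sum_X_mul_pderiv_inr {f : MvPolynomial (ι ⊕ ι) k} {j r : ℕ}
    (hf : IsWeightedHomogeneous (biweight ι) f (j, r)) :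
    ∑ t, X (Sum.inr t) * pderiv (Sum.inr t) f = j • f := by
  have h : IsWeightedHomogeneous (Sum.elim (fun _ => 0) (fun _ => 1) : ι ⊕ ι → ℕ) f j := by
    intro d hd
    rw [Finsupp.weight_apply, Finsupp.sum_fintype _ _ (by simp)]
    simpa using (sum_eq_of_mem_support hf (mem_support_iff.mpr hd)).1
  simpa using h.sum_weight_X_mul_pderiv

lemma pderiv_inr_eq_zero {f : MvPolynomial (ι ⊕ ι) k} {r : ℕ}
    (hf : IsWeightedHomogeneous (biweight ι) f (0, r)) (t : ι) : pderiv (Sum.inr t) f = 0 := by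
  refine pderiv_eq_zero_of_notMem_vars fun h => ?_
  obtain ⟨d, hd, ht⟩ := (mem_vars_iff_mem_support _).mp h
  have := (sum_eq_of_mem_support hf hd).1
  rw [Finset.sum_eq_zero_iff] at this
  exact Finsupp.mem_support_iff.mp ht (this t (Finset.mem_univ t))

end Euler

section Polar

variable {k ι κ : Type*} [Field k] [Fintype ι] [Fintype κ] {a : κ → ι → k}

/-- The number of forms `a i` that do not vanish at `v`. -/
noncomputable def nonvanishingCard (a : κ → ι → k) (v : ι → k) : ℕ :=
  open Classical in (Finset.univ.filter fun i => a i ⬝ᵥ v ≠ 0).card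

/-- The derivative in the direction `v` of the product of the forms not vanishing at `v`. -/
noncomputable def polarDeriv (a : κ → ι → k) (v : ι → k) : MvPolynomial (ι ⊕ ι) k :=
  ∑ t, v t • pderiv (Sum.inr t) (nonvanishingProd a v Finset.univ)

/-- A linear relation between the partial derivatives of the defining form. -/
noncomputable def polarRelation (a : κ → ι → k) (v : ι → k) : MvPolynomial (ι ⊕ ι) k :=
  (Fintype.card κ : MvPolynomial (ι ⊕ ι) k) * (nonvanishingProd a v Finset.univ * fiberForm v) -
    polarDeriv a v * incidenceForm k ι

/-- The ideal generated by the relations `polarRelation a v`, `v ≠ 0`. -/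
noncomputable def polarIdeal (a : κ → ι → k) : Ideal (MvPolynomial (ι ⊕ ι) k) :=
  Ideal.span (Set.range fun v : {v : ι → k // v ≠ 0} => polarRelation a v)

lemma IsGeneric.lt_nonvanishingCard (ha : IsGeneric a) {v : ι → k} (hv : v ≠ 0) :
    Fintype.card κ < nonvanishingCard a v + Fintype.card ι := by
  classical
  have h1 := ha.card_lt (Z := Finset.univ.filter fun i => ¬ a i ⬝ᵥ v ≠ 0)
    (mem_commonKernel.mpr (by simp)) hv
  have h2 := Finset.card_filter_add_card_filter_not (s := (Finset.univ : Finset κ))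
    (fun i => a i ⬝ᵥ v ≠ 0)
  rw [Finset.card_univ] at h2
  rw [nonvanishingCard]
  convert_to _ < (Finset.univ.filter fun i => a i ⬝ᵥ v ≠ 0).card + _
  omega

lemma isBihomogeneous_nonvanishingProd_univ (v : ι → k) :
    IsWeightedHomogeneous (biweight ι) (nonvanishingProd a v Finset.univ)
      (nonvanishingCard a v, 0) :=
  isBihomogeneous_nonvanishingProd v _

lemma isBihomogeneous_polarDeriv {v : ι → k} {N : ℕ} (hN : nonvanishingCard a v = N + 1) :
    IsWeightedHomogeneous (biweight ι) (polarDeriv a v) (N, 0) := by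
  refine IsWeightedHomogeneous.sum _ _ _ fun t _ => ?_
  rw [smul_eq_C_mul]
  refine IsWeightedHomogeneous.C_mul ?_ _
  exact (isBihomogeneous_nonvanishingProd_univ v).pderiv (by rw [hN]; rfl)

lemma isBihomogeneous_polarRelation {v : ι → k} (hv : 0 < nonvanishingCard a v) :
    IsWeightedHomogeneous (biweight ι) (polarRelation a v) (nonvanishingCard a v, 1) := by
  obtain ⟨N, hN⟩ : ∃ N, nonvanishingCard a v = N + 1 := ⟨nonvanishingCard a v - 1, by omega⟩
  refine IsWeightedHomogeneous.sub ?_ ?_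
  · rw [← map_natCast C]
    exact ((isBihomogeneous_nonvanishingProd_univ v).mul (isBihomogeneous_fiberForm v)).C_mul _
  · rw [hN]
    exact (isBihomogeneous_polarDeriv hN).mul isBihomogeneous_incidenceForm

lemma evalGrad_rename (p : MvPolynomial ι k) : evalGrad a (rename Sum.inr p) = p := by
  rw [evalGrad, aeval_rename]
  exact aeval_X_left_apply p

lemma evalGrad_polarRelation (v : ι → k) : evalGrad a (polarRelation a v) = 0 := by
  classical
  let P : MvPolynomial ι k := ∏ i, if a i ⬝ᵥ v = 0 then 1 else linForm (a i)
  let Q : MvPolynomial ι k := ∏ i, if a i ⬝ᵥ v = 0 then linForm (a i) else 1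
  have hP : nonvanishingProd a v Finset.univ = rename Sum.inr P := by
    rw [nonvanishingProd, map_prod]
    refine Finset.prod_congr rfl fun i _ => ?_
    split_ifs <;> simp [rename_linForm]
  have hF : definingForm a = P * Q := by
    rw [definingForm, ← Finset.prod_mul_distrib]
    refine Finset.prod_congr rfl fun i _ => ?_
    split_ifs <;> simp
  let D : Derivation k (MvPolynomial ι k) (MvPolynomial ι k) := mkDerivation k fun t => C (v t)
  have hD (p : MvPolynomial ι k) : D p = ∑ t, v t • pderiv t p := by
    induction p using MvPolynomial.induction_on with
    | C c => simp [D]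
    | add p q hp hq => simp only [map_add, hp, hq, smul_add, Finset.sum_add_distrib]
    | mul_X p t hp =>
      simp only [Derivation.leibniz, hp, smul_add, Finset.sum_add_distrib, smul_eq_mul]
      simp [D, Pi.single_apply, Finset.mul_sum, smul_eq_C_mul, mul_comm, mul_left_comm]
  have hDQ : D Q = 0 := by
    rw [derivation_prod]
    refine Finset.sum_eq_zero fun i _ => ?_
    split_ifs with h
    · rw [hD]
      simp only [pderiv_linForm, smul_eq_C_mul, ← map_mul, ← map_sum]
      have : ∑ t, v t * a i t = 0 := by rw [← h]; exact dotProduct_comm _ _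
      rw [this, C_0, zero_mul]
    · simp
  have h1 : evalGrad a (fiberForm v) = D (P * Q) := by
    rw [evalGrad, aeval_fiberForm, hD, hF]
    rfl
  have h2 : evalGrad a (polarDeriv a v) = D P := by
    rw [hD, polarDeriv, map_sum]
    refine Finset.sum_congr rfl fun t _ => ?_
    rw [map_smul, hP, pderiv_rename Sum.inr_injective, evalGrad_rename]
  rw [polarRelation, map_sub, map_mul, map_mul, map_mul, h1, h2, evalGrad_incidenceForm, hP,
    evalGrad_rename, map_natCast, hF, Derivation.leibniz, hDQ]
  simp only [smul_eq_mul]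
  ring

lemma evalGrad_eq_zero_of_mem_polarIdeal {p : MvPolynomial (ι ⊕ ι) k} (hp : p ∈ polarIdeal a) :
    evalGrad a p = 0 := by
  have : polarIdeal a ≤ RingHom.ker (evalGrad a) := by
    rw [polarIdeal, Ideal.span_le]
    rintro _ ⟨v, rfl⟩
    exact evalGrad_polarRelation _
  exact this hp

lemma IsGeneric.component_mem_polarIdeal (ha : IsGeneric a)
    (hn : Fintype.card ι ≤ Fintype.card κ) {p : MvPolynomial (ι ⊕ ι) k}
    (hp : p ∈ polarIdeal a) (m : ℕ × ℕ) :
    weightedHomogeneousComponent (biweight ι) m p ∈ polarIdeal a := by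
  refine component_mem_span ?_ hp m
  rintro _ ⟨⟨v, hv⟩, rfl⟩
  have := ha.lt_nonvanishingCard hv
  exact ⟨_, isBihomogeneous_polarRelation (a := a) (v := v) (by omega)⟩

lemma logIdeal_le_polarIdeal_sup (hchar : (Fintype.card κ : k) ≠ 0) :
    logIdeal a ∅ Finset.univ ≤ polarIdeal a ⊔ Ideal.span {incidenceForm k ι} := by
  refine logIdeal_le (by simp) (Ideal.mem_sup_right (Ideal.mem_span_singleton_self _))
    fun v _ => ?_
  by_cases hv : v = 0
  · simp [hv]
  have hmem : polarRelation a v ∈ polarIdeal a := Ideal.subset_span ⟨⟨v, hv⟩, rfl⟩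
  have : nonvanishingProd a v Finset.univ * fiberForm v = C (Fintype.card κ : k)⁻¹ *
      (polarRelation a v + polarDeriv a v * incidenceForm k ι) := by
    rw [polarRelation, sub_add_cancel, ← mul_assoc, ← map_natCast C, ← C_mul,
      inv_mul_cancel₀ hchar, C_1, one_mul]
  rw [this]
  exact Ideal.mul_mem_left _ _ (Ideal.add_mem _ (Ideal.mem_sup_left hmem)
    (Ideal.mem_sup_right (Ideal.mul_mem_left _ _ (Ideal.mem_span_singleton_self _))))

end Polar

section Torsion

variable {k ι κ : Type*} [Field k] [Fintype ι] [Fintype κ] {a : κ → ι → k}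

/-- A bihomogeneous multiple of `∑ x_i Y_i` in the polar ideal is, up to terms `b v` of degree zero
in `x`, a combination of polar relations of the smallest possible degree. -/
lemma IsGeneric.exists_sum_of_mem_polarIdeal (ha : IsGeneric a) {m r : ℕ}
    (hm : m + Fintype.card ι = Fintype.card κ) {f : MvPolynomial (ι ⊕ ι) k}
    (hf : IsWeightedHomogeneous (biweight ι) f (m + 1, r + 1)) (h : f ∈ polarIdeal a) :
    ∃ (T : Finset (ι → k)) (b : (ι → k) → MvPolynomial (ι ⊕ ι) k),
      (∀ v, IsWeightedHomogeneous (biweight ι) (b v) (0, r)) ∧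
      (∀ v, b v ≠ 0 → nonvanishingCard a v = m + 1) ∧
      f = ∑ v ∈ T, b v * polarRelation a v := by
  classical
  obtain ⟨c, hc⟩ := Finsupp.mem_ideal_span_range_iff_exists_finsupp.mp h
  let b : (ι → k) → MvPolynomial (ι ⊕ ι) k := fun v =>
    if hv : v ≠ 0 ∧ nonvanishingCard a v = m + 1 then
      weightedHomogeneousComponent (biweight ι) (0, r) (c ⟨v, hv.1⟩) else 0
  refine ⟨c.support.map (Function.Embedding.subtype _), b, fun v => ?_, fun v hv => ?_, ?_⟩
  · dsimp only [b]
    split_ifs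
    · exact weightedHomogeneousComponent_isWeightedHomogeneous _ _
    · exact isWeightedHomogeneous_zero _ _ _
  · by_contra h
    exact hv (dif_neg fun h' => h h'.2)
  · rw [← hf.weightedHomogeneousComponent_same, ← hc, Finsupp.sum, map_sum, Finset.sum_map]
    refine Finset.sum_congr rfl fun ⟨v, hv⟩ _ => ?_
    have hlt := ha.lt_nonvanishingCard hv
    have hpol := isBihomogeneous_polarRelation (a := a) (v := v) (by omega)
    change weightedHomogeneousComponent (biweight ι) (m + 1, r + 1)
      (c ⟨v, hv⟩ * polarRelation a v) = b v * polarRelation a v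
    rw [mul_comm, mul_comm (b v)]
    by_cases hN : nonvanishingCard a v = m + 1
    · rw [hN] at hpol
      have := component_mul_of_isWeightedHomogeneous hpol (c ⟨v, hv⟩) (0, r)
      rw [Prod.mk_add_mk, add_zero, add_comm 1 r] at this
      rw [this]
      simp only [b, dif_pos (And.intro hv hN)]
    · rw [component_mul_eq_zero hpol _ fun h => hN (le_antisymm (Prod.mk_le_mk.mp h).1 (by omega))]
      simp only [b, hN, and_false, dif_neg, not_false_eq_true, mul_zero]

/-- A vector of forms orthogonal to `Y` that, at the vertices of the arrangement, is parallel to the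
vertex vanishes, provided its degree in `x` is small. -/
lemma IsGeneric.eq_zero_of_parallel [DecidableEq ι] [DecidableEq κ] (ha : IsGeneric a)
    [Nonempty ι] {j r : ℕ} (hj : j + Fintype.card ι ≤ Fintype.card κ + 1)
    (hκ : Fintype.card ι ≤ Fintype.card κ + 1)
    {G : ι → MvPolynomial (ι ⊕ ι) k}
    (hG : ∀ t, IsWeightedHomogeneous (biweight ι) (G t) (j, r))
    (hY : ∑ t, X (Sum.inl t) * G t = 0)
    (hv : ∀ Z : Finset κ, Z.card + 1 = Fintype.card ι → ∀ v ∈ commonKernel a Z, v ≠ 0 →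
      ∃ γ, ∀ t, evalBase v (G t) = γ * C (v t)) (t : ι) : G t = 0 := by
  have hpos := Fintype.card_pos (α := ι)
  have := ha.mem_of_evalBase_eq_zero Finset.univ ∅ j r (G t) (Finset.disjoint_empty_left _)
    (by rw [Finset.card_empty]; omega) (by simpa using hκ) (hG t) (by simpa using hj)
    fun Z _ _ hZ v hvZ hv0 => by
      obtain ⟨γ, hγ⟩ := hv Z hZ v hvZ hv0
      have h := congrArg (evalBase v) hY
      have h1 : γ * fiberForm v = 0 := by
        rw [map_zero, map_sum] at h
        rw [← h, fiberForm, Fintype.linearCombination_apply, Finset.mul_sum]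
        refine Finset.sum_congr rfl fun s _ => ?_
        rw [map_mul, hγ, evalBase, aeval_X, Sum.elim_inl, smul_eq_C_mul]
        ring
      rw [hγ, (mul_eq_zero.mp h1).resolve_right fun h => hv0 (fiberForm_eq_zero h), zero_mul]
  simpa using this

lemma IsGeneric.eq_zero_of_incidenceForm_mul_mem [DecidableEq ι] [DecidableEq κ] [Nonempty ι]
    (ha : IsGeneric a) (hchar : (Fintype.card κ : k) ≠ 0) {m r : ℕ}
    (hm : m + Fintype.card ι = Fintype.card κ) {u : MvPolynomial (ι ⊕ ι) k}
    (hu : IsWeightedHomogeneous (biweight ι) u (m, r))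
    (h : incidenceForm k ι * u ∈ polarIdeal a) : u = 0 := by
  have hsu := isBihomogeneous_incidenceForm.mul hu
  rw [Prod.mk_add_mk, add_comm 1, add_comm 1] at hsu
  obtain ⟨T, b, hb, hbN, hsum⟩ := ha.exists_sum_of_mem_polarIdeal hm hsu h
  let P : (ι → k) → MvPolynomial (ι ⊕ ι) k := fun v => nonvanishingProd a v Finset.univ
  let n : MvPolynomial (ι ⊕ ι) k := (Fintype.card κ : MvPolynomial (ι ⊕ ι) k)
  have hn : n = C (Fintype.card κ : k) := (map_natCast C _).symm
  let g := u + ∑ v ∈ T, b v * polarDeriv a v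
  let G : ι → MvPolynomial (ι ⊕ ι) k := fun t =>
    X (Sum.inr t) * g - n * ∑ v ∈ T, b v * (v t • P v)
  have hg : IsWeightedHomogeneous (biweight ι) g (m, r) := by
    refine hu.add (IsWeightedHomogeneous.sum _ _ _ fun v _ => ?_)
    by_cases h0 : b v = 0
    · rw [h0, zero_mul]; exact isWeightedHomogeneous_zero _ _ _
    · have := (hb v).mul (isBihomogeneous_polarDeriv (hbN v h0))
      rwa [Prod.mk_add_mk, zero_add, add_zero] at this
  have hG (t : ι) : IsWeightedHomogeneous (biweight ι) (G t) (m + 1, r) := by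
    refine IsWeightedHomogeneous.sub ?_ ?_
    · have := (isWeightedHomogeneous_X k (biweight ι) (Sum.inr t)).mul hg
      rwa [biweight, Sum.elim_inr, Prod.mk_add_mk, zero_add, add_comm 1] at this
    · rw [hn]
      refine (IsWeightedHomogeneous.sum _ _ _ fun v _ => ?_).C_mul _
      by_cases h0 : b v = 0
      · rw [h0, zero_mul]; exact isWeightedHomogeneous_zero _ _ _
      · have := (hb v).mul ((isBihomogeneous_nonvanishingProd_univ (a := a) v).C_mul (v t))
        rwa [Prod.mk_add_mk, zero_add, add_zero, hbN v h0, ← smul_eq_C_mul] at this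
  have hY : ∑ t, X (Sum.inl t) * G t = 0 := by
    have h1 : ∑ t, X (Sum.inl t) * G t = incidenceForm k ι * g -
        n * ∑ v ∈ T, b v * (P v * fiberForm v) := by
      simp only [G, mul_sub, Finset.sum_sub_distrib, incidenceForm, Finset.sum_mul, fiberForm,
        Fintype.linearCombination_apply, Finset.mul_sum]
      congr 1
      · exact Finset.sum_congr rfl fun t _ => by ring
      · rw [Finset.sum_comm]
        refine Finset.sum_congr rfl fun v _ => Finset.sum_congr rfl fun t _ => ?_
        simp only [smul_eq_C_mul]
        ring
    rw [h1, mul_add, hsum, Finset.mul_sum, Finset.mul_sum, ← Finset.sum_add_distrib,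
      ← Finset.sum_sub_distrib]
    refine Finset.sum_eq_zero fun v _ => ?_
    simp only [polarRelation, n, P]
    ring
  have hG0 : ∀ t, G t = 0 := by
    refine ha.eq_zero_of_parallel (j := m + 1) (by omega) (by omega) hG hY
      fun Z hZ v hv hv0 => ?_
    have hpar (w : ι → k) : ∃ γ : MvPolynomial (ι ⊕ ι) k,
        ∀ t, evalBase v (b w * (w t • P w)) = γ * C (v t) := by
      by_cases hw : w ∈ commonKernel a Z
      · obtain ⟨v₀, -, -, hs⟩ := ha.exists_spanning hZ
        obtain ⟨c, rfl⟩ := hs v hv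
        obtain ⟨c', rfl⟩ := hs w hw
        have hc : c ≠ 0 := by rintro rfl; simp at hv0
        refine ⟨C (c' * c⁻¹) * evalBase (c • v₀) (b (c' • v₀) * P (c' • v₀)), fun t => ?_⟩
        have : (c' • v₀) t = c' * c⁻¹ * (c • v₀) t := by
          simp only [Pi.smul_apply, smul_eq_mul]; field_simp
        rw [this, mul_smul_comm, map_smul, smul_eq_C_mul, C_mul]
        ring
      · rw [mem_commonKernel] at hw
        push Not at hw
        obtain ⟨i, hi, hne⟩ := hw
        refine ⟨0, fun t => ?_⟩
        have : evalBase v (P w) = 0 := by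
          simp only [P]
          rw [nonvanishingProd, map_prod]
          refine Finset.prod_eq_zero (Finset.mem_univ i) ?_
          rw [if_neg hne, evalBase_baseForm, mem_commonKernel.mp hv i hi, C_0]
        rw [map_mul, map_smul, this, smul_zero, mul_zero, zero_mul]
    choose γ hγ using hpar
    refine ⟨evalBase v g - n * ∑ w ∈ T, γ w, fun t => ?_⟩
    simp only [G]
    rw [map_sub, map_mul, map_mul, map_sum, Finset.sum_congr rfl fun w _ => hγ w t, evalBase,
      aeval_X, Sum.elim_inr, hn, algHom_C, ← Finset.sum_mul]
    change _ - C _ * _ = _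
    ring
  have hdiv : ∑ t, pderiv (Sum.inr t) (G t) = 0 :=
    Finset.sum_eq_zero fun t _ => by rw [hG0 t, map_zero]
  have hdiv' : ∑ t, pderiv (Sum.inr t) (G t) = n * g - n * ∑ v ∈ T, b v * polarDeriv a v := by
    have h1 (t : ι) : pderiv (Sum.inr t) (G t) = g + X (Sum.inr t) * pderiv (Sum.inr t) g -
        n * ∑ v ∈ T, b v * (v t • pderiv (Sum.inr t) (P v)) := by
      simp only [G, hn, map_sub, pderiv_mul, pderiv_X_self, one_mul, pderiv_C, zero_mul, zero_add,
        map_sum, pderiv_inr_eq_zero (hb _), Derivation.map_smul]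
    simp only [h1, Finset.sum_sub_distrib, Finset.sum_add_distrib, sum_X_mul_pderiv_inr hg]
    congr 1
    · rw [Finset.sum_const, Finset.card_univ, ← add_smul, add_comm, hm, nsmul_eq_mul]
    · rw [← Finset.mul_sum, Finset.sum_comm]
      simp only [polarDeriv, Finset.mul_sum, P]
  rw [hdiv, ← mul_sub] at hdiv'
  have := (mul_eq_zero.mp hdiv'.symm).resolve_left (by rw [hn, C_eq_zero]; exact hchar)
  simpa [g] using this

end Torsion

section Main

variable {k ι κ : Type*} [Field k] [Fintype ι] {a : κ → ι → k}

lemma IsGeneric.linForm_ne_zero [Nonempty ι] (ha : IsGeneric a) (i : κ) : linForm (a i) ≠ 0 := by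
  intro h
  have h1 := (ha {i} (by rw [Finset.card_singleton]; exact Fintype.card_pos)).ne_zero ⟨i, by simp⟩
  have h2 := congrArg (rename (Sum.inr : ι → ι ⊕ ι)) h
  rw [rename_linForm, map_zero] at h2
  exact h1 (baseForm_eq_zero h2)

variable [Fintype κ]

/-- The relations of the gradient of a generic arrangement are generated by the linear ones:
bihomogeneous case. -/
theorem IsGeneric.mem_polarIdeal_of_evalGrad [Nonempty ι] (ha : IsGeneric a)
    (hn : Fintype.card ι ≤ Fintype.card κ) (hchar : (Fintype.card κ : k) ≠ 0) {r : ℕ} :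
    ∀ {j : ℕ} {p : MvPolynomial (ι ⊕ ι) k}, IsWeightedHomogeneous (biweight ι) p (j, r) →
      evalGrad a p = 0 → p ∈ polarIdeal a := by
  classical
  induction r using Nat.strong_induction_on with
  | _ r ih =>
  have hF : evalGrad a (incidenceForm k ι) ≠ 0 := by
    rw [evalGrad_incidenceForm]
    refine mul_ne_zero ?_ (Finset.prod_ne_zero_iff.mpr fun i _ => ha.linForm_ne_zero i)
    rw [← map_natCast C, Ne, C_eq_zero]
    exact hchar
  have high {j : ℕ} {p : MvPolynomial (ι ⊕ ι) k}
      (hj : Fintype.card κ + 1 ≤ j + Fintype.card ι)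
      (hp : IsWeightedHomogeneous (biweight ι) p (j, r)) (h0 : evalGrad a p = 0) :
      p ∈ polarIdeal a := by
    have h1 : p ∈ logIdeal a ∅ Finset.univ :=
      ha.mem_logIdeal _ _ j r p (by simp) (by simp) hp (by simpa using hj)
        fun Z _ _ hZ e he => ha.conormalProj_eq_zero hp h0 hZ he
    rcases exists_homogeneous_decomposition (fun q hq m => ha.component_mem_polarIdeal hn hq m)
      isBihomogeneous_incidenceForm hp (logIdeal_le_polarIdeal_sup hchar h1) with
      h2 | ⟨b, hb, g, ⟨j', r'⟩, hm, hg, rfl⟩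
    · exact h2
    · rw [map_add, map_mul, evalGrad_eq_zero_of_mem_polarIdeal hb, zero_add] at h0
      have hr : 1 + r' = r := congrArg Prod.snd hm
      exact Ideal.add_mem _ hb (Ideal.mul_mem_left _ _
        (ih r' (by omega) hg ((mul_eq_zero.mp h0).resolve_left hF)))
  intro j p hp h0
  by_cases hj : Fintype.card κ + 1 ≤ j + Fintype.card ι
  · exact high hj hp h0
  obtain ⟨m, hm⟩ : ∃ m, m + Fintype.card ι = Fintype.card κ := ⟨_, Nat.sub_add_cancel hn⟩
  obtain ⟨c, rfl⟩ : ∃ c, m = c + j := ⟨m - j, by omega⟩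
  let t₀ : ι := Classical.arbitrary ι
  have hX (t : ι) : IsWeightedHomogeneous (biweight ι) (X (Sum.inr t) : MvPolynomial (ι ⊕ ι) k)
      (1, 0) := isWeightedHomogeneous_X k (biweight ι) (Sum.inr t)
  have hu : IsWeightedHomogeneous (biweight ι) (X (Sum.inr t₀) ^ c * p) (c + j, r) := by
    simpa using ((hX t₀).pow c).mul hp
  have hu0 : evalGrad a (X (Sum.inr t₀) ^ c * p) = 0 := by rw [map_mul, h0, mul_zero]
  have hmem : incidenceForm k ι * (X (Sum.inr t₀) ^ c * p) ∈ polarIdeal a := by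
    rw [incidenceForm, Finset.sum_mul]
    refine Ideal.sum_mem _ fun t _ => ?_
    rw [mul_comm (X (Sum.inr t)), mul_assoc]
    refine Ideal.mul_mem_left _ _ (high (j := 1 + (c + j)) (by omega) ?_ (by
      rw [map_mul, hu0, mul_zero]))
    simpa using (hX t).mul hu
  have := ha.eq_zero_of_incidenceForm_mul_mem hchar hm hu hmem
  rw [(mul_eq_zero.mp this).resolve_left (pow_ne_zero _ (X_ne_zero _))]
  exact Ideal.zero_mem _

/-- The map `x ↦ x`, `Y_t ↦ ∂_t F · T` whose kernel is the ideal of relations of the gradient. -/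
noncomputable def reesEval (a : κ → ι → k) :
    MvPolynomial (ι ⊕ ι) k →ₐ[k] Polynomial (MvPolynomial ι k) :=
  aeval (Sum.elim (fun t => Polynomial.X * Polynomial.C (pderiv t (definingForm a)))
    (fun t => Polynomial.C (X t)))

lemma reesEval_of_isBihomogeneous {p : MvPolynomial (ι ⊕ ι) k} {j r : ℕ}
    (hp : IsWeightedHomogeneous (biweight ι) p (j, r)) :
    reesEval a p = Polynomial.C (evalGrad a p) * Polynomial.X ^ r := by
  have h := aeval_smul_of_isBihomogeneous hp (fun t => Polynomial.C (X t : MvPolynomial ι k))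
    (fun t => Polynomial.C (pderiv t (definingForm a))) 1 Polynomial.X
  simp only [one_mul, one_pow] at h
  rw [reesEval, h, evalGrad, mul_comm]
  congr 1
  have h2 := AlgHom.comp_apply (Polynomial.CAlgHom (R := k)) (evalGrad a) p
  rw [evalGrad, comp_aeval] at h2
  refine Eq.trans ?_ h2
  congr 2
  ext1 t
  cases t <;> rfl

lemma evalGrad_isHomogeneous {p : MvPolynomial (ι ⊕ ι) k} {j r : ℕ}
    (hp : IsWeightedHomogeneous (biweight ι) p (j, r)) :
    (evalGrad a p).IsHomogeneous (r * (Fintype.card κ - 1) + j) := by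
  rw [evalGrad, aeval_def, eval₂_eq']
  refine IsHomogeneous.sum _ _ _ fun d hd => ?_
  obtain ⟨h1, h2⟩ := sum_eq_of_mem_support hp hd
  refine IsHomogeneous.C_mul ?_ _
  rw [Fintype.prod_sum_type]
  simp only [Sum.elim_inl, Sum.elim_inr]
  rw [← h1, ← h2, Finset.sum_mul]
  refine IsHomogeneous.mul (IsHomogeneous.prod _ _ _ fun t _ => ?_)
    (IsHomogeneous.prod _ _ _ fun t _ => ?_)
  · rw [mul_comm]
    exact definingForm_isHomogeneous.pderiv.pow _
  · simpa using (isHomogeneous_X k t).pow (d (Sum.inr t))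

lemma evalGrad_component_eq_zero {p : MvPolynomial (ι ⊕ ι) k} (hp : reesEval a p = 0)
    (m : ℕ × ℕ) : evalGrad a (weightedHomogeneousComponent (biweight ι) m p) = 0 := by
  classical
  have hc (m : ℕ × ℕ) := weightedHomogeneousComponent_isWeightedHomogeneous (R := k)
    (w := biweight ι) m p
  let T := (weightedHomogeneousComponent_finsupp (w := biweight ι) p).toFinset
  have hsum : ∑ m ∈ T, weightedHomogeneousComponent (biweight ι) m p = p := by
    rw [← finsum_eq_sum _ (weightedHomogeneousComponent_finsupp p)]
    exact sum_weightedHomogeneousComponent _ p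
  rw [← hsum, map_sum] at hp
  have h1 := congrArg
    (fun q => homogeneousComponent (m.2 * (Fintype.card κ - 1) + m.1) (q.coeff m.2)) hp
  simp only [Polynomial.coeff_zero, map_zero, Polynomial.finsetSum_coeff, map_sum] at h1
  rw [← h1, Finset.sum_eq_single m]
  · rw [reesEval_of_isBihomogeneous (hc m), Polynomial.coeff_C_mul_X_pow, if_pos rfl,
      homogeneousComponent_of_mem (evalGrad_isHomogeneous (hc m)), if_pos rfl]
  · intro m' _ hm'
    rw [reesEval_of_isBihomogeneous (hc m'), Polynomial.coeff_C_mul_X_pow]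
    split_ifs with h
    · rw [homogeneousComponent_of_mem (evalGrad_isHomogeneous (hc m')), if_neg]
      intro h'
      rw [h] at h'
      exact hm' (Prod.ext (by omega) h.symm)
    · rw [map_zero]
  · intro hm
    have : weightedHomogeneousComponent (biweight ι) m p = 0 := by
      by_contra h
      exact hm ((Set.Finite.mem_toFinset _).mpr h)
    rw [this, map_zero, Polynomial.coeff_zero, map_zero]

theorem IsGeneric.ker_reesEval_le [Nonempty ι] (ha : IsGeneric a)
    (hn : Fintype.card ι ≤ Fintype.card κ) (hchar : (Fintype.card κ : k) ≠ 0) :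
    RingHom.ker (reesEval a) ≤ polarIdeal a := by
  intro p hp
  rw [← sum_weightedHomogeneousComponent (biweight ι) p,
    finsum_eq_sum _ (weightedHomogeneousComponent_finsupp p)]
  exact Ideal.sum_mem _ fun m _ => ha.mem_polarIdeal_of_evalGrad hn hchar
    (weightedHomogeneousComponent_isWeightedHomogeneous m p) (evalGrad_component_eq_zero hp m)

end Main

section LinearType

variable {A : Type*} [CommRing A]

/-- The ideal generated by the linear relations of a family. -/
noncomputable def linearRelations {m : ℕ} (f : Fin m → A) : Ideal (MvPolynomial (Fin m) A) :=
  Ideal.span {p | p ∈ RingHom.ker (reesPresentation f) ∧ p.IsHomogeneous 1}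

/-- The linear substitution with matrix `α`. -/
noncomputable def linearSubst {m n : ℕ} (α : Fin m → Fin n → A) :
    MvPolynomial (Fin m) A →ₐ[A] MvPolynomial (Fin n) A :=
  aeval fun i => ∑ j, C (α i j) * X j

lemma reesPresentation_linearSubst {m n : ℕ} {f : Fin m → A} {g : Fin n → A}
    {α : Fin m → Fin n → A} (h : ∀ i, ∑ j, α i j * g j = f i) (p : MvPolynomial (Fin m) A) :
    reesPresentation g (linearSubst α p) = reesPresentation f p := by
  rw [← AlgHom.comp_apply]
  congr 1
  ext1 i
  simp only [reesPresentation, linearSubst, AlgHom.comp_apply, aeval_X, map_sum, map_mul, algHom_C,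
    ← h i, Finset.sum_mul, mul_assoc]
  rfl

lemma linearSubst_isHomogeneous {m n : ℕ} (α : Fin m → Fin n → A) {p : MvPolynomial (Fin m) A}
    (hp : p.IsHomogeneous 1) : (linearSubst α p).IsHomogeneous 1 := by
  rw [← mul_one 1]
  refine hp.aeval _ fun i => IsHomogeneous.sum _ _ _ fun j _ => (isHomogeneous_X A j).C_mul _

/-- Whether the relations are generated by linear ones only depends on the ideal generated by the
family. -/
lemma ker_reesPresentation_le_of_span_eq {m n : ℕ} {f : Fin m → A} {g : Fin n → A}
    (h : Ideal.span (Set.range f) = Ideal.span (Set.range g))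
    (hg : RingHom.ker (reesPresentation g) ≤ linearRelations g) :
    RingHom.ker (reesPresentation f) ≤ linearRelations f := by
  have hα (i : Fin m) : ∃ c : Fin n → A, ∑ j, c j * g j = f i :=
    Ideal.mem_span_range_iff_exists_fun.mp (h ▸ Ideal.subset_span ⟨i, rfl⟩)
  have hβ (j : Fin n) : ∃ c : Fin m → A, ∑ i, c i * f i = g j :=
    Ideal.mem_span_range_iff_exists_fun.mp (h ▸ Ideal.subset_span ⟨j, rfl⟩)
  choose α hα using hα
  choose β hβ using hβ
  have hlin : linearRelations g ≤ (linearRelations f).comap (linearSubst β) := by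
    refine Ideal.span_le.mpr fun p ⟨hp, hp1⟩ => Ideal.subset_span ⟨?_, ?_⟩
    · rw [RingHom.mem_ker, reesPresentation_linearSubst hβ]
      exact hp
    · exact linearSubst_isHomogeneous β hp1
  have hsub (p : MvPolynomial (Fin m) A) :
      p - linearSubst β (linearSubst α p) ∈ linearRelations f := by
    rw [← Ideal.Quotient.mk_eq_mk_iff_sub_mem]
    have : Ideal.Quotient.mkₐ A (linearRelations f) =
        (Ideal.Quotient.mkₐ A (linearRelations f)).comp ((linearSubst β).comp (linearSubst α)) := by
      ext1 i
      refine (Ideal.Quotient.mk_eq_mk_iff_sub_mem _ _).mpr (Ideal.subset_span ⟨?_, ?_⟩)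
      · rw [RingHom.mem_ker, map_sub, sub_eq_zero]
        exact ((reesPresentation_linearSubst hβ _).trans (reesPresentation_linearSubst hα _)).symm
      · exact (isHomogeneous_X A i).sub (linearSubst_isHomogeneous β
          (linearSubst_isHomogeneous α (isHomogeneous_X A i)))
    exact DFunLike.congr_fun this p
  intro p hp
  rw [← sub_add_cancel p (linearSubst β (linearSubst α p))]
  refine Ideal.add_mem _ (hsub p) (hlin (hg ?_))
  rw [RingHom.mem_ker, reesPresentation_linearSubst hα]
  exact hp

lemma isLinearType_of_ker_le {n : ℕ} {g : Fin n → A}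
    (hg : RingHom.ker (reesPresentation g) ≤ linearRelations g) :
    (Ideal.span (Set.range g)).IsLinearType := fun _ _ hf =>
  le_antisymm (ker_reesPresentation_le_of_span_eq hf hg) (Ideal.span_le.mpr fun _ hp => hp.1)

end LinearType

section Transfer

variable {k : Type*} [Field k] {d n : ℕ} {a : Fin n → Fin d → k}

lemma sumAlgEquiv_isHomogeneous {ι : Type*} [Fintype ι] {p : MvPolynomial (ι ⊕ ι) k} {j r : ℕ}
    (hp : IsWeightedHomogeneous (biweight ι) p (j, r)) :
    (sumAlgEquiv k ι ι p).IsHomogeneous r := by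
  have h : sumAlgEquiv k ι ι p = aeval (Sum.elim X fun t => C (X t)) p := by
    change (sumAlgEquiv k ι ι).toAlgHom p = _
    congr 1
    ext1 t
    cases t <;> simp
  rw [h, aeval_def, eval₂_eq']
  refine IsHomogeneous.sum _ _ _ fun e he => ?_
  change (C (C (coeff e p)) * _).IsHomogeneous r
  refine IsHomogeneous.C_mul ?_ _
  obtain ⟨-, h2⟩ := sum_eq_of_mem_support hp he
  rw [Fintype.prod_sum_type, mul_comm]
  simp only [Sum.elim_inl, Sum.elim_inr, ← map_pow, ← map_prod]
  refine IsHomogeneous.C_mul ?_ _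
  rw [← h2]
  refine IsHomogeneous.prod _ _ _ fun t _ => ?_
  simpa using (isHomogeneous_X (MvPolynomial ι k) t).pow (e (Sum.inl t))

lemma reesPresentation_sumAlgEquiv (p : MvPolynomial (Fin d ⊕ Fin d) k) :
    reesPresentation (fun j => pderiv j (definingForm a)) (sumAlgEquiv k _ _ p) =
      reesEval a p := by
  change ((reesPresentation fun j => pderiv j (definingForm a)).restrictScalars k).comp
    (sumAlgEquiv k (Fin d) (Fin d)).toAlgHom p = _
  congr 1
  ext1 t
  cases t <;> simp [reesPresentation, reesEval]

theorem IsGeneric.isLinearType [NeZero d] (ha : IsGeneric a) (hn : d ≤ n) (hchar : (n : k) ≠ 0) :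
    (Ideal.span (Set.range fun j => pderiv j (definingForm a))).IsLinearType := by
  refine isLinearType_of_ker_le fun q hq => ?_
  have hle : polarIdeal a ≤ (linearRelations fun j => pderiv j (definingForm a)).comap
      (sumAlgEquiv k (Fin d) (Fin d)) := by
    refine Ideal.span_le.mpr ?_
    rintro _ ⟨⟨v, hv⟩, rfl⟩
    have h := ha.lt_nonvanishingCard hv
    rw [Fintype.card_fin, Fintype.card_fin] at h
    have hb := isBihomogeneous_polarRelation (a := a) (v := v) (by omega)
    refine Ideal.subset_span ⟨?_, sumAlgEquiv_isHomogeneous hb⟩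
    rw [RingHom.mem_ker, reesPresentation_sumAlgEquiv, reesEval_of_isBihomogeneous hb,
      evalGrad_polarRelation, map_zero, zero_mul]
  have hp : (sumAlgEquiv k (Fin d) (Fin d)).symm q ∈ polarIdeal a := by
    refine ha.ker_reesEval_le (by simpa using hn) (by simpa using hchar) ?_
    rw [RingHom.mem_ker, ← reesPresentation_sumAlgEquiv, AlgEquiv.apply_symm_apply]
    exact hq
  simpa using hle hp

lemma exists_linForm_eq {p : MvPolynomial (Fin d) k} (hp : p.IsHomogeneous 1) :
    ∃ c, linForm c = p := by
  refine ⟨fun t => coeff (Finsupp.single t 1) p, ?_⟩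
  have := hp.sum_X_mul_pderiv
  rw [one_smul] at this
  rw [linForm, Fintype.linearCombination_apply]
  refine Eq.trans (Finset.sum_congr rfl fun t _ => ?_) this
  have h0 : (pderiv t p).IsHomogeneous 0 := hp.pderiv
  rw [(totalDegree_eq_zero_iff_eq_C (p := pderiv t p)).mp
    (Nat.le_zero.mp h0.totalDegree_le), coeff_pderiv, smul_eq_C_mul, mul_comm]
  simp

lemma isGeneric_of_linearIndependent (hn : d ≤ n)
    (h : ∀ S : Finset (Fin n), S.card = d → LinearIndependent k fun i : S => linForm (a i)) :
    IsGeneric a := by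
  intro Z hZ
  rw [Fintype.card_fin] at hZ
  obtain ⟨S, hZS, -, hS⟩ := Finset.exists_subsuperset_card_eq (Finset.subset_univ Z) hZ
    (by simpa using hn)
  have h1 : LinearIndependent k fun i : S => a i :=
    LinearIndependent.of_comp (linForm (k := k) (ι := Fin d)) (h S hS)
  exact h1.comp (fun i : Z => (⟨i, hZS i.2⟩ : S)) fun i j hij =>
    Subtype.ext (Subtype.mk.inj hij)

end Transfer

end GenericArrangement

/-- Let `char k ∤ n` and let `F = ℓ_1⋯ℓ_n ∈ k[x_1,…,x_d]` define a generic
hyperplane arrangement of size `n ≥ d+1` (the `ℓ_i` are pairwise non-proportional linear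
forms, any `d` of which are linearly independent).  Then the gradient ideal
`J_F = (∂F/∂x_1,…,∂F/∂x_d)` is an ideal of linear type. -/
theorem statement4 {k : Type*} [Field k] {d n : ℕ} (hd : 1 ≤ d) (hn : d + 1 ≤ n)
    (hchar : (n : k) ≠ 0)
    (ℓ : Fin n → MvPolynomial (Fin d) k)
    (hlin : ∀ i, (ℓ i).IsHomogeneous 1)
    (hprop : ∀ i j, i ≠ j → ∀ c : k, ℓ i ≠ c • ℓ j)
    (hgen : ∀ S : Finset (Fin n), S.card = d →
      LinearIndependent k (fun i : S => ℓ (i : Fin n)))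
    (F : MvPolynomial (Fin d) k) (hF : F = ∏ i, ℓ i)
    (JF : Ideal (MvPolynomial (Fin d) k))
    (hJF : JF = Ideal.span (Set.range fun j : Fin d => MvPolynomial.pderiv j F)) :
    JF.IsLinearType := by
  choose a ha using fun i => GenericArrangement.exists_linForm_eq (hlin i)
  obtain rfl : (fun i => GenericArrangement.linForm (a i)) = ℓ := funext ha
  have : NeZero d := ⟨by omega⟩
  have hgen' := GenericArrangement.isGeneric_of_linearIndependent (by omega) hgen
  rw [hJF, hF]
  exact hgen'.isLinearType (by omega) hchar
end
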